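/- arXiv:1601.03332 — 2 statements merged into one kernel-verified Lean document; each statement's English description precedes it below -/
import Mathlib

section
/- There exist universal constants c, C ∈ (0, ∞) such that for every p ∈ [2, ∞), every n ∈ ℕ, every S ⊆ [n], and every h ∈ L_p^0({−1,1}^n), c·p^{−3/2}·‖Δ_S^{1/2} h‖_p ≤ ( 2^{−n} Σ_{δ ∈ {−1,1}^n} ‖Σ_{j∈S} δ_j ∂_j h‖_p^p )^{1/p} ≤ C·p^{3/2}·‖Δ_S^{1/2} h‖_p. -/
open Finset

/-- The normalized `L_p` norm of a function on the discrete hypercube `{-1,1}^n`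
(coordinates encoded by `Bool`). -/
noncomputable def pnorm {n : ℕ} (p : ℝ) (h : (Fin n → Bool) → ℝ) : ℝ :=
  ((∑ ε : Fin n → Bool, |h ε| ^ p) / 2 ^ n) ^ (1 / p)

/-- The Walsh function `W_A(ε) = Π_{j ∈ A} ε_j`. -/
def walsh {n : ℕ} (A : Finset (Fin n)) (ε : Fin n → Bool) : ℝ :=
  ∏ j ∈ A, (if ε j then (1 : ℝ) else -1)

/-- The Fourier–Walsh coefficient `ĥ(A) = 2^{-n} Σ_ε h(ε) W_A(ε)`. -/
noncomputable def fourierCoef {n : ℕ} (h : (Fin n → Bool) → ℝ) (A : Finset (Fin n)) : ℝ :=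
  (∑ ε : Fin n → Bool, h ε * walsh A ε) / 2 ^ n

/-- `Δ_S^α h = Σ_{A ∩ S ≠ ∅} |A ∩ S|^α ĥ(A) W_A`. -/
noncomputable def deltaPow {n : ℕ} (S : Finset (Fin n)) (α : ℝ) (h : (Fin n → Bool) → ℝ) :
    (Fin n → Bool) → ℝ :=
  fun ε => ∑ A : Finset (Fin n),
    if (A ∩ S).Nonempty then ((A ∩ S).card : ℝ) ^ α * fourierCoef h A * walsh A ε else 0

/-- `E_S h`: averaging of `h` over the coordinates in `S`. -/
noncomputable def condAvg {n : ℕ} (S : Finset (Fin n)) (h : (Fin n → Bool) → ℝ) :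
    (Fin n → Bool) → ℝ :=
  fun ε => (∑ δ : Fin n → Bool, h (fun j => if j ∈ S then δ j else ε j)) / 2 ^ n

/-- The hypercube partial derivative `∂_j h (ε) = h(ε) - h(ε with j-th coordinate flipped)`. -/
noncomputable def dflip {n : ℕ} (j : Fin n) (h : (Fin n → Bool) → ℝ) :
    (Fin n → Bool) → ℝ :=
  fun ε => h ε - h (Function.update ε j (!ε j))

/-- The `±1`-valued sign attached to a Boolean. -/
def boolSign (b : Bool) : ℝ := if b then 1 else -1

lemma boolSign_mul_self (b : Bool) : boolSign b * boolSign b = 1 := by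
  cases b <;> simp [boolSign]

/-- The point `ε` with its `j`-th coordinate flipped. -/
def cubeFlip {n : ℕ} (j : Fin n) (ε : Fin n → Bool) : Fin n → Bool :=
  Function.update ε j (!ε j)

lemma cubeFlip_cubeFlip {n : ℕ} (j : Fin n) (ε : Fin n → Bool) :
    cubeFlip j (cubeFlip j ε) = ε := by
  simp [cubeFlip]

lemma sum_cubeFlip {n : ℕ} (j : Fin n) (f : (Fin n → Bool) → ℝ) :
    ∑ ε, f (cubeFlip j ε) = ∑ ε, f ε :=
  Equiv.sum_comp (Function.Involutive.toPerm _ (cubeFlip_cubeFlip j)) f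

lemma dflip_apply {n : ℕ} (j : Fin n) (h : (Fin n → Bool) → ℝ) (ε : Fin n → Bool) :
    dflip j h ε = h ε - h (cubeFlip j ε) := rfl

lemma walsh_eq_prod_univ {n : ℕ} (A : Finset (Fin n)) (ε : Fin n → Bool) :
    walsh A ε = ∏ j, if j ∈ A then boolSign (ε j) else 1 := by
  simp [walsh, boolSign, Finset.prod_ite]

lemma walsh_cubeFlip {n : ℕ} (A : Finset (Fin n)) (j : Fin n) (ε : Fin n → Bool) :
    walsh A (cubeFlip j ε) = if j ∈ A then -walsh A ε else walsh A ε := by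
  have key : ∀ B : Finset (Fin n), j ∉ B → walsh B (cubeFlip j ε) = walsh B ε := by
    intro B hB
    refine Finset.prod_congr rfl fun i hi => ?_
    have : i ≠ j := fun h => hB (h ▸ hi)
    simp [cubeFlip, this]
  split_ifs with hj
  · have h1 : ∀ ε : Fin n → Bool, walsh A ε = boolSign (ε j) * walsh (A.erase j) ε := fun ε =>
      (Finset.mul_prod_erase A (fun i => if ε i then (1 : ℝ) else -1) hj).symm
    rw [h1, h1 ε, key _ (Finset.notMem_erase j A)]
    cases h : ε j <;> simp [cubeFlip, boolSign, h]
  · exact key A hj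

lemma dflip_walsh {n : ℕ} (A : Finset (Fin n)) (j : Fin n) (ε : Fin n → Bool) :
    dflip j (walsh A) ε = if j ∈ A then 2 * walsh A ε else 0 := by
  rw [dflip_apply, walsh_cubeFlip]
  split_ifs <;> ring

lemma sum_walsh_mul_walsh {n : ℕ} (ε δ : Fin n → Bool) :
    ∑ A, walsh A ε * walsh A δ = if ε = δ then (2 : ℝ) ^ n else 0 := by
  have h1 : ∑ A, walsh A ε * walsh A δ = ∏ j, (1 + boolSign (ε j) * boolSign (δ j)) := by
    rw [Finset.prod_one_add, Finset.powerset_univ]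
    refine Finset.sum_congr rfl fun A _ => ?_
    rw [Finset.prod_mul_distrib]
    rfl
  rw [h1]
  split_ifs with h
  · subst h
    simp only [boolSign_mul_self]
    norm_num
  · obtain ⟨j, hj⟩ := Function.ne_iff.1 h
    refine Finset.prod_eq_zero (Finset.mem_univ j) ?_
    revert hj
    cases ε j <;> cases δ j <;> simp [boolSign]

lemma sum_walsh_mul_walsh_eq_ite {n : ℕ} (A B : Finset (Fin n)) :
    ∑ ε, walsh A ε * walsh B ε = if A = B then (2 : ℝ) ^ n else 0 := by
  have h1 : ∑ ε, walsh A ε * walsh B ε =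
      ∏ j, ∑ b : Bool, (if j ∈ A then boolSign b else 1) * (if j ∈ B then boolSign b else 1) := by
    rw [Finset.prod_univ_sum, Fintype.piFinset_univ]
    refine Finset.sum_congr rfl fun ε _ => ?_
    rw [walsh_eq_prod_univ, walsh_eq_prod_univ, Finset.prod_mul_distrib]
  rw [h1]
  split_ifs with h
  · subst h
    have : ∀ j : Fin n, ∑ b : Bool, (if j ∈ A then boolSign b else 1) *
        (if j ∈ A then boolSign b else 1) = (2 : ℝ) := by
      intro j
      by_cases hj : j ∈ A
      · simp [hj, boolSign]
        norm_num
      · simp [hj]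
    rw [Finset.prod_congr rfl fun j _ => this j]
    simp
  · have : ∃ j, ¬(j ∈ A ↔ j ∈ B) := by
      by_contra! hc
      exact h (Finset.ext hc)
    obtain ⟨j, hj⟩ := this
    refine Finset.prod_eq_zero (Finset.mem_univ j) ?_
    by_cases hA : j ∈ A <;> by_cases hB : j ∈ B <;> simp_all [boolSign]

lemma sum_fourierCoef_mul_walsh {n : ℕ} (h : (Fin n → Bool) → ℝ) (ε : Fin n → Bool) :
    ∑ A, fourierCoef h A * walsh A ε = h ε := by
  have : ∀ A, fourierCoef h A * walsh A ε = ∑ δ, h δ * (walsh A δ * walsh A ε) / 2 ^ n := by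
    intro A
    rw [fourierCoef, div_mul_eq_mul_div, Finset.sum_mul, Finset.sum_div]
    exact Finset.sum_congr rfl fun δ _ => by ring
  simp_rw [this]
  rw [Finset.sum_comm]
  simp_rw [← Finset.sum_div, ← Finset.mul_sum, sum_walsh_mul_walsh]
  simp

lemma fourierCoef_sum_walsh {n : ℕ} (c : Finset (Fin n) → ℝ) (A : Finset (Fin n)) :
    fourierCoef (fun ε => ∑ B, c B * walsh B ε) A = c A := by
  have : ∑ ε, (∑ B, c B * walsh B ε) * walsh A ε =
      ∑ B, c B * ∑ ε, walsh B ε * walsh A ε := by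
    simp_rw [Finset.sum_mul, Finset.mul_sum]
    rw [Finset.sum_comm]
    simp_rw [mul_assoc]
  rw [fourierCoef, this]
  simp [sum_walsh_mul_walsh_eq_ite]

/-- The Fourier multiplier acting on `W_A` by `m(|A ∩ S|)`. -/
noncomputable def cubeMult {n : ℕ} (S : Finset (Fin n)) (m : ℕ → ℝ) (h : (Fin n → Bool) → ℝ) :
    (Fin n → Bool) → ℝ :=
  fun ε => ∑ A, m (A ∩ S).card * fourierCoef h A * walsh A ε

lemma fourierCoef_cubeMult {n : ℕ} (S : Finset (Fin n)) (m : ℕ → ℝ) (h : (Fin n → Bool) → ℝ)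
    (A : Finset (Fin n)) :
    fourierCoef (cubeMult S m h) A = m (A ∩ S).card * fourierCoef h A :=
  fourierCoef_sum_walsh (fun B => m (B ∩ S).card * fourierCoef h B) A

lemma cubeMult_cubeMult {n : ℕ} (S : Finset (Fin n)) (m m' : ℕ → ℝ)
    (h : (Fin n → Bool) → ℝ) :
    cubeMult S m (cubeMult S m' h) = cubeMult S (fun k => m k * m' k) h := by
  funext ε
  simp only [cubeMult.eq_1 S m, cubeMult.eq_1 S (fun k => m k * m' k), fourierCoef_cubeMult]
  exact Finset.sum_congr rfl fun A _ => by ring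

lemma cubeMult_one {n : ℕ} (S : Finset (Fin n)) (h : (Fin n → Bool) → ℝ) :
    cubeMult S (fun _ => 1) h = h := by
  funext ε
  simp only [cubeMult, one_mul, sum_fourierCoef_mul_walsh]

lemma fourierCoef_const_mul {n : ℕ} (t : ℝ) (f : (Fin n → Bool) → ℝ) (A : Finset (Fin n)) :
    fourierCoef (fun ε => t * f ε) A = t * fourierCoef f A := by
  simp only [fourierCoef, mul_assoc, ← Finset.mul_sum, mul_div_assoc]

lemma cubeMult_const_mul {n : ℕ} (S : Finset (Fin n)) (m : ℕ → ℝ) (t : ℝ)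
    (f : (Fin n → Bool) → ℝ) (ε : Fin n → Bool) :
    cubeMult S m (fun ε => t * f ε) ε = t * cubeMult S m f ε := by
  simp only [cubeMult, fourierCoef_const_mul, Finset.mul_sum]
  exact Finset.sum_congr rfl fun A _ => by ring

lemma fourierCoef_dflip {n : ℕ} (j : Fin n) (h : (Fin n → Bool) → ℝ) (A : Finset (Fin n)) :
    fourierCoef (dflip j h) A = if j ∈ A then 2 * fourierCoef h A else 0 := by
  have h1 : ∑ ε, dflip j h ε * walsh A ε = ∑ ε, h ε * dflip j (walsh A) ε := by
    simp only [dflip_apply, sub_mul, mul_sub, Finset.sum_sub_distrib]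
    congr 1
    rw [← sum_cubeFlip j]
    simp only [cubeFlip_cubeFlip]
  rw [fourierCoef, h1]
  simp only [dflip_walsh]
  split_ifs
  · rw [fourierCoef, mul_div_assoc', Finset.mul_sum]
    congr 1
    exact Finset.sum_congr rfl fun ε _ => by ring
  · simp

lemma dflip_cubeMult {n : ℕ} (S : Finset (Fin n)) (m : ℕ → ℝ) (j : Fin n)
    (h : (Fin n → Bool) → ℝ) : dflip j (cubeMult S m h) = cubeMult S m (dflip j h) := by
  funext ε
  simp only [dflip_apply, cubeMult, walsh_cubeFlip, fourierCoef_dflip, ← Finset.sum_sub_distrib]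
  refine Finset.sum_congr rfl fun A _ => ?_
  split_ifs <;> ring

lemma cubeMult_natCast {n : ℕ} (S : Finset (Fin n)) (h : (Fin n → Bool) → ℝ)
    (ε : Fin n → Bool) :
    cubeMult S (fun k => (k : ℝ)) h ε = (∑ j ∈ S, dflip j h ε) / 2 := by
  have h1 : ∀ j, dflip j h ε = ∑ A, (if j ∈ A then 2 * fourierCoef h A else 0) * walsh A ε := by
    intro j
    rw [← sum_fourierCoef_mul_walsh (dflip j h) ε]
    simp only [fourierCoef_dflip]
  simp_rw [h1]
  rw [Finset.sum_comm, Finset.sum_div]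
  refine Finset.sum_congr rfl fun A _ => ?_
  rw [← Finset.sum_mul, Finset.sum_ite_mem, Finset.sum_const, Finset.inter_comm, nsmul_eq_mul]
  ring

lemma sum_cubeMult_mul {n : ℕ} (S : Finset (Fin n)) (m : ℕ → ℝ) (f g : (Fin n → Bool) → ℝ) :
    ∑ ε, cubeMult S m f ε * g ε = ∑ ε, f ε * cubeMult S m g ε := by
  have h1 : ∀ f g : (Fin n → Bool) → ℝ, ∑ ε, cubeMult S m f ε * g ε =
      ∑ A, m (A ∩ S).card * fourierCoef f A * fourierCoef g A * 2 ^ n := by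
    intro f g
    simp only [cubeMult, Finset.sum_mul]
    rw [Finset.sum_comm]
    refine Finset.sum_congr rfl fun A _ => ?_
    rw [fourierCoef.eq_1 g, mul_assoc _ _ ((2 : ℝ) ^ n), div_mul_cancel₀ _ (by positivity),
      Finset.mul_sum]
    exact Finset.sum_congr rfl fun ε _ => by ring
  rw [h1]
  simp_rw [mul_comm (f _)]
  rw [h1]
  exact Finset.sum_congr rfl fun A _ => by ring

lemma cubeMult_const {n : ℕ} (S : Finset (Fin n)) (m : ℕ → ℝ) (ε : Fin n → Bool) :
    cubeMult S m (fun _ => 1) ε = m 0 := by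
  have h1 : (fun _ : Fin n → Bool => (1 : ℝ)) = walsh ∅ := by
    funext ε; simp [walsh]
  rw [h1]
  simp only [cubeMult, fourierCoef, sum_walsh_mul_walsh_eq_ite]
  simp [walsh, ite_div]

lemma deltaPow_half {n : ℕ} (S : Finset (Fin n)) (h : (Fin n → Bool) → ℝ) :
    deltaPow S (1 / 2) h = cubeMult S (fun k => √(k : ℝ)) h := by
  funext ε
  refine Finset.sum_congr rfl fun A _ => ?_
  simp only [Real.sqrt_eq_rpow]
  split_ifs with hA
  · rfl
  · simp [Finset.not_nonempty_iff_eq_empty.1 hA]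

lemma cubeMult_eq_sum_kernel {n : ℕ} (S : Finset (Fin n)) (m : ℕ → ℝ)
    (f : (Fin n → Bool) → ℝ) (ε : Fin n → Bool) :
    cubeMult S m f ε = ∑ δ, cubeMult S m (Pi.single δ 1) ε * f δ := by
  have h1 : ∀ δ A, fourierCoef (Pi.single δ (1 : ℝ)) A = walsh (n := n) A δ / 2 ^ n := by
    intro δ A
    simp [fourierCoef, Pi.single_apply]
  simp only [cubeMult, h1, Finset.sum_mul]
  rw [Finset.sum_comm]
  refine Finset.sum_congr rfl fun A _ => ?_
  rw [fourierCoef, Finset.sum_div, Finset.mul_sum, Finset.sum_mul]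
  exact Finset.sum_congr rfl fun δ _ => by ring

/-- The multiplier `m` preserves nonnegative functions on the cube. -/
def PosMult {n : ℕ} (S : Finset (Fin n)) (m : ℕ → ℝ) : Prop :=
  ∀ f : (Fin n → Bool) → ℝ, (∀ ε, 0 ≤ f ε) → ∀ ε, 0 ≤ cubeMult S m f ε

lemma cubeMult_add_left {n : ℕ} (S : Finset (Fin n)) (m m' : ℕ → ℝ) (f : (Fin n → Bool) → ℝ)
    (ε : Fin n → Bool) :
    cubeMult S (fun k => m k + m' k) f ε = cubeMult S m f ε + cubeMult S m' f ε := by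
  simp only [cubeMult, ← Finset.sum_add_distrib]
  exact Finset.sum_congr rfl fun A _ => by ring

lemma cubeMult_const_mul_left {n : ℕ} (S : Finset (Fin n)) (c : ℝ) (m : ℕ → ℝ)
    (f : (Fin n → Bool) → ℝ) (ε : Fin n → Bool) :
    cubeMult S (fun k => c * m k) f ε = c * cubeMult S m f ε := by
  simp only [cubeMult, Finset.mul_sum]
  exact Finset.sum_congr rfl fun A _ => by ring

lemma PosMult.add {n : ℕ} {S : Finset (Fin n)} {m m' : ℕ → ℝ} (h : PosMult S m)
    (h' : PosMult S m') : PosMult S (fun k => m k + m' k) := fun f hf ε => by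
  rw [cubeMult_add_left]
  exact add_nonneg (h f hf ε) (h' f hf ε)

lemma PosMult.const_mul {n : ℕ} {S : Finset (Fin n)} {m : ℕ → ℝ} (h : PosMult S m)
    {c : ℝ} (hc : 0 ≤ c) : PosMult S (fun k => c * m k) := fun f hf ε => by
  rw [cubeMult_const_mul_left]
  exact mul_nonneg hc (h f hf ε)

lemma PosMult.mul {n : ℕ} {S : Finset (Fin n)} {m m' : ℕ → ℝ} (h : PosMult S m)
    (h' : PosMult S m') : PosMult S (fun k => m k * m' k) := fun f hf ε => by
  rw [← cubeMult_cubeMult]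
  exact h _ (h' f hf) ε

lemma posMult_one {n : ℕ} (S : Finset (Fin n)) : PosMult S (fun _ => 1) := fun f hf ε => by
  rw [cubeMult_one]
  exact hf ε

lemma PosMult.pow {n : ℕ} {S : Finset (Fin n)} {m : ℕ → ℝ} (h : PosMult S m) (i : ℕ) :
    PosMult S (fun k => m k ^ i) := by
  induction i with
  | zero => simpa using posMult_one S
  | succ i ih => simpa only [pow_succ] using ih.mul h

lemma PosMult.of_tendsto {n : ℕ} {S : Finset (Fin n)} {m : ℕ → ℕ → ℝ} {l : ℕ → ℝ}
    (h : ∀ i, PosMult S (m i))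
    (hl : ∀ k ≤ n, Filter.Tendsto (fun i => m i k) Filter.atTop (nhds (l k))) :
    PosMult S l := by
  intro f hf ε
  have h1 : Filter.Tendsto (fun i => cubeMult S (m i) f ε) Filter.atTop
      (nhds (cubeMult S l f ε)) := by
    refine tendsto_finsetSum _ fun A _ => ?_
    refine ((hl _ ?_).mul_const _).mul_const _
    exact (Finset.card_le_univ _).trans_eq (Fintype.card_fin n)
  exact ge_of_tendsto' h1 fun i => h i f hf ε

lemma PosMult.exp {n : ℕ} {S : Finset (Fin n)} {m : ℕ → ℝ} (h : PosMult S m) :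
    PosMult S (fun k => Real.exp (m k)) := by
  have hpart : ∀ i, PosMult S (fun k => ∑ a ∈ Finset.range i, (m k) ^ a / a.factorial) := by
    intro i
    induction i with
    | zero =>
      intro f hf ε
      simp [cubeMult]
    | succ i ih =>
      simp only [Finset.sum_range_succ]
      refine ih.add ?_
      simpa only [div_eq_inv_mul] using (h.pow i).const_mul (c := ((i.factorial : ℝ))⁻¹)
        (by positivity)
  refine PosMult.of_tendsto hpart fun k _ => ?_
  rw [Real.exp_eq_exp_ℝ]
  exact (NormedSpace.expSeries_div_hasSum_exp (m k)).tendsto_sum_nat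

lemma posMult_one_sub_div {n : ℕ} (S : Finset (Fin n)) :
    PosMult S (fun k => 1 - (k : ℝ) / (n + 1)) := by
  intro f hf ε
  have h1 : cubeMult S (fun k => 1 - (k : ℝ) / (n + 1)) f ε =
      f ε + (-(1 / ((n : ℝ) + 1))) * ((∑ j ∈ S, dflip j f ε) / 2) := by
    have h := cubeMult_add_left S (fun _ => 1) (fun k => -(1 / ((n : ℝ) + 1)) * k) f ε
    rw [cubeMult_one, cubeMult_const_mul_left, cubeMult_natCast] at h
    rw [← h]
    congr 1
    funext k
    ring
  have h2 : ∑ j ∈ S, dflip j f ε ≤ n * f ε := by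
    calc ∑ j ∈ S, dflip j f ε ≤ ∑ j ∈ S, f ε := by
          refine Finset.sum_le_sum fun j _ => ?_
          rw [dflip_apply]
          linarith [hf (cubeFlip j ε)]
      _ = S.card * f ε := by simp
      _ ≤ n * f ε := by
          have : S.card ≤ n := (Finset.card_le_univ _).trans_eq (Fintype.card_fin n)
          have : (S.card : ℝ) ≤ n := by exact_mod_cast this
          exact mul_le_mul_of_nonneg_right this (hf ε)
  have hn : (0 : ℝ) < n + 1 := by positivity
  have h3 := hf ε
  rw [h1]
  have h4 : (1 / ((n : ℝ) + 1)) * ((∑ j ∈ S, dflip j f ε) / 2) ≤ f ε := by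
    rw [one_div, inv_mul_le_iff₀ hn]
    nlinarith [mul_nonneg (Nat.cast_nonneg (α := ℝ) n) h3]
  linarith

/-- Iterates converging to `1 - √(1 - x)`. -/
noncomputable def sqrtIter (x : ℝ) : ℕ → ℝ
  | 0 => 0
  | i + 1 => (x + sqrtIter x i ^ 2) / 2

lemma sqrtIter_tendsto {x : ℝ} (h0 : 0 ≤ x) (h1 : x ≤ 1) :
    Filter.Tendsto (sqrtIter x) Filter.atTop (nhds (1 - √(1 - x))) := by
  set a := 1 - √(1 - x) with ha
  have hs : √(1 - x) ^ 2 = 1 - x := Real.sq_sqrt (by linarith)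
  have hs0 : 0 ≤ √(1 - x) := Real.sqrt_nonneg _
  have ha2 : a = (x + a ^ 2) / 2 := by nlinarith
  have ha1 : a ≤ 1 := by linarith
  have ha0 : 0 ≤ a := by nlinarith
  have hb : ∀ i, 0 ≤ sqrtIter x i ∧ sqrtIter x i ≤ a := by
    intro i
    induction i with
    | zero => exact ⟨le_rfl, ha0⟩
    | succ i ih =>
      refine ⟨by simp only [sqrtIter]; positivity, ?_⟩
      simp only [sqrtIter]
      nlinarith [pow_le_pow_left₀ ih.1 ih.2 2]
  have hm : Monotone (sqrtIter x) := by
    refine monotone_nat_of_le_succ fun i => ?_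
    induction i with
    | zero => exact (hb 1).1
    | succ i ih =>
      simp only [sqrtIter] at ih ⊢
      have := pow_le_pow_left₀ (hb i).1 ih 2
      linarith
  have hbdd : BddAbove (Set.range (sqrtIter x)) := ⟨a, by rintro _ ⟨i, rfl⟩; exact (hb i).2⟩
  have ht := tendsto_atTop_ciSup hm hbdd
  set L := ⨆ i, sqrtIter x i with hL
  have hLa : L ≤ a := ciSup_le fun i => (hb i).2
  have ht2 : Filter.Tendsto (fun i => sqrtIter x (i + 1)) Filter.atTop
      (nhds ((x + L ^ 2) / 2)) := by
    simp only [sqrtIter]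
    exact ((ht.pow 2).const_add x).div_const 2
  have hfix : L = (x + L ^ 2) / 2 :=
    tendsto_nhds_unique ((Filter.tendsto_add_atTop_iff_nat 1).2 ht) ht2
  have : L = a := by
    have : (a - L) * (2 - a - L) = 0 := by nlinarith
    rcases mul_eq_zero.1 this with h | h <;> linarith
  rwa [← this]

lemma posMult_exp_neg_sqrt {n : ℕ} (S : Finset (Fin n)) {y : ℝ} (hy : 0 ≤ y) :
    PosMult S (fun k => Real.exp (-(y * √k))) := by
  have hn : (0 : ℝ) < n + 1 := by positivity
  have hiter : ∀ i, PosMult S (fun k => sqrtIter (1 - (k : ℝ) / (n + 1)) i) := by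
    intro i
    induction i with
    | zero =>
      intro f hf ε
      simp [cubeMult, sqrtIter]
    | succ i ih =>
      have := ((posMult_one_sub_div S).add (ih.pow 2)).const_mul (c := 1 / 2) (by norm_num)
      convert this using 2 with k
      simp only [sqrtIter]
      ring
  have h1 : PosMult S (fun k => 1 - √((k : ℝ) / (n + 1))) := by
    refine PosMult.of_tendsto hiter fun k hk => ?_
    have hk' : (k : ℝ) ≤ n := by exact_mod_cast hk
    have := sqrtIter_tendsto (x := 1 - (k : ℝ) / (n + 1))
      (by rw [sub_nonneg, div_le_one hn]; linarith)
      (by rw [sub_le_self_iff]; positivity)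
    simpa using this
  have h2 := ((h1.const_mul (c := y * √(n + 1)) (by positivity)).exp).const_mul
    (c := Real.exp (-(y * √(n + 1)))) (Real.exp_nonneg _)
  convert h2 using 2 with k
  rw [← Real.exp_add, Real.sqrt_div (Nat.cast_nonneg k)]
  congr 1
  have : √((n : ℝ) + 1) ≠ 0 := (Real.sqrt_pos.2 hn).ne'
  field_simp
  ring

/-- The convex region `{(x, r) : |x| ≤ r ^ β, r ≥ 0}`. -/
def powRegion {ι : Type*} (s : Finset ι) (β : ℝ) : Set ((ι → ℝ) × ℝ) :=
  {z | 0 ≤ z.2 ∧ ∑ i ∈ s, z.1 i ^ 2 ≤ (z.2 ^ β) ^ 2}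

lemma convex_powRegion {ι : Type*} (s : Finset ι) {β : ℝ} (h0 : 0 ≤ β) (h1 : β ≤ 1) :
    Convex ℝ (powRegion s β) := by
  rintro ⟨x, r⟩ ⟨hr, hx⟩ ⟨y, t⟩ ⟨ht, hy⟩ a b ha hb hab
  simp only at hr hx ht hy
  refine ⟨by simp only [Prod.smul_mk, Prod.mk_add_mk, smul_eq_mul]; positivity, ?_⟩
  simp only [Prod.smul_mk, Prod.mk_add_mk, smul_eq_mul, Pi.add_apply, Pi.smul_apply]
  have hR : 0 ≤ r ^ β := by positivity
  have hT : 0 ≤ t ^ β := by positivity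
  have hconc : a * r ^ β + b * t ^ β ≤ (a * r + b * t) ^ β := by
    have := (Real.concaveOn_rpow h0 h1).2 (x := r) (y := t) hr ht ha hb hab
    simpa using this
  have hcs : ∑ i ∈ s, x i * y i ≤ r ^ β * t ^ β := by
    refine abs_le_of_sq_le_sq' ?_ (by positivity) |>.2
    calc (∑ i ∈ s, x i * y i) ^ 2 ≤ (∑ i ∈ s, x i ^ 2) * ∑ i ∈ s, y i ^ 2 :=
          Finset.sum_mul_sq_le_sq_mul_sq s x y
      _ ≤ (r ^ β) ^ 2 * (t ^ β) ^ 2 := by gcongr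
      _ = _ := by ring
  calc ∑ i ∈ s, (a * x i + b * y i) ^ 2
      = a ^ 2 * ∑ i ∈ s, x i ^ 2 + 2 * (a * b) * ∑ i ∈ s, x i * y i +
          b ^ 2 * ∑ i ∈ s, y i ^ 2 := by
        simp only [Finset.mul_sum, ← Finset.sum_add_distrib]
        exact Finset.sum_congr rfl fun i _ => by ring
    _ ≤ a ^ 2 * (r ^ β) ^ 2 + 2 * (a * b) * (r ^ β * t ^ β) + b ^ 2 * (t ^ β) ^ 2 := by
        gcongr
    _ = (a * r ^ β + b * t ^ β) ^ 2 := by ring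
    _ ≤ _ := by gcongr

/-- The function `|x|² r^α + B r^q`. -/
noncomputable def energyFun {ι : Type*} (s : Finset ι) (q α B : ℝ) (x : ι → ℝ) (r : ℝ) : ℝ :=
  ∑ i ∈ s, x i ^ 2 * r ^ α + B * r ^ q

/-- The differential of `energyFun`. -/
noncomputable def energyDiff {ι : Type*} (s : Finset ι) (q α B : ℝ) (x : ι → ℝ) (r : ℝ)
    (u : ι → ℝ) (d : ℝ) : ℝ :=
  ∑ i ∈ s, (2 * x i * u i * r ^ α + x i ^ 2 * (α * r ^ (α - 1) * d)) + B * (q * r ^ (q - 1) * d)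

/-- The Hessian quadratic form of `energyFun`. -/
noncomputable def energyHess {ι : Type*} (s : Finset ι) (q α B : ℝ) (x : ι → ℝ) (r : ℝ)
    (u : ι → ℝ) (d : ℝ) : ℝ :=
  ∑ i ∈ s, (2 * u i ^ 2 * r ^ α + 4 * x i * u i * (α * r ^ (α - 1) * d) +
    x i ^ 2 * (α * (α - 1) * r ^ (α - 2) * d ^ 2)) + B * (q * (q - 1) * r ^ (q - 2) * d ^ 2)

lemma hasDerivAt_rpow_comp {r : ℝ → ℝ} {r' t : ℝ} (a : ℝ) (hr : HasDerivAt r r' t)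
    (h0 : 0 < r t) : HasDerivAt (fun t => r t ^ a) (a * r t ^ (a - 1) * r') t := by
  exact (hr.rpow_const (p := a) (Or.inl h0.ne')).congr_deriv (by ring)

lemma hasDerivAt_energyFun {ι : Type*} (s : Finset ι) (q α B : ℝ) {x : ℝ → ι → ℝ} {r : ℝ → ℝ}
    {x' : ι → ℝ} {r' t : ℝ} (hx : ∀ i ∈ s, HasDerivAt (fun t => x t i) (x' i) t)
    (hr : HasDerivAt r r' t) (h0 : 0 < r t) :
    HasDerivAt (fun t => energyFun s q α B (x t) (r t))
      (energyDiff s q α B (x t) (r t) x' r') t := by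
  refine HasDerivAt.add (HasDerivAt.fun_sum fun i hi => ?_)
    ((hasDerivAt_rpow_comp q hr h0).const_mul B)
  exact (((hx i hi).pow 2).mul (hasDerivAt_rpow_comp α hr h0)).congr_deriv (by simp)

lemma hasDerivAt_energyDiff {ι : Type*} (s : Finset ι) (q α B : ℝ) {x x' : ℝ → ι → ℝ}
    {r r' : ℝ → ℝ} {x'' : ι → ℝ} {r'' t : ℝ}
    (hx : ∀ i ∈ s, HasDerivAt (fun t => x t i) (x' t i) t)
    (hx' : ∀ i ∈ s, HasDerivAt (fun t => x' t i) (x'' i) t)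
    (hr : HasDerivAt r (r' t) t) (hr' : HasDerivAt r' r'' t) (h0 : 0 < r t) :
    HasDerivAt (fun t => energyDiff s q α B (x t) (r t) (x' t) (r' t))
      (energyHess s q α B (x t) (r t) (x' t) (r' t) +
        energyDiff s q α B (x t) (r t) x'' r'') t := by
  have h1 : ∀ a : ℝ, HasDerivAt (fun t => a * r t ^ (a - 1) * r' t)
      (a * (a - 1) * r t ^ (a - 2) * r' t ^ 2 + a * r t ^ (a - 1) * r'') t := by
    intro a
    refine (((hasDerivAt_rpow_comp (a - 1) hr h0).const_mul a).mul hr').congr_deriv ?_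
    rw [show a - 1 - 1 = a - 2 by ring]
    ring
  have h2 : energyHess s q α B (x t) (r t) (x' t) (r' t) +
        energyDiff s q α B (x t) (r t) x'' r'' =
      ∑ i ∈ s, (2 * ((x' t i * x' t i + x t i * x'' i) * r t ^ α +
        x t i * x' t i * (α * r t ^ (α - 1) * r' t)) + (2 * x t i * x' t i *
        (α * r t ^ (α - 1) * r' t) + x t i ^ 2 *
        (α * (α - 1) * r t ^ (α - 2) * r' t ^ 2 + α * r t ^ (α - 1) * r''))) +
      B * (q * (q - 1) * r t ^ (q - 2) * r' t ^ 2 + q * r t ^ (q - 1) * r'') := by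
    rw [energyHess, energyDiff, add_add_add_comm, ← Finset.sum_add_distrib]
    congr 1
    · exact Finset.sum_congr rfl fun i _ => by ring
    · ring
  rw [h2]
  refine HasDerivAt.add (HasDerivAt.fun_sum fun i hi => HasDerivAt.add ?_ ?_)
    ((h1 q).const_mul B)
  · refine ((((hx i hi).mul (hx' i hi)).mul (hasDerivAt_rpow_comp α hr h0)).const_mul
      2).congr_of_eventuallyEq (Filter.Eventually.of_forall fun t => ?_)
    simp only [Pi.mul_apply]
    ring
  · refine (((hx i hi).pow 2).mul (h1 α)).congr_deriv ?_
    simp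

/-- Admissible exponents for the energy function. -/
structure EnergyExponents (q α β B : ℝ) : Prop where
  one_lt : 1 < q
  abs_le : |α| ≤ 1
  nonneg : 0 ≤ β
  le_one : β ≤ 1
  add_eq : α + 2 * β = q
  five_le : 5 ≤ B * (q - 1)

lemma EnergyExponents.const_nonneg {q α β B : ℝ} (hE : EnergyExponents q α β B) : 0 ≤ B := by
  have h1 := hE.one_lt
  have h2 := hE.five_le
  by_contra! h
  nlinarith

lemma le_energyHess {ι : Type*} (s : Finset ι) {q α β B : ℝ} (hE : EnergyExponents q α β B)
    {x : ι → ℝ} {r : ℝ} (hr : 0 < r) (hx : (x, r) ∈ powRegion s β) (u : ι → ℝ) (d : ℝ) :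
    r ^ α * ∑ i ∈ s, u i ^ 2 ≤ energyHess s q α B x r u d := by
  obtain ⟨hα1, hα2⟩ := abs_le.1 hE.abs_le
  have hq := hE.one_lt
  have e1 : r ^ (α - 1) = r ^ α * r⁻¹ := by
    rw [Real.rpow_sub hr, Real.rpow_one, div_eq_mul_inv]
  have e2 : r ^ (α - 2) = r ^ α * r⁻¹ ^ 2 := by
    rw [Real.rpow_sub hr, Real.rpow_ofNat, div_eq_mul_inv, inv_pow]
  have hA : 0 < r ^ α := Real.rpow_pos_of_pos hr α
  have h1 : ∀ i ∈ s, r ^ α * u i ^ 2 - 5 * (r ^ (α - 2) * d ^ 2) * x i ^ 2 ≤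
      2 * u i ^ 2 * r ^ α + 4 * x i * u i * (α * r ^ (α - 1) * d) +
        x i ^ 2 * (α * (α - 1) * r ^ (α - 2) * d ^ 2) := by
    intro i _
    rw [e1, e2, ← sub_nonneg]
    have : 0 ≤ r ^ α * ((u i + 2 * α * x i * r⁻¹ * d) ^ 2 +
        (5 + α * (α - 1) - 4 * α ^ 2) * (x i * r⁻¹ * d) ^ 2) := by
      have : 0 ≤ 5 + α * (α - 1) - 4 * α ^ 2 := by nlinarith
      positivity
    calc _ ≤ _ := this
      _ = _ := by ring
  have h2 : r ^ (α - 2) * ∑ i ∈ s, x i ^ 2 ≤ r ^ (q - 2) := by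
    calc r ^ (α - 2) * ∑ i ∈ s, x i ^ 2 ≤ r ^ (α - 2) * (r ^ β) ^ 2 := by
          gcongr
          exact hx.2
      _ = r ^ (q - 2) := by
          rw [← Real.rpow_natCast (r ^ β), ← Real.rpow_mul hr.le, ← Real.rpow_add hr]
          congr 1
          rw [← hE.add_eq]
          push_cast
          ring
  have h3 : 5 * (r ^ (q - 2) * d ^ 2) ≤ B * (q * (q - 1) * r ^ (q - 2) * d ^ 2) := by
    have : 5 ≤ B * (q - 1) * q := by nlinarith [hE.five_le]
    have h0 : 0 ≤ r ^ (q - 2) * d ^ 2 := by positivity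
    nlinarith [mul_le_mul_of_nonneg_right this h0]
  have h4 : 5 * (r ^ (α - 2) * d ^ 2) * ∑ i ∈ s, x i ^ 2 ≤ 5 * (r ^ (q - 2) * d ^ 2) := by
    nlinarith [mul_le_mul_of_nonneg_right h2 (sq_nonneg d)]
  have h5 := Finset.sum_le_sum h1
  rw [Finset.sum_sub_distrib, ← Finset.mul_sum, ← Finset.mul_sum] at h5
  rw [energyHess]
  linarith

lemma le_rpow_segment {α r r' t : ℝ} (hα : |α| ≤ 1) (hr : 0 < r) (hr' : 0 < r') (h0 : 0 < t)
    (h1 : t < 1) : (if r ≤ r' then t else 1 - t) * max r r' ^ α ≤ (r + t * (r' - r)) ^ α := by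
  obtain ⟨hα1, hα2⟩ := abs_le.1 hα
  have aux : ∀ c M v : ℝ, 0 < c → c < 1 → 0 < M → c * M ≤ v → v ≤ M → c * M ^ α ≤ v ^ α := by
    intro c M v hc hc1 hM hv hvM
    have hv0 : 0 < v := lt_of_lt_of_le (mul_pos hc hM) hv
    rcases le_total 0 α with h | h
    · calc c * M ^ α = c ^ (1 : ℝ) * M ^ α := by rw [Real.rpow_one]
        _ ≤ c ^ α * M ^ α := by
            gcongr ?_ * _
            exact Real.rpow_le_rpow_of_exponent_ge hc hc1.le hα2
        _ = (c * M) ^ α := (Real.mul_rpow hc.le hM.le).symm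
        _ ≤ v ^ α := by gcongr
    · calc c * M ^ α ≤ M ^ α := mul_le_of_le_one_left (by positivity) hc1.le
        _ ≤ v ^ α := Real.rpow_le_rpow_of_nonpos hv0 hvM h
  split_ifs with h
  · rw [max_eq_right h]
    exact aux t r' _ h0 h1 hr' (by nlinarith) (by nlinarith)
  · push Not at h
    rw [max_eq_left h.le]
    exact aux (1 - t) r _ (by linarith) (by linarith) hr (by nlinarith) (by nlinarith)

lemma le_energyDiff_sub {ι : Type*} (s : Finset ι) {q α β B : ℝ}
    (hE : EnergyExponents q α β B) {x x' : ι → ℝ} {r r' : ℝ} (hr : 0 < r) (hr' : 0 < r')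
    (hx : (x, r) ∈ powRegion s β) (hx' : (x', r') ∈ powRegion s β) :
    max r r' ^ α * (∑ i ∈ s, (x' i - x i) ^ 2) / 2 ≤
      energyDiff s q α B x' r' (fun i => x' i - x i) (r' - r) -
        energyDiff s q α B x r (fun i => x' i - x i) (r' - r) := by
  set u : ι → ℝ := fun i => x' i - x i with hu
  set d := r' - r with hd
  set X : ℝ → ι → ℝ := fun t i => x i + t * u i with hX
  set R : ℝ → ℝ := fun t => r + t * d with hR
  set Q := max r r' ^ α * (∑ i ∈ s, u i ^ 2) with hQ
  have hQ0 : 0 ≤ Q := by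
    have : 0 < max r r' := lt_max_of_lt_left hr
    have : 0 ≤ ∑ i ∈ s, u i ^ 2 := Finset.sum_nonneg fun i _ => sq_nonneg _
    positivity
  have hRpos : ∀ t ∈ Set.Icc (0 : ℝ) 1, 0 < R t := by
    rintro t ⟨h0, h1⟩
    simp only [hR, hd]
    rcases h0.eq_or_lt with rfl | h0
    · simpa using hr
    · nlinarith [mul_pos h0 hr', mul_nonneg (sub_nonneg.2 h1) hr.le]
  have hmem : ∀ t ∈ Set.Icc (0 : ℝ) 1, (X t, R t) ∈ powRegion s β := by
    rintro t ⟨h0, h1⟩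
    have := convex_powRegion s hE.nonneg hE.le_one hx hx' (sub_nonneg.2 h1) h0 (by ring)
    convert this using 1
    refine Prod.ext ?_ ?_
    · funext i
      simp only [hX, hu, Prod.smul_mk, Prod.mk_add_mk, Pi.add_apply, Pi.smul_apply, smul_eq_mul]
      ring
    · simp only [hR, hd, Prod.smul_mk, Prod.mk_add_mk, smul_eq_mul]
      ring
  have hder : ∀ t ∈ Set.Icc (0 : ℝ) 1, HasDerivAt (fun t => energyDiff s q α B (X t) (R t) u d)
      (energyHess s q α B (X t) (R t) u d) t := by
    intro t ht
    have h1 : ∀ i ∈ s, HasDerivAt (fun t => X t i) (u i) t := fun i _ =>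
      (((hasDerivAt_id t).mul_const (u i)).const_add (x i)).congr_deriv (one_mul _)
    have h2 : HasDerivAt R d t :=
      (((hasDerivAt_id t).mul_const d).const_add r).congr_deriv (one_mul _)
    have := hasDerivAt_energyDiff s q α B (x' := fun _ => u) (r' := fun _ => d)
      (x'' := fun _ => 0) (r'' := 0) h1 (fun i _ => hasDerivAt_const t (u i)) h2
      (hasDerivAt_const t d) (hRpos t ht)
    refine this.congr_deriv ?_
    simp [energyDiff]
  -- an antiderivative of the lower bound for the Hessian along the segment
  set w : ℝ → ℝ := fun t => if r ≤ r' then t else 1 - t with hw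
  set W : ℝ → ℝ := fun t => if r ≤ r' then t ^ 2 / 2 else t - t ^ 2 / 2 with hW
  have hWder : ∀ t, HasDerivAt W (w t) t := by
    intro t
    simp only [hW, hw]
    split_ifs
    · exact (((hasDerivAt_id t).pow 2).div_const 2).congr_deriv (by simp)
    · exact ((hasDerivAt_id t).sub (((hasDerivAt_id t).pow 2).div_const 2)).congr_deriv
        (by simp)
  set G : ℝ → ℝ := fun t => energyDiff s q α B (X t) (R t) u d - W t * Q with hG
  have hGder : ∀ t ∈ Set.Icc (0 : ℝ) 1, HasDerivAt G
      (energyHess s q α B (X t) (R t) u d - w t * Q) t :=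
    fun t ht => (hder t ht).sub ((hWder t).mul_const Q)
  have hmono : MonotoneOn G (Set.Icc 0 1) := by
    refine monotoneOn_of_deriv_nonneg (convex_Icc 0 1)
      (fun t ht => (hGder t ht).continuousAt.continuousWithinAt)
      (fun t ht => (hGder t (interior_subset ht)).differentiableAt.differentiableWithinAt)
      fun t ht => ?_
    rw [(hGder t (interior_subset ht)).deriv, sub_nonneg]
    have ht' := interior_subset ht
    rw [interior_Icc] at ht
    refine le_trans ?_ (le_energyHess s hE (hRpos t ht') (hmem t ht') u d)
    rw [hQ, ← mul_assoc]
    exact mul_le_mul_of_nonneg_right (le_rpow_segment hE.abs_le hr hr' ht.1 ht.2)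
      (Finset.sum_nonneg fun i _ => sq_nonneg _)
  have hfin := hmono (Set.left_mem_Icc.2 zero_le_one) (Set.right_mem_Icc.2 zero_le_one)
    zero_le_one
  have hX1 : X 1 = x' := by funext i; simp [hX, hu]
  have hX0 : X 0 = x := by funext i; simp [hX]
  have hR1 : R 1 = r' := by simp [hR, hd]
  have hR0 : R 0 = r := by simp [hR]
  have hWd : W 1 - W 0 = 1 / 2 := by
    simp only [hW]
    split_ifs <;> norm_num
  simp only [hG, hX1, hX0, hR1, hR0] at hfin
  have : W 1 * Q - W 0 * Q = Q / 2 := by rw [← sub_mul, hWd]; ring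
  linarith

/-- The Poisson semigroup `exp(-y Δ_S^{1/2})` on the cube. -/
noncomputable def cubePoisson {n : ℕ} (S : Finset (Fin n)) (y : ℝ) (f : (Fin n → Bool) → ℝ) :
    (Fin n → Bool) → ℝ :=
  cubeMult S (fun k => Real.exp (-(y * √k))) f

/-- The derivative in `y` of the Poisson semigroup. -/
noncomputable def cubePoissonDeriv {n : ℕ} (S : Finset (Fin n)) (y : ℝ)
    (f : (Fin n → Bool) → ℝ) : (Fin n → Bool) → ℝ :=
  cubeMult S (fun k => -√k * Real.exp (-(y * √k))) f

lemma hasDerivAt_cubeMult {n : ℕ} (S : Finset (Fin n)) {m : ℝ → ℕ → ℝ} {m' : ℕ → ℝ} {y : ℝ}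
    (hm : ∀ k, HasDerivAt (fun y => m y k) (m' k) y) (f : (Fin n → Bool) → ℝ)
    (ε : Fin n → Bool) :
    HasDerivAt (fun y => cubeMult S (m y) f ε) (cubeMult S m' f ε) y :=
  HasDerivAt.fun_sum fun _ _ => ((hm _).mul_const _).mul_const _

lemma hasDerivAt_exp_neg_mul (y a : ℝ) :
    HasDerivAt (fun y => Real.exp (-(y * a))) (-a * Real.exp (-(y * a))) y :=
  (((hasDerivAt_id y).mul_const a).neg.exp).congr_deriv (by simp [mul_comm])

lemma hasDerivAt_cubePoisson {n : ℕ} (S : Finset (Fin n)) (y : ℝ) (f : (Fin n → Bool) → ℝ)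
    (ε : Fin n → Bool) :
    HasDerivAt (fun y => cubePoisson S y f ε) (cubePoissonDeriv S y f ε) y :=
  hasDerivAt_cubeMult S (fun k => hasDerivAt_exp_neg_mul y √k) f ε

lemma hasDerivAt_cubePoissonDeriv {n : ℕ} (S : Finset (Fin n)) (y : ℝ)
    (f : (Fin n → Bool) → ℝ) (ε : Fin n → Bool) :
    HasDerivAt (fun y => cubePoissonDeriv S y f ε)
      ((∑ j ∈ S, dflip j (cubePoisson S y f) ε) / 2) y := by
  rw [← cubeMult_natCast, cubePoisson, cubeMult_cubeMult]
  refine hasDerivAt_cubeMult S (fun k => ?_) f ε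
  refine ((hasDerivAt_exp_neg_mul y √k).const_mul (-√k)).congr_deriv ?_
  rw [← mul_assoc, neg_mul_neg, Real.mul_self_sqrt (Nat.cast_nonneg k)]

lemma cubePoisson_zero {n : ℕ} (S : Finset (Fin n)) (f : (Fin n → Bool) → ℝ) :
    cubePoisson S 0 f = f := by
  simp [cubePoisson, cubeMult_one]

lemma cubePoisson_mem {n : ℕ} {ι : Type*} (S : Finset (Fin n)) {y : ℝ} (hy : 0 ≤ y)
    {K : Set ((ι → ℝ) × ℝ)} (hK : Convex ℝ K) {f : ι → (Fin n → Bool) → ℝ}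
    {φ : (Fin n → Bool) → ℝ} (h : ∀ ε, (fun i => f i ε, φ ε) ∈ K) (ε : Fin n → Bool) :
    (fun i => cubePoisson S y (f i) ε, cubePoisson S y φ ε) ∈ K := by
  set π : (Fin n → Bool) → ℝ := fun δ => cubePoisson S y (Pi.single δ 1) ε with hπ
  have hπ0 : ∀ δ ∈ Finset.univ, 0 ≤ π δ := fun δ _ =>
    posMult_exp_neg_sqrt S hy _ (fun ε => by
      by_cases h : ε = δ
      · subst h; simp
      · simp [h]) ε
  have hker : ∀ g, cubePoisson S y g ε = ∑ δ, π δ * g δ := fun g =>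
    cubeMult_eq_sum_kernel S _ g ε
  have hπ1 : ∑ δ, π δ = 1 := by
    have := hker fun _ => 1
    rw [cubePoisson, cubeMult_const] at this
    simpa using this.symm
  have := hK.sum_mem hπ0 hπ1 (fun δ _ => h δ)
  convert this using 1
  refine Prod.ext ?_ ?_
  · funext i
    simp [hker, Prod.fst_sum]
  · simp [hker, Prod.snd_sum]

lemma energyDiff_smul_sum {ι κ : Type*} (s : Finset ι) (q α B : ℝ) (x : ι → ℝ) (r : ℝ)
    (T : Finset κ) (c : ℝ) (u : κ → ι → ℝ) (d : κ → ℝ) :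
    energyDiff s q α B x r (fun i => (∑ j ∈ T, u j i) * c) ((∑ j ∈ T, d j) * c) =
      (∑ j ∈ T, energyDiff s q α B x r (u j) (d j)) * c := by
  simp only [energyDiff, Finset.sum_add_distrib, add_mul, Finset.mul_sum, Finset.sum_mul]
  congr 1
  congr 1
  · rw [Finset.sum_comm]
    exact Finset.sum_congr rfl fun j _ => Finset.sum_congr rfl fun i _ => by ring
  · rw [Finset.sum_comm]
    exact Finset.sum_congr rfl fun j _ => Finset.sum_congr rfl fun i _ => by ring
  · exact Finset.sum_congr rfl fun i _ => by ring

lemma energyDiff_neg {ι : Type*} (s : Finset ι) (q α B : ℝ) (x : ι → ℝ) (r : ℝ)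
    (u : ι → ℝ) (d : ℝ) :
    energyDiff s q α B x r (fun i => -u i) (-d) = -energyDiff s q α B x r u d := by
  simp only [energyDiff, neg_add, ← Finset.sum_neg_distrib]
  congr 1
  · exact Finset.sum_congr rfl fun i _ => by ring
  · ring

lemma energyFun_nonneg {ι : Type*} (s : Finset ι) {q α B : ℝ} (hB : 0 ≤ B) (x : ι → ℝ)
    {r : ℝ} (hr : 0 ≤ r) : 0 ≤ energyFun s q α B x r := by
  have : 0 ≤ ∑ i ∈ s, x i ^ 2 * r ^ α := Finset.sum_nonneg fun i _ => by positivity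
  unfold energyFun
  positivity

lemma energyFun_le {ι : Type*} (s : Finset ι) {q α β B : ℝ} (hE : EnergyExponents q α β B)
    {x : ι → ℝ} {r : ℝ} (hr : 0 < r) (hx : (x, r) ∈ powRegion s β) :
    energyFun s q α B x r ≤ (1 + B) * r ^ q := by
  have : ∑ i ∈ s, x i ^ 2 * r ^ α ≤ r ^ q := by
    calc ∑ i ∈ s, x i ^ 2 * r ^ α = (∑ i ∈ s, x i ^ 2) * r ^ α := by rw [Finset.sum_mul]
      _ ≤ (r ^ β) ^ 2 * r ^ α := by
          gcongr
          exact hx.2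
      _ = r ^ q := by
          rw [← Real.rpow_natCast (r ^ β), ← Real.rpow_mul hr.le, ← Real.rpow_add hr]
          congr 1
          rw [← hE.add_eq]
          push_cast
          ring
  unfold energyFun
  linarith

/-- The total energy of the Poisson extensions of `f` and `φ` at height `y`. -/
noncomputable def poissonEnergy {n : ℕ} {ι : Type*} (S : Finset (Fin n)) (s : Finset ι)
    (q α B : ℝ) (f : ι → (Fin n → Bool) → ℝ) (φ : (Fin n → Bool) → ℝ) (y : ℝ) : ℝ :=
  ∑ ε, energyFun s q α B (fun i => cubePoisson S y (f i) ε) (cubePoisson S y φ ε)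

lemma convex_snd_Ici {ι : Type*} (η : ℝ) : Convex ℝ {z : (ι → ℝ) × ℝ | η ≤ z.2} :=
  convex_halfSpace_ge (LinearMap.snd ℝ (ι → ℝ) ℝ).isLinear η

lemma convex_snd_Iic {ι : Type*} (η : ℝ) : Convex ℝ {z : (ι → ℝ) × ℝ | z.2 ≤ η} :=
  convex_halfSpace_le (LinearMap.snd ℝ (ι → ℝ) ℝ).isLinear η

lemma le_cubePoisson {n : ℕ} (S : Finset (Fin n)) {y η : ℝ} (hy : 0 ≤ y)
    {φ : (Fin n → Bool) → ℝ} (h : ∀ ε, η ≤ φ ε) (ε : Fin n → Bool) :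
    η ≤ cubePoisson S y φ ε :=
  cubePoisson_mem S hy (convex_snd_Ici (ι := Empty) η) (f := fun _ _ => 0) h ε

lemma cubePoisson_le {n : ℕ} (S : Finset (Fin n)) {y η : ℝ} (hy : 0 ≤ y)
    {φ : (Fin n → Bool) → ℝ} (h : ∀ ε, φ ε ≤ η) (ε : Fin n → Bool) :
    cubePoisson S y φ ε ≤ η :=
  cubePoisson_mem S hy (convex_snd_Iic (ι := Empty) η) (f := fun _ _ => 0) h ε

section

variable {n : ℕ} {ι : Type*} {S : Finset (Fin n)} {s : Finset ι} {q α β B η : ℝ}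
  {f : ι → (Fin n → Bool) → ℝ} {φ : (Fin n → Bool) → ℝ}

lemma poissonEnergy_nonneg (hE : EnergyExponents q α β B) (hη : 0 < η) (hφ : ∀ ε, η ≤ φ ε)
    {y : ℝ} (hy : 0 ≤ y) : 0 ≤ poissonEnergy S s q α B f φ y :=
  Finset.sum_nonneg fun ε _ => energyFun_nonneg s hE.const_nonneg _
    (hη.le.trans (le_cubePoisson S hy hφ ε))

lemma poissonEnergy_zero_le (hE : EnergyExponents q α β B) (hη : 0 < η) (hφ : ∀ ε, η ≤ φ ε)
    (hf : ∀ ε, (fun i => f i ε, φ ε) ∈ powRegion s β) :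
    poissonEnergy S s q α B f φ 0 ≤ (1 + B) * ∑ ε, φ ε ^ q := by
  rw [poissonEnergy, Finset.mul_sum]
  simp only [cubePoisson_zero]
  exact Finset.sum_le_sum fun ε _ => energyFun_le s hE (hη.trans_le (hφ ε)) (hf ε)

lemma exists_poissonEnergy_le (hE : EnergyExponents q α β B) (hη : 0 < η) (hφ : ∀ ε, η ≤ φ ε)
    (hf : ∀ ε, (fun i => f i ε, φ ε) ∈ powRegion s β) :
    ∃ M, ∀ y, 0 ≤ y → poissonEnergy S s q α B f φ y ≤ M := by
  have hφ0 : ∀ ε, 0 ≤ φ ε := fun ε => hη.le.trans (hφ ε)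
  refine ⟨∑ _ε : Fin n → Bool, (1 + B) * (∑ ε, φ ε) ^ q, fun y hy => ?_⟩
  refine Finset.sum_le_sum fun ε _ => ?_
  have hpos : 0 < cubePoisson S y φ ε := hη.trans_le (le_cubePoisson S hy hφ ε)
  refine (energyFun_le s hE hpos
    (cubePoisson_mem S hy (convex_powRegion s hE.nonneg hE.le_one) hf ε)).trans ?_
  have := hE.const_nonneg
  have := hE.one_lt
  have : cubePoisson S y φ ε ≤ ∑ ε, φ ε :=
    cubePoisson_le S hy (fun ε => Finset.single_le_sum (fun δ _ => hφ0 δ) (Finset.mem_univ ε)) ε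
  gcongr

lemma sum_energyDiff_dflip_ge (hE : EnergyExponents q α β B) (hη : 0 < η)
    (hφ : ∀ ε, η ≤ φ ε) (hf : ∀ ε, (fun i => f i ε, φ ε) ∈ powRegion s β) (j : Fin n) :
    (∑ ε, max (φ ε) (φ (cubeFlip j ε)) ^ α * ∑ i ∈ s, dflip j (f i) ε ^ 2) / 4 ≤
      ∑ ε, energyDiff s q α B (fun i => f i ε) (φ ε) (fun i => dflip j (f i) ε)
        (dflip j φ ε) := by
  set X : (Fin n → Bool) → ℝ := fun ε =>
    energyDiff s q α B (fun i => f i ε) (φ ε) (fun i => dflip j (f i) ε) (dflip j φ ε) with hX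
  set Y : (Fin n → Bool) → ℝ := fun ε =>
    energyDiff s q α B (fun i => f i (cubeFlip j ε)) (φ (cubeFlip j ε))
      (fun i => dflip j (f i) ε) (dflip j φ ε) with hY
  have h1 : ∑ ε, X ε = -∑ ε, Y ε := by
    rw [← sum_cubeFlip j, ← Finset.sum_neg_distrib]
    refine Finset.sum_congr rfl fun ε _ => ?_
    simp only [hX, hY, ← energyDiff_neg, dflip_apply, cubeFlip_cubeFlip, neg_sub]
  have h2 : ∑ ε, X ε = (∑ ε, (X ε - Y ε)) / 2 := by
    rw [Finset.sum_sub_distrib]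
    linarith
  rw [h2, Finset.sum_div, Finset.sum_div]
  refine Finset.sum_le_sum fun ε _ => ?_
  have := le_energyDiff_sub s hE (hη.trans_le (hφ (cubeFlip j ε))) (hη.trans_le (hφ ε))
    (hf (cubeFlip j ε)) (hf ε)
  rw [max_comm] at this
  simp only [hX, hY, dflip_apply]
  linarith

lemma exists_poissonEnergy_deriv (hE : EnergyExponents q α β B) (hη : 0 < η)
    (hφ : ∀ ε, η ≤ φ ε) (hf : ∀ ε, (fun i => f i ε, φ ε) ∈ powRegion s β) :
    ∃ b' b'' : ℝ → ℝ, ∀ y, 0 ≤ y →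
      HasDerivAt (poissonEnergy S s q α B f φ) (b' y) y ∧ HasDerivAt b' (b'' y) y ∧
      ∑ ε, cubePoisson S y φ ε ^ α * ∑ i ∈ s, cubePoissonDeriv S y (f i) ε ^ 2 +
        (∑ j ∈ S, ∑ ε, max (cubePoisson S y φ ε) (cubePoisson S y φ (cubeFlip j ε)) ^ α *
          ∑ i ∈ s, dflip j (cubePoisson S y (f i)) ε ^ 2) / 8 ≤ b'' y := by
  refine ⟨fun y => ∑ ε, energyDiff s q α B (fun i => cubePoisson S y (f i) ε)
      (cubePoisson S y φ ε) (fun i => cubePoissonDeriv S y (f i) ε) (cubePoissonDeriv S y φ ε),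
    fun y => ∑ ε, (energyHess s q α B (fun i => cubePoisson S y (f i) ε)
      (cubePoisson S y φ ε) (fun i => cubePoissonDeriv S y (f i) ε) (cubePoissonDeriv S y φ ε) +
      energyDiff s q α B (fun i => cubePoisson S y (f i) ε) (cubePoisson S y φ ε)
        (fun i => (∑ j ∈ S, dflip j (cubePoisson S y (f i)) ε) / 2)
        ((∑ j ∈ S, dflip j (cubePoisson S y φ) ε) / 2)), fun y hy => ?_⟩
  have hφy := le_cubePoisson S hy hφ
  have hfy := cubePoisson_mem S hy (convex_powRegion s hE.nonneg hE.le_one) hf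
  refine ⟨?_, ?_, ?_⟩
  · exact HasDerivAt.fun_sum fun ε _ => hasDerivAt_energyFun s q α B
      (fun i _ => hasDerivAt_cubePoisson S y (f i) ε) (hasDerivAt_cubePoisson S y φ ε)
      (hη.trans_le (hφy ε))
  · exact HasDerivAt.fun_sum fun ε _ => hasDerivAt_energyDiff s q α B
      (x := fun y i => cubePoisson S y (f i) ε) (x' := fun y i => cubePoissonDeriv S y (f i) ε)
      (fun i _ => hasDerivAt_cubePoisson S y (f i) ε)
      (fun i _ => hasDerivAt_cubePoissonDeriv S y (f i) ε)
      (hasDerivAt_cubePoisson S y φ ε) (hasDerivAt_cubePoissonDeriv S y φ ε)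
      (hη.trans_le (hφy ε))
  · beta_reduce
    rw [Finset.sum_add_distrib]
    refine add_le_add (Finset.sum_le_sum fun ε _ =>
      le_energyHess s hE (hη.trans_le (hφy ε)) (hfy ε) _ _) ?_
    simp only [div_eq_mul_inv _ (2 : ℝ), energyDiff_smul_sum]
    rw [← Finset.sum_mul, Finset.sum_comm (s := Finset.univ), Finset.sum_div, Finset.sum_mul]
    refine Finset.sum_le_sum fun j _ => ?_
    have := sum_energyDiff_dflip_ge hE hη hφy hfy j
    linarith

end

lemma le_of_second_deriv_le {b b' b'' e e' e'' : ℝ → ℝ} {M : ℝ}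
    (hb : ∀ y, 0 ≤ y → HasDerivAt b (b' y) y) (hb' : ∀ y, 0 ≤ y → HasDerivAt b' (b'' y) y)
    (he : ∀ y, 0 ≤ y → HasDerivAt e (e' y) y) (he' : ∀ y, 0 ≤ y → HasDerivAt e' (e'' y) y)
    (h0 : ∀ y, 0 ≤ y → 0 ≤ b y) (hM : ∀ y, 0 ≤ y → b y ≤ M)
    (hlim : Filter.Tendsto e Filter.atTop (nhds 0)) (hle : ∀ y, 0 ≤ y → e'' y ≤ b'' y) :
    e 0 ≤ b 0 := by
  have hr : ∀ y, 0 ≤ y → HasDerivAt (fun y => b y - e y) (b' y - e' y) y := fun y hy =>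
    (hb y hy).sub (he y hy)
  have hr' : ∀ y, 0 ≤ y → HasDerivAt (fun y => b' y - e' y) (b'' y - e'' y) y := fun y hy =>
    (hb' y hy).sub (he' y hy)
  have hmono : MonotoneOn (fun y => b' y - e' y) (Set.Ici 0) :=
    monotoneOn_of_deriv_nonneg (convex_Ici 0)
      (fun y hy => (hr' y hy).continuousAt.continuousWithinAt)
      (fun y hy => (hr' y (interior_subset hy)).differentiableAt.differentiableWithinAt)
      fun y hy => by
        rw [(hr' y (interior_subset hy)).deriv, sub_nonneg]
        exact hle y (interior_subset hy)
  have hev : ∀ᶠ y in Filter.atTop, -1 ≤ e y :=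
    (hlim.eventually (lt_mem_nhds (by norm_num : (-1 : ℝ) < 0))).mono fun y hy => hy.le
  have hneg : ∀ y, 0 ≤ y → b' y - e' y ≤ 0 := by
    intro y₀ hy₀
    by_contra! hc
    set c := b' y₀ - e' y₀ with hcdef
    have hder : ∀ y, 0 ≤ y →
        HasDerivAt (fun y => b y - e y - c * y) (b' y - e' y - c) y := fun y hy =>
      ((hr y hy).sub ((hasDerivAt_id y).const_mul c)).congr_deriv (by ring)
    have hm : MonotoneOn (fun y => b y - e y - c * y) (Set.Ici y₀) := by
      refine monotoneOn_of_deriv_nonneg (convex_Ici y₀)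
        (fun y hy => (hder y (hy₀.trans hy)).continuousAt.continuousWithinAt)
        (fun y hy => (hder y
          (hy₀.trans (interior_subset hy))).differentiableAt.differentiableWithinAt)
        fun y hy => ?_
      have hy' : y₀ ≤ y := interior_subset hy
      rw [(hder y (hy₀.trans hy')).deriv, sub_nonneg]
      exact hmono hy₀ (hy₀.trans hy' : (0 : ℝ) ≤ y) hy'
    have hbig : Filter.Tendsto (fun y => c * y) Filter.atTop Filter.atTop :=
      Filter.tendsto_id.const_mul_atTop hc
    obtain ⟨y, h1, h2, h3⟩ := (hev.and ((Filter.eventually_ge_atTop y₀).and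
      (hbig.eventually_gt_atTop (M + 1 - (b y₀ - e y₀ - c * y₀))))).exists
    have h4 := hm (Set.mem_Ici.2 le_rfl) (Set.mem_Ici.2 h2) h2
    have h5 := hM y (hy₀.trans h2)
    beta_reduce at h4
    linarith
  have hanti : AntitoneOn (fun y => b y - e y) (Set.Ici 0) :=
    antitoneOn_of_deriv_nonpos (convex_Ici 0)
      (fun y hy => (hr y hy).continuousAt.continuousWithinAt)
      (fun y hy => (hr y (interior_subset hy)).differentiableAt.differentiableWithinAt)
      fun y hy => by
        rw [(hr y (interior_subset hy)).deriv]
        exact hneg y (interior_subset hy)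
  have hlast : ∀ᶠ y in Filter.atTop, -(b 0 - e 0) ≤ e y := by
    filter_upwards [Filter.eventually_ge_atTop 0] with y hy
    have h4 := hanti (Set.mem_Ici.2 le_rfl) (Set.mem_Ici.2 hy) hy
    have h5 := h0 y hy
    beta_reduce at h4
    linarith
  have := ge_of_tendsto hlim hlast
  linarith

/-- The pairing of `exp(-2 y Δ_S^{1/2}) f` with `g`. -/
noncomputable def poissonPairing {n : ℕ} (S : Finset (Fin n)) (f g : (Fin n → Bool) → ℝ)
    (y : ℝ) : ℝ :=
  ∑ ε, cubeMult S (fun k => Real.exp (-(y * (2 * √k)))) f ε * g ε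

lemma poissonPairing_zero {n : ℕ} (S : Finset (Fin n)) (f g : (Fin n → Bool) → ℝ) :
    poissonPairing S f g 0 = ∑ ε, f ε * g ε := by
  simp [poissonPairing, cubeMult_one]

lemma poissonPairing_tendsto {n : ℕ} (S : Finset (Fin n)) {f : (Fin n → Bool) → ℝ}
    (hf : ∀ A : Finset (Fin n), A ∩ S = ∅ → fourierCoef f A = 0) (g : (Fin n → Bool) → ℝ) :
    Filter.Tendsto (poissonPairing S f g) Filter.atTop (nhds 0) := by
  have : (0 : ℝ) = ∑ ε : Fin n → Bool, (∑ A : Finset (Fin n), 0 * walsh A ε) * g ε := by simp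
  rw [this]
  refine tendsto_finsetSum _ fun ε _ => (tendsto_finsetSum _ fun A _ =>
    Filter.Tendsto.mul_const _ ?_).mul_const _
  by_cases hA : A ∩ S = ∅
  · simp [hf A hA]
  · have hpos : 0 < 2 * √((A ∩ S).card : ℝ) := mul_pos two_pos
      (Real.sqrt_pos.2 (Nat.cast_pos.2 (Finset.card_pos.2 (Finset.nonempty_iff_ne_empty.2 hA))))
    rw [← zero_mul (fourierCoef f A)]
    refine Filter.Tendsto.mul_const _ ?_
    exact Real.tendsto_exp_neg_atTop_nhds_zero.comp (Filter.tendsto_id.atTop_mul_const hpos)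

lemma hasDerivAt_poissonPairing {n : ℕ} (S : Finset (Fin n)) (f g : (Fin n → Bool) → ℝ)
    (y : ℝ) :
    HasDerivAt (poissonPairing S f g)
      (∑ ε, cubeMult S (fun k => -(2 * √k) * Real.exp (-(y * (2 * √k)))) f ε * g ε) y :=
  HasDerivAt.fun_sum fun ε _ => (hasDerivAt_cubeMult S
    (fun k => hasDerivAt_exp_neg_mul y (2 * √k)) f ε).mul_const _

lemma hasDerivAt_poissonPairing_deriv {n : ℕ} (S : Finset (Fin n))
    (f g : (Fin n → Bool) → ℝ) (y : ℝ) :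
    HasDerivAt (fun y => ∑ ε, cubeMult S (fun k => -(2 * √k) * Real.exp (-(y * (2 * √k)))) f ε *
        g ε)
      (4 * ∑ ε, cubePoissonDeriv S y f ε * cubePoissonDeriv S y g ε) y := by
  have h1 : 4 * ∑ ε, cubePoissonDeriv S y f ε * cubePoissonDeriv S y g ε =
      ∑ ε, cubeMult S (fun k => -(2 * √k) * (-(2 * √k) * Real.exp (-(y * (2 * √k))))) f ε *
        g ε := by
    simp only [cubePoissonDeriv]
    rw [← sum_cubeMult_mul, cubeMult_cubeMult, Finset.mul_sum]
    refine Finset.sum_congr rfl fun ε _ => ?_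
    rw [← mul_assoc, ← cubeMult_const_mul_left]
    congr 3
    funext k
    rw [show -(y * (2 * √(k : ℝ))) = -(y * √k) + -(y * √k) by ring, Real.exp_add]
    ring
  rw [h1]
  exact HasDerivAt.fun_sum fun ε _ => (hasDerivAt_cubeMult S
    (fun k => (hasDerivAt_exp_neg_mul y (2 * √k)).const_mul _) f ε).mul_const _

/-- Integration by parts: the vertical and horizontal parts of the Poisson energy agree. -/
lemma four_mul_sum_cubePoissonDeriv_mul {n : ℕ} (S : Finset (Fin n))
    (f g : (Fin n → Bool) → ℝ) (y : ℝ) :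
    4 * ∑ ε, cubePoissonDeriv S y f ε * cubePoissonDeriv S y g ε =
      ∑ j ∈ S, ∑ ε, dflip j (cubePoisson S y f) ε * dflip j (cubePoisson S y g) ε := by
  have h1 : ∑ ε, cubePoissonDeriv S y f ε * cubePoissonDeriv S y g ε =
      ∑ ε, cubeMult S (fun k => (k : ℝ)) (cubePoisson S y f) ε * cubePoisson S y g ε := by
    simp only [cubePoissonDeriv, cubePoisson]
    rw [← sum_cubeMult_mul, ← sum_cubeMult_mul, cubeMult_cubeMult, cubeMult_cubeMult,
      cubeMult_cubeMult]
    refine Finset.sum_congr rfl fun ε _ => ?_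
    congr 3
    funext k
    have := Real.mul_self_sqrt (Nat.cast_nonneg (α := ℝ) k)
    calc _ = √(k : ℝ) * √k * (Real.exp (-(y * √k)) * Real.exp (-(y * √k))) := by ring
      _ = _ := by rw [this]; ring
  rw [h1]
  simp only [cubeMult_natCast, Finset.sum_div, Finset.sum_mul, Finset.mul_sum]
  rw [Finset.sum_comm]
  refine Finset.sum_congr rfl fun j _ => ?_
  set F := cubePoisson S y f
  set G := cubePoisson S y g
  have h2 : ∑ ε, dflip j F ε * G (cubeFlip j ε) = -∑ ε, dflip j F ε * G ε := by
    rw [← sum_cubeFlip j, ← Finset.sum_neg_distrib]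
    refine Finset.sum_congr rfl fun ε _ => ?_
    simp only [dflip_apply, cubeFlip_cubeFlip]
    ring
  have h3 : ∑ ε, dflip j F ε * dflip j G ε =
      ∑ ε, dflip j F ε * G ε - ∑ ε, dflip j F ε * G (cubeFlip j ε) := by
    rw [← Finset.sum_sub_distrib]
    exact Finset.sum_congr rfl fun ε _ => by rw [dflip_apply j G, mul_sub]
  rw [h3, h2, sub_neg_eq_add, ← two_mul, Finset.mul_sum]
  exact Finset.sum_congr rfl fun ε _ => by ring

lemma dflip_cubePoisson_sqrt {n : ℕ} (S : Finset (Fin n)) (y : ℝ) (h : (Fin n → Bool) → ℝ)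
    (j : Fin n) (ε : Fin n → Bool) :
    dflip j (cubePoisson S y (cubeMult S (fun k => √(k : ℝ)) h)) ε =
      -cubePoissonDeriv S y (dflip j h) ε := by
  rw [cubePoisson, cubeMult_cubeMult, dflip_cubeMult, cubePoissonDeriv, neg_eq_neg_one_mul,
    ← cubeMult_const_mul_left]
  congr 1
  funext k
  ring

/-- The lower bound for the second derivative of the Poisson energy. -/
noncomputable def poissonSquare {n : ℕ} {ι : Type*} (S : Finset (Fin n)) (s : Finset ι) (α : ℝ)
    (f : ι → (Fin n → Bool) → ℝ) (φ : (Fin n → Bool) → ℝ) (y : ℝ) : ℝ :=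
  ∑ ε, cubePoisson S y φ ε ^ α * ∑ i ∈ s, cubePoissonDeriv S y (f i) ε ^ 2 +
    (∑ j ∈ S, ∑ ε, max (cubePoisson S y φ ε) (cubePoisson S y φ (cubeFlip j ε)) ^ α *
      ∑ i ∈ s, dflip j (cubePoisson S y (f i)) ε ^ 2) / 8

lemma le_of_second_deriv_le_poissonSquare {n : ℕ} {ι κ : Type*} {S : Finset (Fin n)}
    {s : Finset ι} {t : Finset κ} {q α β α' β' B η : ℝ} {f : ι → (Fin n → Bool) → ℝ}
    {g : κ → (Fin n → Bool) → ℝ} {φ : (Fin n → Bool) → ℝ}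
    (hE : EnergyExponents q α β B) (hE' : EnergyExponents q α' β' B) (hη : 0 < η)
    (hφ : ∀ ε, η ≤ φ ε) (hf : ∀ ε, (fun i => f i ε, φ ε) ∈ powRegion s β)
    (hg : ∀ ε, (fun i => g i ε, φ ε) ∈ powRegion t β') {e e' e'' : ℝ → ℝ}
    (he : ∀ y, 0 ≤ y → HasDerivAt e (e' y) y) (he' : ∀ y, 0 ≤ y → HasDerivAt e' (e'' y) y)
    (hlim : Filter.Tendsto e Filter.atTop (nhds 0))
    (hle : ∀ y, 0 ≤ y →
      e'' y ≤ 16 * (poissonSquare S s α f φ y + poissonSquare S t α' g φ y)) :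
    e 0 ≤ 32 * (1 + B) * ∑ ε, φ ε ^ q := by
  obtain ⟨b', b'', hb⟩ := exists_poissonEnergy_deriv hE hη hφ hf
  obtain ⟨c', c'', hc⟩ := exists_poissonEnergy_deriv hE' hη hφ hg
  obtain ⟨M, hM⟩ := exists_poissonEnergy_le hE hη hφ hf
  obtain ⟨M', hM'⟩ := exists_poissonEnergy_le hE' hη hφ hg
  have key := le_of_second_deriv_le
    (b := fun y => 16 * (poissonEnergy S s q α B f φ y + poissonEnergy S t q α' B g φ y))
    (M := 16 * (M + M'))
    (fun y hy => ((hb y hy).1.add (hc y hy).1).const_mul 16)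
    (fun y hy => ((hb y hy).2.1.add (hc y hy).2.1).const_mul 16) he he'
    (fun y hy => by
      have := poissonEnergy_nonneg (S := S) (s := s) (f := f) hE hη hφ hy
      have := poissonEnergy_nonneg (S := S) (s := t) (f := g) hE' hη hφ hy
      positivity)
    (fun y hy => by
      have := hM y hy
      have := hM' y hy
      linarith)
    hlim fun y hy => (hle y hy).trans (mul_le_mul_of_nonneg_left
      (add_le_add (hb y hy).2.2 (hc y hy).2.2) (by norm_num))
  have h1 := poissonEnergy_zero_le (S := S) hE hη hφ hf
  have h2 := poissonEnergy_zero_le (S := S) hE' hη hφ hg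
  beta_reduce at key
  linarith

lemma energyExponents_two_sub {p : ℝ} (hp : 2 ≤ p) :
    EnergyExponents (p / (p - 1)) (2 - p / (p - 1)) (p / (p - 1) - 1) (5 * (p - 1)) := by
  have h0 : 0 < p - 1 := by linarith
  have h : p / (p - 1) = 1 + 1 / (p - 1) := by field_simp; ring
  have h1 : 0 < 1 / (p - 1) := by positivity
  have h2 : 1 / (p - 1) ≤ 1 := by
    rw [div_le_one h0]
    linarith
  have h3 : (p - 1) * (1 / (p - 1)) = 1 := by field_simp
  rw [h]
  refine ⟨by linarith, abs_le.2 ⟨by linarith, by linarith⟩, by linarith, by linarith, by ring, ?_⟩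
  rw [mul_assoc, add_sub_cancel_left, h3, mul_one]

lemma energyExponents_sub_two {p : ℝ} (hp : 2 ≤ p) :
    EnergyExponents (p / (p - 1)) (p / (p - 1) - 2) 1 (5 * (p - 1)) := by
  have h := energyExponents_two_sub hp
  refine ⟨h.one_lt, ?_, zero_le_one, le_rfl, by ring, h.five_le⟩
  rw [abs_sub_comm]
  exact h.abs_le

lemma two_mul_abs_mul_le {r a b : ℝ} (hr : 0 < r) (α : ℝ) :
    2 * |a * b| ≤ r ^ α * a ^ 2 + r ^ (-α) * b ^ 2 := by
  have hw : 0 < r ^ α := Real.rpow_pos_of_pos hr α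
  rw [Real.rpow_neg hr.le, abs_mul]
  have h : 0 ≤ r ^ α * (|a| - (r ^ α)⁻¹ * |b|) ^ 2 := by positivity
  have h1 : r ^ α * (|a| - (r ^ α)⁻¹ * |b|) ^ 2 =
      r ^ α * |a| ^ 2 + (r ^ α)⁻¹ * |b| ^ 2 - 2 * (|a| * |b|) := by
    field_simp
    ring
  rw [sq_abs, sq_abs] at h1
  linarith

section

variable {n : ℕ} (S : Finset (Fin n)) (h : (Fin n → Bool) → ℝ) {p η : ℝ}
  {φ : (Fin n → Bool) → ℝ}

lemma sum_dflip_mul_le (hp : 2 ≤ p) (v : Fin n → (Fin n → Bool) → ℝ) (hη : 0 < η)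
    (hφ : ∀ ε, η ≤ φ ε)
    (hk : ∀ ε, |cubeMult S (fun k => √(k : ℝ)) h ε| ≤ φ ε ^ (p / (p - 1) - 1))
    (hv : ∀ ε, ∑ j ∈ S, v j ε ^ 2 ≤ φ ε ^ 2) :
    ∑ j ∈ S, ∑ ε, dflip j h ε * v j ε ≤ 160 * p * ∑ ε, φ ε ^ (p / (p - 1)) := by
  set q := p / (p - 1) with hq
  have hφ0 : ∀ ε, 0 ≤ φ ε := fun ε => hη.le.trans (hφ ε)
  have key := le_of_second_deriv_le_poissonSquare (S := S) (s := {()}) (t := S)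
    (f := fun _ => cubeMult S (fun k => √(k : ℝ)) h) (g := v)
    (energyExponents_two_sub hp) (energyExponents_sub_two hp) hη hφ
    (fun ε => ⟨hφ0 ε, by simpa using (sq_le_sq' (abs_le.1 (hk ε)).1 (abs_le.1 (hk ε)).2)⟩)
    (fun ε => ⟨hφ0 ε, by simpa using hv ε⟩)
    (e := fun y => ∑ j ∈ S, poissonPairing S (dflip j h) (v j) y)
    (fun y _ => HasDerivAt.fun_sum fun j _ => hasDerivAt_poissonPairing S (dflip j h) (v j) y)
    (fun y _ => HasDerivAt.fun_sum fun j _ =>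
      hasDerivAt_poissonPairing_deriv S (dflip j h) (v j) y)
    ?_ ?_
  · simp only [poissonPairing_zero] at key
    refine key.trans (mul_le_mul_of_nonneg_right (by linarith) ?_)
    exact Finset.sum_nonneg fun ε _ => Real.rpow_nonneg (hφ0 ε) _
  · rw [show (0 : ℝ) = ∑ j ∈ S, 0 by simp]
    refine tendsto_finsetSum _ fun j hj => poissonPairing_tendsto S (fun A hA => ?_) _
    rw [fourierCoef_dflip, if_neg]
    intro hjA
    exact Finset.notMem_empty j (hA ▸ Finset.mem_inter.2 ⟨hjA, hj⟩)
  · intro y hy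
    have hpos : ∀ ε, 0 < cubePoisson S y φ ε := fun ε =>
      hη.trans_le (le_cubePoisson S hy hφ ε)
    set K := cubePoisson S y (cubeMult S (fun k => √(k : ℝ)) h) with hK
    have h1 : ∑ j ∈ S, 4 * ∑ ε, cubePoissonDeriv S y (dflip j h) ε * cubePoissonDeriv S y (v j) ε ≤
        2 * ∑ j ∈ S, ∑ ε, (max (cubePoisson S y φ ε) (cubePoisson S y φ (cubeFlip j ε)) ^ (2 - q) *
          dflip j K ε ^ 2 + cubePoisson S y φ ε ^ (q - 2) * cubePoissonDeriv S y (v j) ε ^ 2) := by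
      simp only [Finset.mul_sum]
      refine Finset.sum_le_sum fun j _ => Finset.sum_le_sum fun ε _ => ?_
      have e1 := dflip_cubePoisson_sqrt S y h j ε
      rw [← hK] at e1
      have e2 := two_mul_abs_mul_le (a := dflip j K ε) (b := cubePoissonDeriv S y (v j) ε)
        (hpos ε) (2 - q)
      have e3 := neg_le_abs (dflip j K ε * cubePoissonDeriv S y (v j) ε)
      have e4 : cubePoisson S y φ ε ^ (2 - q) ≤
          max (cubePoisson S y φ ε) (cubePoisson S y φ (cubeFlip j ε)) ^ (2 - q) :=
        Real.rpow_le_rpow (hpos ε).le (le_max_left _ _) (by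
          have := (abs_le.1 (energyExponents_two_sub hp).abs_le)
          have := (energyExponents_two_sub hp).le_one
          linarith)
      have e5 := mul_le_mul_of_nonneg_right e4 (sq_nonneg (dflip j K ε))
      rw [neg_sub] at e2
      rw [e1] at e2 e3 e5 ⊢
      linarith
    refine h1.trans ?_
    simp only [Finset.sum_add_distrib]
    have h2 : 0 ≤ ∑ ε, cubePoisson S y φ ε ^ (2 - q) *
        cubePoissonDeriv S y (cubeMult S (fun k => √(k : ℝ)) h) ε ^ 2 :=
      Finset.sum_nonneg fun ε _ => mul_nonneg (Real.rpow_nonneg (hpos ε).le _) (sq_nonneg _)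
    have h3 : 0 ≤ ∑ j ∈ S, ∑ ε,
        max (cubePoisson S y φ ε) (cubePoisson S y φ (cubeFlip j ε)) ^ (q - 2) *
          ∑ i ∈ S, dflip j (cubePoisson S y (v i)) ε ^ 2 :=
      Finset.sum_nonneg fun j _ => Finset.sum_nonneg fun ε _ => mul_nonneg
        (Real.rpow_nonneg ((hpos ε).le.trans (le_max_left _ _)) _)
        (Finset.sum_nonneg fun i _ => sq_nonneg _)
    have h4 : ∑ j ∈ S, ∑ ε, cubePoisson S y φ ε ^ (q - 2) * cubePoissonDeriv S y (v j) ε ^ 2 =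
        ∑ ε, cubePoisson S y φ ε ^ (q - 2) * ∑ j ∈ S, cubePoissonDeriv S y (v j) ε ^ 2 := by
      rw [Finset.sum_comm]
      simp only [Finset.mul_sum]
    have h5 : 0 ≤ ∑ ε, cubePoisson S y φ ε ^ (q - 2) *
        ∑ j ∈ S, cubePoissonDeriv S y (v j) ε ^ 2 :=
      Finset.sum_nonneg fun ε _ => mul_nonneg (Real.rpow_nonneg (hpos ε).le _)
        (Finset.sum_nonneg fun i _ => sq_nonneg _)
    simp only [poissonSquare, Finset.sum_singleton, ← hq, ← hK]
    linarith

lemma sum_cubeMult_sqrt_mul_le (hp : 2 ≤ p) (g : (Fin n → Bool) → ℝ) (hη : 0 < η)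
    (hφ : ∀ ε, η ≤ φ ε) (hg : ∀ ε, |g ε| ≤ φ ε)
    (hu : ∀ ε, ∑ j ∈ S, dflip j h ε ^ 2 ≤ (φ ε ^ (p / (p - 1) - 1)) ^ 2) :
    ∑ ε, cubeMult S (fun k => √(k : ℝ)) h ε * g ε ≤ 160 * p * ∑ ε, φ ε ^ (p / (p - 1)) := by
  set q := p / (p - 1) with hq
  have hφ0 : ∀ ε, 0 ≤ φ ε := fun ε => hη.le.trans (hφ ε)
  have key := le_of_second_deriv_le_poissonSquare (S := S) (s := S) (t := {()})
    (f := fun j => dflip j h) (g := fun _ => g)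
    (energyExponents_two_sub hp) (energyExponents_sub_two hp) hη hφ
    (fun ε => ⟨hφ0 ε, hu ε⟩)
    (fun ε => ⟨hφ0 ε, by simpa using (sq_le_sq' (abs_le.1 (hg ε)).1 (abs_le.1 (hg ε)).2)⟩)
    (fun y _ => hasDerivAt_poissonPairing S (cubeMult S (fun k => √(k : ℝ)) h) g y)
    (fun y _ => hasDerivAt_poissonPairing_deriv S (cubeMult S (fun k => √(k : ℝ)) h) g y)
    ?_ ?_
  · simp only [poissonPairing_zero] at key
    refine key.trans (mul_le_mul_of_nonneg_right (by linarith) ?_)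
    exact Finset.sum_nonneg fun ε _ => Real.rpow_nonneg (hφ0 ε) _
  · refine poissonPairing_tendsto S (fun A hA => ?_) _
    simp [fourierCoef_cubeMult, hA]
  · intro y hy
    have hpos : ∀ ε, 0 < cubePoisson S y φ ε := fun ε =>
      hη.trans_le (le_cubePoisson S hy hφ ε)
    have hα : 0 ≤ 2 - q := by
      have := (energyExponents_two_sub hp).le_one
      linarith
    rw [four_mul_sum_cubePoissonDeriv_mul]
    set K := cubePoisson S y (cubeMult S (fun k => √(k : ℝ)) h) with hK
    set m : Fin n → (Fin n → Bool) → ℝ := fun j ε =>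
      max (cubePoisson S y φ ε) (cubePoisson S y φ (cubeFlip j ε)) with hm
    have hinv : ∀ j, ∑ ε, cubePoisson S y φ (cubeFlip j ε) ^ (2 - q) * dflip j K ε ^ 2 =
        ∑ ε, cubePoisson S y φ ε ^ (2 - q) * dflip j K ε ^ 2 := by
      intro j
      rw [← sum_cubeFlip j]
      refine Finset.sum_congr rfl fun ε _ => ?_
      simp only [dflip_apply, cubeFlip_cubeFlip]
      ring
    have h1 : ∀ j, ∑ ε, dflip j K ε * dflip j (cubePoisson S y g) ε ≤
        ∑ ε, cubePoisson S y φ ε ^ (2 - q) * cubePoissonDeriv S y (dflip j h) ε ^ 2 +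
          (∑ ε, m j ε ^ (q - 2) * dflip j (cubePoisson S y g) ε ^ 2) / 2 := by
      intro j
      have e0 : ∀ ε, dflip j K ε * dflip j (cubePoisson S y g) ε ≤
          (cubePoisson S y φ ε ^ (2 - q) * dflip j K ε ^ 2 +
            cubePoisson S y φ (cubeFlip j ε) ^ (2 - q) * dflip j K ε ^ 2 +
            m j ε ^ (q - 2) * dflip j (cubePoisson S y g) ε ^ 2) / 2 := by
        intro ε
        have e2 := two_mul_abs_mul_le (a := dflip j K ε) (b := dflip j (cubePoisson S y g) ε)
          ((hpos ε).trans_le (le_max_left _ (cubePoisson S y φ (cubeFlip j ε)))) (2 - q)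
        have e3 := le_abs_self (dflip j K ε * dflip j (cubePoisson S y g) ε)
        have e4 : m j ε ^ (2 - q) ≤ cubePoisson S y φ ε ^ (2 - q) +
            cubePoisson S y φ (cubeFlip j ε) ^ (2 - q) := by
          have f1 := Real.rpow_nonneg (hpos ε).le (2 - q)
          have f2 := Real.rpow_nonneg (hpos (cubeFlip j ε)).le (2 - q)
          rcases max_choice (cubePoisson S y φ ε) (cubePoisson S y φ (cubeFlip j ε)) with hc | hc
          · simp only [hm, hc]
            linarith
          · simp only [hm, hc]
            linarith
        have e5 := mul_le_mul_of_nonneg_right e4 (sq_nonneg (dflip j K ε))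
        rw [neg_sub] at e2
        simp only [hm] at e5 ⊢
        linarith
      refine (Finset.sum_le_sum fun ε _ => e0 ε).trans (le_of_eq ?_)
      rw [← Finset.sum_div, Finset.sum_add_distrib, Finset.sum_add_distrib, hinv]
      simp only [hK, dflip_cubePoisson_sqrt, neg_sq]
      ring
    refine (Finset.sum_le_sum fun j _ => h1 j).trans ?_
    rw [Finset.sum_add_distrib, ← Finset.sum_div]
    have h2 : 0 ≤ ∑ ε, cubePoisson S y φ ε ^ (q - 2) * cubePoissonDeriv S y g ε ^ 2 :=
      Finset.sum_nonneg fun ε _ => mul_nonneg (Real.rpow_nonneg (hpos ε).le _) (sq_nonneg _)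
    have h3 : 0 ≤ ∑ j ∈ S, ∑ ε, m j ε ^ (2 - q) *
          ∑ i ∈ S, dflip j (cubePoisson S y (dflip i h)) ε ^ 2 :=
      Finset.sum_nonneg fun j _ => Finset.sum_nonneg fun ε _ => mul_nonneg
        (Real.rpow_nonneg ((hpos ε).le.trans (le_max_left _ _)) _)
        (Finset.sum_nonneg fun i _ => sq_nonneg _)
    have h4 : ∑ j ∈ S, ∑ ε, cubePoisson S y φ ε ^ (2 - q) *
        cubePoissonDeriv S y (dflip j h) ε ^ 2 =
        ∑ ε, cubePoisson S y φ ε ^ (2 - q) * ∑ j ∈ S, cubePoissonDeriv S y (dflip j h) ε ^ 2 := by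
      rw [Finset.sum_comm]
      simp only [Finset.mul_sum]
    have h5 : 0 ≤ ∑ ε, cubePoisson S y φ ε ^ (2 - q) *
        ∑ j ∈ S, cubePoissonDeriv S y (dflip j h) ε ^ 2 :=
      Finset.sum_nonneg fun ε _ => mul_nonneg (Real.rpow_nonneg (hpos ε).le _)
        (Finset.sum_nonneg fun i _ => sq_nonneg _)
    have h6 : 0 ≤ ∑ j ∈ S, ∑ ε, m j ε ^ (q - 2) * dflip j (cubePoisson S y g) ε ^ 2 :=
      Finset.sum_nonneg fun j _ => Finset.sum_nonneg fun ε _ => mul_nonneg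
        (Real.rpow_nonneg ((hpos ε).le.trans (le_max_left _ _)) _) (sq_nonneg _)
    simp only [poissonSquare, Finset.sum_singleton, ← hq]
    simp only [hm] at h3 h6 ⊢
    linarith

end

lemma le_of_forall_le_sum_add_rpow {ι : Type*} [Fintype ι] {a b : ι → ℝ} {q c X : ℝ}
    (hq : 1 ≤ q) (hq2 : q ≤ 2) (hc : 0 ≤ c) (ha : ∀ i, 0 ≤ a i) (hb : ∀ i, 0 ≤ b i)
    (h : ∀ η, 0 < η → X ≤ c * ∑ i, (a i + b i + η) ^ q) :
    X ≤ 4 * c * (∑ i, a i ^ q + ∑ i, b i ^ q) := by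
  have hcont : Filter.Tendsto (fun η => c * ∑ i, (a i + b i + η) ^ q) (nhdsWithin 0 (Set.Ioi 0))
      (nhds (c * ∑ i, (a i + b i + 0) ^ q)) := by
    refine tendsto_nhdsWithin_of_tendsto_nhds (Filter.Tendsto.const_mul _
      (tendsto_finsetSum _ fun i _ => ?_))
    exact (tendsto_const_nhds.add Filter.tendsto_id).rpow_const (Or.inr (by linarith))
  have h1 : X ≤ c * ∑ i, (a i + b i + 0) ^ q :=
    ge_of_tendsto hcont (eventually_nhdsWithin_of_forall fun η hη => h η hη)
  refine h1.trans ?_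
  rw [← Finset.sum_add_distrib, mul_comm 4 c, mul_assoc]
  refine mul_le_mul_of_nonneg_left ?_ hc
  rw [Finset.mul_sum]
  refine Finset.sum_le_sum fun i _ => ?_
  have h2 : (2 : ℝ) ^ q ≤ 4 := by
    calc (2 : ℝ) ^ q ≤ 2 ^ (2 : ℝ) := Real.rpow_le_rpow_of_exponent_le one_le_two hq2
      _ = 4 := by norm_num
  have h3 : (a i + b i + 0) ^ q ≤ (2 * max (a i) (b i)) ^ q := by
    have := ha i
    have := hb i
    refine Real.rpow_le_rpow (by positivity) ?_ (by linarith)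
    linarith [le_max_left (a i) (b i), le_max_right (a i) (b i)]
  refine h3.trans ?_
  have h4 : 0 ≤ max (a i) (b i) := (ha i).trans (le_max_left _ _)
  rw [Real.mul_rpow zero_le_two h4]
  have h5 : max (a i) (b i) ^ q ≤ a i ^ q + b i ^ q := by
    have f1 := Real.rpow_nonneg (ha i) q
    have f2 := Real.rpow_nonneg (hb i) q
    rcases max_choice (a i) (b i) with hm | hm <;> rw [hm] <;> linarith
  exact mul_le_mul h2 h5 (Real.rpow_nonneg h4 _) (by norm_num)

lemma le_of_forall_mul_le {p c X Y : ℝ} (hc : 0 < c)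
    (h : ∀ t, 0 < t → t * X ≤ c * (X + t ^ p * Y)) : X ≤ (2 * c) ^ p * Y := by
  have h1 := h (2 * c) (by positivity)
  have h2 : c * X ≤ c * ((2 * c) ^ p * Y) := by linarith
  exact le_of_mul_le_mul_left h2 hc

section

variable {n : ℕ} (S : Finset (Fin n)) (h : (Fin n → Bool) → ℝ) {p : ℝ}

lemma dflip_const_mul (j : Fin n) (t : ℝ) (ε : Fin n → Bool) :
    dflip j (fun ε => t * h ε) ε = t * dflip j h ε :=
  (mul_sub t _ _).symm

lemma rpow_sub_one_rpow_conj (hp : 2 ≤ p) {x : ℝ} (hx : 0 ≤ x) :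
    (x ^ (p - 1)) ^ (p / (p - 1)) = x ^ p := by
  rw [← Real.rpow_mul hx, mul_div_cancel₀ _ (by linarith : p - 1 ≠ 0)]

lemma le_add_rpow_conj_sub_one (hp : 2 ≤ p) {x a b : ℝ} (hx : 0 ≤ x) (ha : 0 ≤ a) (hb : 0 ≤ b) :
    x ≤ (a + x ^ (p - 1) + b) ^ (p / (p - 1) - 1) := by
  have h0 : 0 < p - 1 := by linarith
  have h1 : (x ^ (p - 1)) ^ (p / (p - 1) - 1) = x := by
    rw [← Real.rpow_mul hx, mul_sub, mul_div_cancel₀ _ h0.ne', mul_one, sub_sub_cancel,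
      Real.rpow_one]
  calc x = (x ^ (p - 1)) ^ (p / (p - 1) - 1) := h1.symm
    _ ≤ _ := Real.rpow_le_rpow (Real.rpow_nonneg hx _) (by linarith)
      (energyExponents_two_sub hp).nonneg

lemma conj_exponent_le_two (hp : 2 ≤ p) : p / (p - 1) ≤ 2 := by
  linarith [(energyExponents_two_sub hp).le_one]

lemma sum_sqrt_dflip_rpow_le (hp : 2 ≤ p) :
    ∑ ε, √(∑ j ∈ S, dflip j h ε ^ 2) ^ p ≤
      (1280 * p) ^ p * ∑ ε, |cubeMult S (fun k => √(k : ℝ)) h ε| ^ p := by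
  have h0 : 0 < p - 1 := by linarith
  set N : (Fin n → Bool) → ℝ := fun ε => √(∑ j ∈ S, dflip j h ε ^ 2) with hN
  have hN0 : ∀ ε, 0 ≤ N ε := fun ε => Real.sqrt_nonneg _
  have hN2 : ∀ ε, ∑ j ∈ S, dflip j h ε ^ 2 = N ε ^ 2 := fun ε =>
    (Real.sq_sqrt (Finset.sum_nonneg fun j _ => sq_nonneg _)).symm
  have hNp : ∀ ε, N ε ^ (p - 2) * N ε = N ε ^ (p - 1) := fun ε => by
    rw [← Real.rpow_add_one' (hN0 ε) (by linarith)]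
    congr 1
    ring
  have hNp' : ∀ ε, N ε ^ (p - 1) * N ε = N ε ^ p := fun ε => by
    rw [← Real.rpow_add_one' (hN0 ε) (by linarith), sub_add_cancel]
  rw [show 1280 * p = 2 * (640 * p) by ring]
  refine le_of_forall_mul_le (by linarith) fun t ht => ?_
  have hk : ∀ ε, |cubeMult S (fun k => √(k : ℝ)) (fun ε => t * h ε) ε| =
      t * |cubeMult S (fun k => √(k : ℝ)) h ε| := fun ε => by
    rw [cubeMult_const_mul, abs_mul, abs_of_pos ht]
  have key := le_of_forall_le_sum_add_rpow (a := fun ε => N ε ^ (p - 1))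
    (b := fun ε => |cubeMult S (fun k => √(k : ℝ)) (fun ε => t * h ε) ε| ^ (p - 1))
    (energyExponents_two_sub hp).one_lt.le (conj_exponent_le_two hp) (c := 160 * p) (by linarith)
    (fun ε => Real.rpow_nonneg (hN0 ε) _) (fun ε => Real.rpow_nonneg (abs_nonneg _) _)
    (fun η hη => sum_dflip_mul_le S (fun ε => t * h ε) hp
      (fun j ε => N ε ^ (p - 2) * dflip j h ε) hη
      (fun ε => by
        have := Real.rpow_nonneg (hN0 ε) (p - 1)
        have := Real.rpow_nonneg
          (abs_nonneg (cubeMult S (fun k => √(k : ℝ)) (fun ε => t * h ε) ε)) (p - 1)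
        linarith)
      (fun ε => le_add_rpow_conj_sub_one hp (abs_nonneg _) (Real.rpow_nonneg (hN0 ε) _) hη.le)
      (fun ε => by
        have e1 := Real.rpow_nonneg (hN0 ε) (p - 1)
        have e2 := Real.rpow_nonneg
          (abs_nonneg (cubeMult S (fun k => √(k : ℝ)) (fun ε => t * h ε) ε)) (p - 1)
        simp only [mul_pow, ← Finset.mul_sum]
        rw [hN2, ← mul_pow, hNp]
        exact pow_le_pow_left₀ e1 (by linarith) 2))
  have e1 : ∑ j ∈ S, ∑ ε, dflip j (fun ε => t * h ε) ε * (N ε ^ (p - 2) * dflip j h ε) =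
      t * ∑ ε, N ε ^ p := by
    rw [Finset.sum_comm, Finset.mul_sum]
    refine Finset.sum_congr rfl fun ε _ => ?_
    rw [← hNp' ε, ← hNp ε, mul_assoc, ← sq, ← hN2, Finset.mul_sum, Finset.mul_sum]
    refine Finset.sum_congr rfl fun j _ => ?_
    rw [dflip_const_mul]
    ring
  rw [e1] at key
  simp only [rpow_sub_one_rpow_conj hp (hN0 _), rpow_sub_one_rpow_conj hp (abs_nonneg _)] at key
  simp only [hk, Real.mul_rpow ht.le (abs_nonneg _), ← Finset.mul_sum] at key
  linarith

lemma sum_cubeMult_sqrt_rpow_le (hp : 2 ≤ p) :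
    ∑ ε, |cubeMult S (fun k => √(k : ℝ)) h ε| ^ p ≤
      (1280 * p) ^ p * ∑ ε, √(∑ j ∈ S, dflip j h ε ^ 2) ^ p := by
  have h0 : 0 < p - 1 := by linarith
  set k := cubeMult S (fun k => √(k : ℝ)) h with hk
  have hkp : ∀ ε, |k ε| ^ (p - 2) * |k ε| = |k ε| ^ (p - 1) := fun ε => by
    rw [← Real.rpow_add_one' (abs_nonneg _) (by linarith)]
    congr 1
    ring
  have hkp' : ∀ ε, |k ε| ^ (p - 1) * |k ε| = |k ε| ^ p := fun ε => by
    rw [← Real.rpow_add_one' (abs_nonneg _) (by linarith), sub_add_cancel]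
  rw [show 1280 * p = 2 * (640 * p) by ring]
  refine le_of_forall_mul_le (by linarith) fun t ht => ?_
  set N : (Fin n → Bool) → ℝ := fun ε => √(∑ j ∈ S, dflip j (fun ε => t * h ε) ε ^ 2) with hN
  have hN0 : ∀ ε, 0 ≤ N ε := fun ε => Real.sqrt_nonneg _
  have hNt : ∀ ε, N ε = t * √(∑ j ∈ S, dflip j h ε ^ 2) := fun ε => by
    simp only [hN, dflip_const_mul, mul_pow, ← Finset.mul_sum]
    rw [Real.sqrt_mul (sq_nonneg t), Real.sqrt_sq ht.le]
  have key := le_of_forall_le_sum_add_rpow (a := fun ε => |k ε| ^ (p - 1))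
    (b := fun ε => N ε ^ (p - 1))
    (energyExponents_two_sub hp).one_lt.le (conj_exponent_le_two hp) (c := 160 * p) (by linarith)
    (fun ε => Real.rpow_nonneg (abs_nonneg _) _) (fun ε => Real.rpow_nonneg (hN0 ε) _)
    (fun η hη => sum_cubeMult_sqrt_mul_le S (fun ε => t * h ε) hp
      (fun ε => |k ε| ^ (p - 2) * k ε) hη
      (fun ε => by
        have := Real.rpow_nonneg (hN0 ε) (p - 1)
        have := Real.rpow_nonneg (abs_nonneg (k ε)) (p - 1)
        linarith)
      (fun ε => by
        have := Real.rpow_nonneg (hN0 ε) (p - 1)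
        rw [abs_mul, abs_of_nonneg (Real.rpow_nonneg (abs_nonneg (k ε)) (p - 2)), hkp]
        linarith)
      (fun ε => by
        have e1 := le_add_rpow_conj_sub_one hp (hN0 ε)
          (Real.rpow_nonneg (abs_nonneg (k ε)) (p - 1)) hη.le
        refine le_trans (le_of_eq ?_) (pow_le_pow_left₀ (hN0 ε) e1 2)
        exact (Real.sq_sqrt (Finset.sum_nonneg fun j _ => sq_nonneg _)).symm))
  have e1 : ∑ ε, cubeMult S (fun k => √(k : ℝ)) (fun ε => t * h ε) ε *
      (|k ε| ^ (p - 2) * k ε) = t * ∑ ε, |k ε| ^ p := by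
    rw [Finset.mul_sum]
    refine Finset.sum_congr rfl fun ε _ => ?_
    rw [← hkp' ε, ← hkp ε, mul_assoc (|k ε| ^ (p - 2)), abs_mul_abs_self, cubeMult_const_mul, ← hk]
    ring
  rw [e1] at key
  simp only [rpow_sub_one_rpow_conj hp (hN0 _), rpow_sub_one_rpow_conj hp (abs_nonneg _)] at key
  simp only [hNt, Real.mul_rpow ht.le (Real.sqrt_nonneg _), ← Finset.mul_sum] at key
  linarith

end

lemma sum_sq_sum_boolSign {n : ℕ} (S : Finset (Fin n)) (a : Fin n → ℝ) :
    ∑ δ : Fin n → Bool, (∑ j ∈ S, boolSign (δ j) * a j) ^ 2 = 2 ^ n * ∑ j ∈ S, a j ^ 2 := by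
  have hw : ∀ (δ : Fin n → Bool) j, boolSign (δ j) = walsh {j} δ := fun δ j => by
    simp [walsh, boolSign]
  simp only [sq, Finset.sum_mul_sum, hw]
  rw [Finset.sum_comm, Finset.mul_sum]
  refine Finset.sum_congr rfl fun i hi => ?_
  rw [Finset.sum_comm]
  have h1 : ∀ j, ∑ δ : Fin n → Bool, walsh {i} δ * a i * (walsh {j} δ * a j) =
      if i = j then 2 ^ n * (a i * a j) else 0 := by
    intro j
    have := sum_walsh_mul_walsh_eq_ite ({i} : Finset (Fin n)) {j}
    simp only [Finset.singleton_inj] at this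
    rw [← ite_zero_mul, ← this, Finset.sum_mul]
    exact Finset.sum_congr rfl fun δ _ => by ring
  simp [h1, hi]

lemma sqrt_rpow_le_sum_boolSign {n : ℕ} (S : Finset (Fin n)) (a : Fin n → ℝ) {p : ℝ}
    (hp : 2 ≤ p) :
    √(∑ j ∈ S, a j ^ 2) ^ p ≤
      (∑ δ : Fin n → Bool, |∑ j ∈ S, boolSign (δ j) * a j| ^ p) / 2 ^ n := by
  have h := Real.rpow_arith_mean_le_arith_mean_rpow Finset.univ
    (fun _ : Fin n → Bool => (1 : ℝ) / 2 ^ n)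
    (fun δ => (∑ j ∈ S, boolSign (δ j) * a j) ^ 2) (fun _ _ => by positivity) (by simp)
    (fun _ _ => sq_nonneg _) (p := p / 2) (by linarith)
  rw [← Finset.mul_sum, ← Finset.mul_sum, sum_sq_sum_boolSign, ← mul_assoc,
    one_div_mul_cancel (by positivity), one_mul] at h
  have h1 : ∀ x : ℝ, (x ^ 2) ^ (p / 2) = |x| ^ p := fun x => by
    rw [← sq_abs, ← Real.rpow_natCast, ← Real.rpow_mul (abs_nonneg x)]
    congr 1
    push_cast
    ring
  simp only [h1] at h
  have h2 : (∑ j ∈ S, a j ^ 2) ^ (p / 2) = √(∑ j ∈ S, a j ^ 2) ^ p := by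
    rw [← abs_of_nonneg (Real.sqrt_nonneg (∑ j ∈ S, a j ^ 2)), ← h1,
      Real.sq_sqrt (Finset.sum_nonneg fun j _ => sq_nonneg _)]
  rw [h2] at h
  rwa [div_eq_inv_mul, ← one_div]

lemma sum_exp_boolSign_le {n : ℕ} (S : Finset (Fin n)) (a : Fin n → ℝ) :
    ∑ δ : Fin n → Bool, Real.exp (∑ j ∈ S, boolSign (δ j) * a j) ≤
      2 ^ n * Real.exp ((∑ j ∈ S, a j ^ 2) / 2) := by
  have h1 : ∀ δ : Fin n → Bool, Real.exp (∑ j ∈ S, boolSign (δ j) * a j) =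
      ∏ j, Real.exp (if j ∈ S then boolSign (δ j) * a j else 0) := fun δ => by
    rw [← Real.exp_sum, Finset.sum_ite_mem, Finset.univ_inter]
  have h2 : 2 ^ n * Real.exp ((∑ j ∈ S, a j ^ 2) / 2) =
      ∏ j, (2 * Real.exp (if j ∈ S then a j ^ 2 / 2 else 0)) := by
    rw [Finset.prod_mul_distrib, ← Real.exp_sum, Finset.sum_ite_mem, Finset.univ_inter,
      Finset.sum_div]
    simp
  simp only [h1, h2]
  have h3 := Finset.prod_univ_sum (fun _ : Fin n => (Finset.univ : Finset Bool))
    (fun j b => Real.exp (if j ∈ S then boolSign b * a j else 0))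
  rw [Fintype.piFinset_univ] at h3
  rw [← h3]
  refine Finset.prod_le_prod (fun j _ => Finset.sum_nonneg fun b _ => (Real.exp_pos _).le)
    fun j _ => ?_
  have h4 := Real.cosh_le_exp_half_sq (a j)
  rw [Real.cosh_eq] at h4
  by_cases hj : j ∈ S
  · simp [hj, boolSign]
    linarith
  · simp [hj]

lemma sum_boolSign_rpow_le {n : ℕ} (S : Finset (Fin n)) (a : Fin n → ℝ) {p : ℝ} (hp : 2 ≤ p) :
    (∑ δ : Fin n → Bool, |∑ j ∈ S, boolSign (δ j) * a j| ^ p) / 2 ^ n ≤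
      (2 * Real.exp (1 / 2) * √p) ^ p * √(∑ j ∈ S, a j ^ 2) ^ p := by
  have hp0 : 0 < p := by linarith
  have hσ2 : ∑ j ∈ S, a j ^ 2 = √(∑ j ∈ S, a j ^ 2) ^ 2 :=
    (Real.sq_sqrt (Finset.sum_nonneg fun j _ => sq_nonneg _)).symm
  have hσ0 : 0 ≤ √(∑ j ∈ S, a j ^ 2) := Real.sqrt_nonneg _
  generalize √(∑ j ∈ S, a j ^ 2) = σ at hσ2 hσ0 ⊢
  rcases hσ0.eq_or_lt with h0 | hpos
  · have ha : ∀ j ∈ S, a j = 0 := by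
      rw [← h0, zero_pow two_ne_zero, Finset.sum_eq_zero_iff_of_nonneg
        fun j _ => sq_nonneg _] at hσ2
      exact fun j hj => pow_eq_zero_iff two_ne_zero |>.1 (hσ2 j hj)
    have hz : ∀ δ : Fin n → Bool, ∑ j ∈ S, boolSign (δ j) * a j = 0 := fun δ =>
      Finset.sum_eq_zero fun j hj => by rw [ha j hj, mul_zero]
    simp [hz, ← h0, Real.zero_rpow hp0.ne']
  have hsp : 0 < √p := Real.sqrt_pos.2 hp0
  set c := √p / σ with hc
  have hcpos : 0 < c := by positivity
  have hexp : ∀ b : ℝ, b ^ 2 = c ^ 2 → ∑ δ : Fin n → Bool,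
      Real.exp (∑ j ∈ S, boolSign (δ j) * (b * a j)) ≤ 2 ^ n * Real.exp (p / 2) := by
    intro b hb
    refine (sum_exp_boolSign_le S fun j => b * a j).trans (le_of_eq ?_)
    simp only [mul_pow, ← Finset.mul_sum, hσ2, hb, hc, div_pow, Real.sq_sqrt hp0.le]
    rw [div_mul_cancel₀ _ (by positivity)]
  have hpt : ∀ x : ℝ, |x| ^ p ≤ (σ * √p) ^ p * (Real.exp (c * x) + Real.exp (-c * x)) := by
    intro x
    have e1 : c * |x| / p ≤ Real.exp (c * |x| / p) := by
      linarith [Real.add_one_le_exp (c * |x| / p)]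
    have e2 : (c * |x| / p) ^ p ≤ Real.exp (c * |x|) := by
      refine (Real.rpow_le_rpow (by positivity) e1 hp0.le).trans (le_of_eq ?_)
      rw [← Real.exp_mul, div_mul_cancel₀ _ hp0.ne']
    have e3 : |x| = σ * √p * (c * |x| / p) := by
      have := Real.mul_self_sqrt hp0.le
      rw [hc]
      field_simp
      rw [sq, this]
    have e4 : Real.exp (c * |x|) ≤ Real.exp (c * x) + Real.exp (-c * x) := by
      have f1 := Real.exp_pos (c * x)
      have f2 := Real.exp_pos (-c * x)
      rcases abs_choice x with hx | hx
      · rw [hx]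
        linarith
      · rw [hx, mul_neg, ← neg_mul]
        linarith
    calc |x| ^ p = (σ * √p) ^ p * (c * |x| / p) ^ p := by
          rw [← Real.mul_rpow (by positivity) (by positivity), ← e3]
      _ ≤ _ := mul_le_mul_of_nonneg_left (e2.trans e4) (by positivity)
  rw [div_le_iff₀ (by positivity)]
  calc ∑ δ : Fin n → Bool, |∑ j ∈ S, boolSign (δ j) * a j| ^ p
      ≤ ∑ δ : Fin n → Bool, (σ * √p) ^ p *
        (Real.exp (∑ j ∈ S, boolSign (δ j) * (c * a j)) +
          Real.exp (∑ j ∈ S, boolSign (δ j) * (-c * a j))) := by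
        refine Finset.sum_le_sum fun δ _ => (hpt _).trans (le_of_eq ?_)
        simp only [Finset.mul_sum, mul_left_comm]
    _ ≤ (σ * √p) ^ p * (2 ^ n * Real.exp (p / 2) + 2 ^ n * Real.exp (p / 2)) := by
        rw [← Finset.mul_sum, Finset.sum_add_distrib]
        exact mul_le_mul_of_nonneg_left (add_le_add (hexp c rfl) (hexp (-c) (neg_sq c)))
          (by positivity)
    _ = (σ * √p) ^ p * Real.exp (p / 2) * 2 ^ n * 2 := by ring
    _ ≤ (σ * √p) ^ p * Real.exp (p / 2) * 2 ^ n * 2 ^ p := by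
        refine mul_le_mul_of_nonneg_left ?_ (by positivity)
        exact Real.self_le_rpow_of_one_le one_le_two (by linarith)
    _ = _ := by
        rw [Real.mul_rpow hpos.le hsp.le, Real.mul_rpow (by positivity) hsp.le,
          Real.mul_rpow (by positivity) (by positivity), ← Real.exp_mul]
        ring_nf

/-- **Lust-Piquard's inequality (3.8)**: there are universal `c, C > 0` such that for every
`p ∈ [2,∞)`, `n ∈ ℕ`, `S ⊆ [n]` and mean-zero `h : {-1,1}^n → ℝ`,
`c p^{-3/2} ‖Δ_S^{1/2} h‖_p ≤ (2^{-n} Σ_δ ‖Σ_{j∈S} δ_j ∂_j h‖_p^p)^{1/p}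
  ≤ C p^{3/2} ‖Δ_S^{1/2} h‖_p`. -/
theorem lust_piquard_riesz :
    ∃ c C : ℝ, 0 < c ∧ 0 < C ∧ ∀ p : ℝ, 2 ≤ p → ∀ n : ℕ, ∀ S : Finset (Fin n),
      ∀ h : (Fin n → Bool) → ℝ, (∑ ε : Fin n → Bool, h ε) = 0 →
      c * p ^ (-(3 : ℝ) / 2) * pnorm p (deltaPow S (1 / 2) h) ≤
        ((∑ δ : Fin n → Bool,
            pnorm p (fun ε => ∑ j ∈ S, (if δ j then (1 : ℝ) else -1) * dflip j h ε) ^ p) /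
          2 ^ n) ^ (1 / p) ∧
      ((∑ δ : Fin n → Bool,
            pnorm p (fun ε => ∑ j ∈ S, (if δ j then (1 : ℝ) else -1) * dflip j h ε) ^ p) /
          2 ^ n) ^ (1 / p) ≤
        C * p ^ ((3 : ℝ) / 2) * pnorm p (deltaPow S (1 / 2) h) := by
  refine ⟨1 / 1280, 2 * Real.exp (1 / 2) * 1280, by norm_num, by positivity, ?_⟩
  intro p hp n S h _
  have hp0 : 0 < p := by linarith
  generalize hM : (∑ δ : Fin n → Bool,
    pnorm p (fun ε => ∑ j ∈ S, (if δ j then (1 : ℝ) else -1) * dflip j h ε) ^ p) / 2 ^ n = M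
  obtain ⟨X, hX⟩ : ∃ X, X = ∑ ε, √(∑ j ∈ S, dflip j h ε ^ 2) ^ p := ⟨_, rfl⟩
  obtain ⟨Y, hY⟩ : ∃ Y, Y = ∑ ε, |cubeMult S (fun k => √(k : ℝ)) h ε| ^ p := ⟨_, rfl⟩
  have hpn : pnorm p (deltaPow S (1 / 2) h) = (Y / 2 ^ n) ^ (1 / p) := by
    rw [deltaPow_half, pnorm, hY]
  have hX0 : 0 ≤ X := by
    rw [hX]
    exact Finset.sum_nonneg fun ε _ => Real.rpow_nonneg (Real.sqrt_nonneg _) _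
  have hY0 : 0 ≤ Y := by
    rw [hY]
    exact Finset.sum_nonneg fun ε _ => Real.rpow_nonneg (abs_nonneg _) _
  have hMeq : M = (∑ ε, (∑ δ : Fin n → Bool,
      |∑ j ∈ S, boolSign (δ j) * dflip j h ε| ^ p) / 2 ^ n) / 2 ^ n := by
    have hδ : ∀ δ : Fin n → Bool,
        pnorm p (fun ε => ∑ j ∈ S, (if δ j then (1 : ℝ) else -1) * dflip j h ε) ^ p =
          (∑ ε, |∑ j ∈ S, boolSign (δ j) * dflip j h ε| ^ p) / 2 ^ n := fun δ => by
      rw [pnorm, ← Real.rpow_mul (by positivity), one_div_mul_cancel hp0.ne', Real.rpow_one]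
      rfl
    simp only [← hM, hδ]
    rw [← Finset.sum_div, ← Finset.sum_div, Finset.sum_comm]
  have hXM : X / 2 ^ n ≤ M := by
    rw [hMeq, hX]
    exact div_le_div_of_nonneg_right (Finset.sum_le_sum fun ε _ =>
      sqrt_rpow_le_sum_boolSign S (fun j => dflip j h ε) hp) (by positivity)
  have hMX : M ≤ (2 * Real.exp (1 / 2) * √p) ^ p * (X / 2 ^ n) := by
    rw [hMeq, mul_div_assoc', hX, Finset.mul_sum]
    exact div_le_div_of_nonneg_right (Finset.sum_le_sum fun ε _ =>
      sum_boolSign_rpow_le S (fun j => dflip j h ε) hp) (by positivity)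
  have hXY : X / 2 ^ n ≤ (1280 * p) ^ p * (Y / 2 ^ n) := by
    rw [mul_div_assoc', hX, hY]
    exact div_le_div_of_nonneg_right (sum_sqrt_dflip_rpow_le S h hp) (by positivity)
  have hYX : Y / 2 ^ n ≤ (1280 * p) ^ p * (X / 2 ^ n) := by
    rw [mul_div_assoc', hX, hY]
    exact div_le_div_of_nonneg_right (sum_cubeMult_sqrt_rpow_le S h hp) (by positivity)
  have hM0 : 0 ≤ M := le_trans (by positivity) hXM
  have hroot : ∀ a b c : ℝ, 0 ≤ a → 0 ≤ b → 0 ≤ c → a ≤ c ^ p * b →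
      a ^ (1 / p) ≤ c * b ^ (1 / p) := by
    intro a b c ha hb hc hab
    refine (Real.rpow_le_rpow ha hab (by positivity)).trans (le_of_eq ?_)
    rw [Real.mul_rpow (by positivity) hb, ← Real.rpow_mul hc, mul_one_div_cancel hp0.ne',
      Real.rpow_one]
  rw [hpn]
  constructor
  · have h1 : (Y / 2 ^ n) ^ (1 / p) ≤ 1280 * p * M ^ (1 / p) :=
      hroot _ _ _ (by positivity) hM0 (by positivity)
        (hYX.trans (mul_le_mul_of_nonneg_left hXM (by positivity)))
    have h2 : p ^ (-(3 : ℝ) / 2) * p ≤ 1 := by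
      rw [← Real.rpow_add_one hp0.ne']
      exact Real.rpow_le_one_of_one_le_of_nonpos (by linarith) (by norm_num)
    calc 1 / 1280 * p ^ (-(3 : ℝ) / 2) * (Y / 2 ^ n) ^ (1 / p)
        ≤ 1 / 1280 * p ^ (-(3 : ℝ) / 2) * (1280 * p * M ^ (1 / p)) :=
          mul_le_mul_of_nonneg_left h1 (by positivity)
      _ = p ^ (-(3 : ℝ) / 2) * p * M ^ (1 / p) := by ring
      _ ≤ 1 * M ^ (1 / p) := mul_le_mul_of_nonneg_right h2 (by positivity)
      _ = M ^ (1 / p) := one_mul _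
  · have h1 : M ^ (1 / p) ≤ 2 * Real.exp (1 / 2) * √p * (1280 * p) * (Y / 2 ^ n) ^ (1 / p) := by
      refine hroot _ _ _ hM0 (by positivity) (by positivity) (hMX.trans ?_)
      rw [Real.mul_rpow (y := 1280 * p) (by positivity) (by positivity),
        mul_assoc (_ ^ p) (_ ^ p)]
      exact mul_le_mul_of_nonneg_left hXY (by positivity)
    refine h1.trans (le_of_eq ?_)
    have h2 : p ^ ((3 : ℝ) / 2) = √p * p := by
      rw [Real.sqrt_eq_rpow, ← Real.rpow_add_one hp0.ne']
      norm_num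
    rw [h2]
    ring
end

section
/- Let p, q ∈ [2, ∞) with q < p. There exists c = c(p) ∈ (0, ∞) depending only on p such that the following holds. Let m, n ∈ ℕ, D ∈ [1, ∞), and suppose φ : [32m]_q^n → L_p satisfies ‖x − y‖_{ℓ_q^n} ≤ ‖φ(x) − φ(y)‖_{L_p} ≤ D·‖x − y‖_{ℓ_q^n} for all x, y ∈ [32m]_q^n. Then for every k ∈ [n] with k ≥ n/(16m²), D ≥ c · k^{1/q} / ( k + k^{p/2} n^{p/q − p/2} )^{1/p}. -/
open Finset

/-- The Lebesgue space `L_p(ℝ)` (with `p ∈ [1,∞)` given as a real number). -/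
noncomputable abbrev LpSpace (p : ℝ) :=
  MeasureTheory.Lp ℝ (ENNReal.ofReal p) (MeasureTheory.volume : MeasureTheory.Measure ℝ)

/-- The `ℓ_q^n` metric on `ℝ^n`: `d(x,y) = (Σ_i |x_i - y_i|^q)^{1/q}`. -/
noncomputable def lqDist {n : ℕ} (q : ℝ) (x y : Fin n → ℝ) : ℝ :=
  (∑ i, |x i - y i| ^ q) ^ (1 / q)

/-- The `ℓ_q^n` metric on the grid `{1,…,m}^n` (encoded as `Fin n → Fin m`). -/
noncomputable def gridDist (q : ℝ) {n m : ℕ} (x y : Fin n → Fin m) : ℝ :=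
  lqDist q (fun i => ((x i : ℕ) : ℝ)) (fun i => ((y i : ℕ) : ℝ))

/-- The `L_p` distortion `c_p(X, d)` of a distance function `d` on `X`: the infimum of those
`D ∈ [1,∞)` for which there is `f : X → L_p` with
`d(x,y) ≤ ‖f(x) - f(y)‖_{L_p} ≤ D d(x,y)` for all `x, y ∈ X`. -/
noncomputable def LpDistortion (p : ℝ) {X : Type*} (d : X → X → ℝ) : ℝ :=
  sInf {D : ℝ | 1 ≤ D ∧ ∃ f : X → LpSpace p,
    ∀ x y : X, d x y ≤ ‖f x - f y‖ ∧ ‖f x - f y‖ ≤ D * d x y}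

lemma mul_rpow_sub_one_le {r B X : ℝ} (hr : 1 ≤ r) (hB : 0 ≤ B) (hX : 0 ≤ X) :
    B * X ^ (r - 1) ≤ X ^ r / 2 + (2 * B) ^ r / 2 := by
  have key : ∀ Y : ℝ, 0 ≤ Y → Y ^ r = Y * Y ^ (r - 1) := by
    intro Y hY
    rw [← Real.rpow_one_add' hY (by linarith)]
    congr 1; ring
  rcases le_total (2 * B) X with h | h
  · have h1 : 2 * B * X ^ (r - 1) ≤ X * X ^ (r - 1) := by gcongr
    have h2 : 0 ≤ (2 * B) ^ r := by positivity
    rw [key X hX]; linarith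
  · have h1 : B * X ^ (r - 1) ≤ B * (2 * B) ^ (r - 1) := by
      gcongr
    have h2 : 0 ≤ X ^ r := by positivity
    rw [key (2 * B) (by linarith)]; linarith

lemma add_rpow_le_two_rpow_mul {s a b : ℝ} (hs : 0 ≤ s) (ha : 0 ≤ a) (hb : 0 ≤ b) :
    (a + b) ^ s ≤ 2 ^ s * (a ^ s + b ^ s) := by
  have ha' : 0 ≤ a ^ s := by positivity
  have hb' : 0 ≤ b ^ s := by positivity
  have hm : (a + b) ^ s ≤ (2 * max a b) ^ s := by
    gcongr
    linarith [le_max_left a b, le_max_right a b]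
  rw [Real.mul_rpow (by norm_num) (by positivity)] at hm
  refine hm.trans ?_
  gcongr
  rcases max_choice a b with h | h <;> rw [h] <;> linarith

lemma sq_add_three_rpow_le {r : ℝ} (hr : 0 ≤ r) (a b c : ℝ) :
    ((a + b + c) ^ 2) ^ r ≤ 12 ^ r * ((a ^ 2) ^ r + (b ^ 2) ^ r + (c ^ 2) ^ r) := by
  have h1 : (a + b + c) ^ 2 ≤ 3 * (a ^ 2 + b ^ 2 + c ^ 2) := by
    nlinarith [sq_nonneg (a - b), sq_nonneg (b - c), sq_nonneg (a - c)]
  have h2 : (1 : ℝ) ≤ 2 ^ r := Real.one_le_rpow (by norm_num) hr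
  have h3 : (12 : ℝ) ^ r = 3 ^ r * (2 ^ r * 2 ^ r) := by
    rw [← Real.mul_rpow, ← Real.mul_rpow] <;> norm_num
  calc ((a + b + c) ^ 2) ^ r ≤ (3 * (a ^ 2 + b ^ 2 + c ^ 2)) ^ r := by gcongr
    _ = 3 ^ r * (a ^ 2 + b ^ 2 + c ^ 2) ^ r := Real.mul_rpow (by norm_num) (by positivity)
    _ ≤ 3 ^ r * (2 ^ r * ((a ^ 2 + b ^ 2) ^ r + (c ^ 2) ^ r)) := by
        gcongr
        exact add_rpow_le_two_rpow_mul hr (by positivity) (by positivity)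
    _ ≤ 3 ^ r * (2 ^ r * (2 ^ r * ((a ^ 2) ^ r + (b ^ 2) ^ r) + 2 ^ r * (c ^ 2) ^ r)) := by
        gcongr
        · exact add_rpow_le_two_rpow_mul hr (by positivity) (by positivity)
        · exact le_mul_of_one_le_left (by positivity) h2
    _ = _ := by rw [h3]; ring

lemma rpow_sub_rpow_le_mul {r a b : ℝ} (hr : 1 ≤ r) (hb : 0 ≤ b) (hab : b ≤ a) :
    a ^ r - b ^ r ≤ r * a ^ (r - 1) * (a - b) := by
  rcases hb.eq_or_lt with rfl | hb
  · rcases hab.eq_or_lt with rfl | ha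
    · simp
    · rw [Real.zero_rpow (by linarith), sub_zero, sub_zero, mul_assoc, ← Real.rpow_add_one ha.ne']
      rw [sub_add_cancel]
      nlinarith [Real.rpow_pos_of_pos ha r]
  · have ha : 0 < a := by linarith
    have h := one_add_mul_self_le_rpow_one_add (s := b / a - 1) (by
      have : 0 ≤ b / a := by positivity
      linarith) hr
    rw [show 1 + (b / a - 1) = b / a by ring, Real.div_rpow hb.le ha.le] at h
    have har : 0 < a ^ r := by positivity
    rw [le_div_iff₀ har] at h
    have e : a ^ r = a ^ (r - 1) * a := by
      rw [← Real.rpow_add_one ha.ne', sub_add_cancel]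
    have : (1 + r * (b / a - 1)) * a ^ r = a ^ r - r * a ^ (r - 1) * (a - b) := by
      rw [e]; field_simp; ring
    linarith

/-- The odd power map `a ↦ sign a * |a| ^ r`. -/
noncomputable def oddPow (r a : ℝ) : ℝ := a * |a| ^ (r - 1)

lemma oddPow_neg (r a : ℝ) : oddPow r (-a) = -oddPow r a := by
  simp [oddPow]

lemma sq_oddPow {r : ℝ} (hr : 1 ≤ r) (a : ℝ) : oddPow r a ^ 2 = (a ^ 2) ^ r := by
  rw [oddPow, mul_pow, ← sq_abs a, ← Real.rpow_natCast (|a| ^ (r - 1)), ← Real.rpow_mul (abs_nonneg a),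
    ← Real.rpow_natCast |a|, ← Real.rpow_mul (abs_nonneg a),
    ← Real.rpow_add' (abs_nonneg a) (by push_cast; linarith)]
  congr 1; push_cast; ring

lemma abs_oddPow_sub_le {r : ℝ} (hr : 1 ≤ r) (a b : ℝ) :
    |oddPow r a - oddPow r b| ≤ r * max |a| |b| ^ (r - 1) * |a - b| := by
  wlog hba : |b| ≤ |a| generalizing a b
  · rw [abs_sub_comm, max_comm, abs_sub_comm a]
    exact this b a (le_of_not_ge hba)
  wlog ha : 0 ≤ a generalizing a b
  · have := this (-a) (-b) (by simpa using hba) (by linarith)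
    simp only [oddPow_neg, abs_neg] at this
    rwa [neg_sub_neg, neg_sub_neg, abs_sub_comm, abs_sub_comm b] at this
  rw [max_eq_left hba, abs_of_nonneg ha] at *
  have key : ∀ Y : ℝ, 0 ≤ Y → Y * Y ^ (r - 1) = Y ^ r := by
    intro Y hY
    rw [← Real.rpow_one_add' hY (by linarith)]
    congr 1; ring
  rcases le_total 0 b with hb | hb
  · rw [abs_of_nonneg hb] at hba
    rw [oddPow, oddPow, abs_of_nonneg ha, abs_of_nonneg hb, key a ha, key b hb,
      abs_of_nonneg (by linarith : 0 ≤ a - b), abs_of_nonneg]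
    · exact rpow_sub_rpow_le_mul hr hb hba
    · have : b ^ r ≤ a ^ r := by gcongr
      linarith
  · rw [abs_of_nonpos hb] at hba
    rw [oddPow, oddPow, abs_of_nonneg ha, abs_of_nonpos hb, abs_of_nonneg (by linarith : 0 ≤ a - b)]
    have h1 : (-b) ^ (r - 1) ≤ a ^ (r - 1) := by
      apply Real.rpow_le_rpow <;> linarith
    have h2 : 0 ≤ (-b) ^ (r - 1) := Real.rpow_nonneg (by linarith) _
    have h3 : 0 ≤ a ^ (r - 1) := Real.rpow_nonneg (by linarith) _
    rw [abs_of_nonneg (by nlinarith)]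
    have h4 : (-b) * (-b) ^ (r - 1) ≤ (-b) * a ^ (r - 1) :=
      mul_le_mul_of_nonneg_left h1 (by linarith)
    have h5 : 0 ≤ a ^ (r - 1) * (a - b) := mul_nonneg h3 (by linarith)
    nlinarith

lemma sq_oddPow_sub_le {r : ℝ} (hr : 1 ≤ r) (a b : ℝ) :
    (oddPow r a - oddPow r b) ^ 2 ≤
      r ^ 2 * ((a ^ 2) ^ (r - 1) + (b ^ 2) ^ (r - 1)) * (a - b) ^ 2 := by
  have h := abs_oddPow_sub_le hr a b
  have h2 : (max |a| |b| ^ (r - 1)) ^ 2 ≤ (a ^ 2) ^ (r - 1) + (b ^ 2) ^ (r - 1) := by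
    have e : ∀ Y : ℝ, (|Y| ^ (r - 1)) ^ 2 = (Y ^ 2) ^ (r - 1) := by
      intro Y
      rw [← sq_abs Y, ← Real.rpow_natCast, ← Real.rpow_mul (abs_nonneg Y), mul_comm,
        Real.rpow_mul (abs_nonneg Y), Real.rpow_natCast]
    have ha : 0 ≤ (a ^ 2) ^ (r - 1) := by positivity
    have hb : 0 ≤ (b ^ 2) ^ (r - 1) := by positivity
    rcases max_choice |a| |b| with h | h <;> rw [h, e] <;> linarith
  calc (oddPow r a - oddPow r b) ^ 2 = |oddPow r a - oddPow r b| ^ 2 := (sq_abs _).symm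
    _ ≤ (r * max |a| |b| ^ (r - 1) * |a - b|) ^ 2 := by gcongr
    _ = r ^ 2 * (max |a| |b| ^ (r - 1)) ^ 2 * (a - b) ^ 2 := by
        rw [mul_pow, mul_pow, sq_abs]
    _ ≤ _ := by gcongr

/-- The sum over the directions in `S` of the squared forward and backward differences. -/
def sqGrad {Ω ι : Type*} [AddCommGroup Ω] (e : ι → Ω) (S : Finset ι) (h : Ω → ℝ) (x : Ω) : ℝ :=
  ∑ j ∈ S, ((h (x + e j) - h x) ^ 2 + (h (x - e j) - h x) ^ 2)

lemma sqGrad_nonneg {Ω ι : Type*} [AddCommGroup Ω] (e : ι → Ω) (S : Finset ι) (h : Ω → ℝ) (x : Ω) :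
    0 ≤ sqGrad e S h x := sum_nonneg fun _ _ => by positivity

section Translation

variable {Ω : Type*} [AddCommGroup Ω] [Fintype Ω]

lemma sum_comp_add_right (F : Ω → ℝ) (u : Ω) : ∑ x, F (x + u) = ∑ x, F x :=
  Equiv.sum_comp (Equiv.addRight u) F

lemma sum_comp_sub_right (F : Ω → ℝ) (u : Ω) : ∑ x, F (x - u) = ∑ x, F x :=
  Equiv.sum_comp (Equiv.subRight u) F

/-- The short diagonals inequality for commuting involutive translations. -/
lemma sum_sq_sub_add_le (G : Ω → ℝ) {u : Ω} (hu : u + u = 0) (v : Ω) :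
    ∑ x, (G (x + (u + v)) - G x) ^ 2 ≤
      ∑ x, (G (x + u) - G x) ^ 2 + ∑ x, (G (x + v) - G x) ^ 2 := by
  have h1 : ∑ x, (G (x + v) - G (x + u)) ^ 2 = ∑ x, (G (x + (u + v)) - G x) ^ 2 := by
    rw [← sum_comp_add_right (fun x => (G (x + v) - G (x + u)) ^ 2) u]
    refine sum_congr rfl fun x _ => ?_
    rw [add_assoc x u u, hu, add_zero, add_assoc]
  have h2 : ∑ x, (G (x + (u + v)) - G (x + u)) ^ 2 = ∑ x, (G (x + v) - G x) ^ 2 := by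
    rw [← sum_comp_add_right (fun x => (G (x + v) - G x) ^ 2) u]
    simp only [add_assoc]
  have h3 : ∑ x, (G (x + (u + v)) - G (x + v)) ^ 2 = ∑ x, (G (x + u) - G x) ^ 2 := by
    rw [← sum_comp_add_right (fun x => (G (x + u) - G x) ^ 2) v]
    simp only [add_assoc, add_comm v u]
  have h4 : ∑ x, ((G (x + v) - G (x + u)) ^ 2 + (G (x + (u + v)) - G x) ^ 2) ≤
      ∑ x, ((G (x + (u + v)) - G (x + u)) ^ 2 + (G (x + (u + v)) - G (x + v)) ^ 2 +
        (G (x + u) - G x) ^ 2 + (G (x + v) - G x) ^ 2) := by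
    refine sum_le_sum fun x _ => ?_
    nlinarith [sq_nonneg (G x - G (x + u) - G (x + v) + G (x + (u + v)))]
  simp only [sum_add_distrib] at h4
  linarith

lemma sum_sq_sub_sum_le {ι : Type*} [DecidableEq ι] (G : Ω → ℝ) (u : ι → Ω)
    (hu : ∀ j, u j + u j = 0) (S : Finset ι) :
    ∑ x, (G (x + ∑ j ∈ S, u j) - G x) ^ 2 ≤ ∑ j ∈ S, ∑ x, (G (x + u j) - G x) ^ 2 := by
  induction S using Finset.induction_on with
  | empty => simp
  | insert a s ha ih =>
    rw [sum_insert ha, sum_insert ha]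
    exact (sum_sq_sub_add_le G (hu a) _).trans (by gcongr)

lemma sum_sq_sub_nsmul_le (G : Ω → ℝ) (e : Ω) (T : ℕ) :
    ∑ x, (G (x + T • e) - G x) ^ 2 ≤ (T : ℝ) ^ 2 * ∑ x, (G (x + e) - G x) ^ 2 := by
  calc ∑ x, (G (x + T • e) - G x) ^ 2
      ≤ ∑ x, (T : ℝ) * ∑ i ∈ range T, (G (x + i • e + e) - G (x + i • e)) ^ 2 := by
        refine sum_le_sum fun x _ => ?_
        have h : G (x + T • e) - G x = ∑ i ∈ range T, (G (x + i • e + e) - G (x + i • e)) := by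
          have := sum_range_sub (fun i => G (x + i • e)) T
          simp only [zero_smul, add_zero, succ_nsmul, ← add_assoc] at this
          exact this.symm
        rw [h]
        simpa using sq_sum_le_card_mul_sum_sq (s := range T)
          (f := fun i => G (x + i • e + e) - G (x + i • e))
    _ = _ := by
        rw [← mul_sum, sum_comm]
        have : ∀ i ∈ range T, ∑ x, (G (x + i • e + e) - G (x + i • e)) ^ 2 =
            ∑ x, (G (x + e) - G x) ^ 2 := fun i _ =>
          sum_comp_add_right (fun x => (G (x + e) - G x) ^ 2) (i • e)
        rw [sum_congr rfl this]
        simp; ring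

/-- A Poincaré inequality for functions which are odd under an involutive translation. -/
lemma sum_sq_rpow_le_of_odd {ι : Type*} [DecidableEq ι] {r : ℝ} (hr : 1 ≤ r) (e : ι → Ω) (T : ℕ)
    (he : ∀ j, T • e j + T • e j = 0) (S : Finset ι) (h : Ω → ℝ)
    (hodd : ∀ x, h (x + ∑ j ∈ S, T • e j) = -h x) :
    ∑ x, (h x ^ 2) ^ r ≤ ∑ x, (2 * ((T : ℝ) ^ 2 * r ^ 2 / 4 * sqGrad e S h x)) ^ r := by
  have h1 := sum_sq_sub_sum_le (fun x => oddPow r (h x)) (fun j => T • e j) he S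
  have h2 : ∑ x, (oddPow r (h (x + ∑ j ∈ S, T • e j)) - oddPow r (h x)) ^ 2 =
      4 * ∑ x, (h x ^ 2) ^ r := by
    rw [mul_sum]
    refine sum_congr rfl fun x _ => ?_
    rw [hodd, oddPow_neg, ← sq_oddPow hr]; ring
  rw [h2] at h1
  have h3 : ∑ j ∈ S, ∑ x, (oddPow r (h (x + T • e j)) - oddPow r (h x)) ^ 2 ≤
      ∑ j ∈ S, (T : ℝ) ^ 2 * (r ^ 2 * ∑ x, (h x ^ 2) ^ (r - 1) *
        ((h (x + e j) - h x) ^ 2 + (h (x - e j) - h x) ^ 2)) := by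
    refine sum_le_sum fun j _ => ?_
    refine (sum_sq_sub_nsmul_le (fun x => oddPow r (h x)) (e j) T).trans ?_
    gcongr
    calc ∑ x, (oddPow r (h (x + e j)) - oddPow r (h x)) ^ 2
        ≤ ∑ x, r ^ 2 * ((h (x + e j) ^ 2) ^ (r - 1) + (h x ^ 2) ^ (r - 1)) *
            (h (x + e j) - h x) ^ 2 := sum_le_sum fun x _ => sq_oddPow_sub_le hr _ _
      _ = r ^ 2 * (∑ x, (h (x + e j) ^ 2) ^ (r - 1) * (h (x + e j) - h x) ^ 2 +
            ∑ x, (h x ^ 2) ^ (r - 1) * (h (x + e j) - h x) ^ 2) := by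
          rw [← sum_add_distrib, mul_sum]
          exact sum_congr rfl fun x _ => by ring
      _ = r ^ 2 * (∑ x, (h x ^ 2) ^ (r - 1) * (h (x - e j) - h x) ^ 2 +
            ∑ x, (h x ^ 2) ^ (r - 1) * (h (x + e j) - h x) ^ 2) := by
          congr 2
          rw [← sum_comp_sub_right
            (fun x => (h (x + e j) ^ 2) ^ (r - 1) * (h (x + e j) - h x) ^ 2) (e j)]
          refine sum_congr rfl fun x _ => ?_
          simp only [sub_add_cancel]; ring
      _ = _ := by
          rw [← sum_add_distrib]
          congr 1
          exact sum_congr rfl fun x _ => by ring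
  have h4 : ∑ j ∈ S, (T : ℝ) ^ 2 * (r ^ 2 * ∑ x, (h x ^ 2) ^ (r - 1) *
        ((h (x + e j) - h x) ^ 2 + (h (x - e j) - h x) ^ 2)) =
      4 * ∑ x, (T : ℝ) ^ 2 * r ^ 2 / 4 * sqGrad e S h x * (h x ^ 2) ^ (r - 1) := by
    simp only [sqGrad, mul_sum, sum_mul]
    rw [sum_comm]
    refine sum_congr rfl fun x _ => sum_congr rfl fun j _ => by ring
  have h5 : ∑ x, (T : ℝ) ^ 2 * r ^ 2 / 4 * sqGrad e S h x * (h x ^ 2) ^ (r - 1) ≤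
      ∑ x, ((h x ^ 2) ^ r / 2 + (2 * ((T : ℝ) ^ 2 * r ^ 2 / 4 * sqGrad e S h x)) ^ r / 2) :=
    sum_le_sum fun x _ => mul_rpow_sub_one_le hr
      (mul_nonneg (by positivity) (sqGrad_nonneg e S h x)) (by positivity)
  rw [sum_add_distrib, ← sum_div, ← sum_div] at h5
  linarith

lemma sum_sq_sub_rpow_le {ι : Type*} [DecidableEq ι] {r : ℝ} (hr : 1 ≤ r) (e : ι → Ω) (T : ℕ)
    (he : ∀ j, T • e j + T • e j = 0) (S : Finset ι) (g : Ω → ℝ) :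
    ∑ x, ((g (x + ∑ j ∈ S, T • e j) - g x) ^ 2) ^ r ≤
      2 * 2 ^ r * ((T : ℝ) ^ 2 * r ^ 2) ^ r * ∑ x, sqGrad e S g x ^ r := by
  set u := ∑ j ∈ S, T • e j with hu
  have huu : u + u = 0 := by
    rw [hu, ← sum_add_distrib]; exact sum_eq_zero fun j _ => he j
  have h0 := sum_sq_rpow_le_of_odd hr e T he S (fun x => g (x + u) - g x) (fun x => by
    rw [← hu, add_assoc, huu, add_zero]; ring)
  refine h0.trans ?_
  have h1 : ∀ x, (2 * ((T : ℝ) ^ 2 * r ^ 2 / 4 * sqGrad e S (fun x => g (x + u) - g x) x)) ^ r ≤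
      2 ^ r * ((T : ℝ) ^ 2 * r ^ 2) ^ r * (sqGrad e S g (x + u) ^ r + sqGrad e S g x ^ r) := by
    intro x
    have hle : sqGrad e S (fun x => g (x + u) - g x) x ≤
        2 * (sqGrad e S g (x + u) + sqGrad e S g x) := by
      rw [sqGrad, sqGrad, sqGrad, ← sum_add_distrib, mul_sum]
      refine sum_le_sum fun j _ => ?_
      rw [add_right_comm x (e j) u, sub_add_eq_add_sub x (e j) u]
      nlinarith [sq_nonneg (g (x + u + e j) - g (x + u) + (g (x + e j) - g x)),
        sq_nonneg (g (x + u - e j) - g (x + u) + (g (x - e j) - g x))]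
    have p1 := sqGrad_nonneg e S g x
    have p2 := sqGrad_nonneg e S g (x + u)
    have p3 := sqGrad_nonneg e S (fun x => g (x + u) - g x) x
    calc _ ≤ ((T : ℝ) ^ 2 * r ^ 2 * (sqGrad e S g (x + u) + sqGrad e S g x)) ^ r := by
          apply Real.rpow_le_rpow (by positivity) _ (by linarith)
          nlinarith [mul_le_mul_of_nonneg_left hle (by positivity : 0 ≤ (T : ℝ) ^ 2 * r ^ 2)]
      _ = ((T : ℝ) ^ 2 * r ^ 2) ^ r * (sqGrad e S g (x + u) + sqGrad e S g x) ^ r :=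
          Real.mul_rpow (by positivity) (by positivity)
      _ ≤ ((T : ℝ) ^ 2 * r ^ 2) ^ r *
            (2 ^ r * (sqGrad e S g (x + u) ^ r + sqGrad e S g x ^ r)) := by
          gcongr
          exact add_rpow_le_two_rpow_mul (by linarith) p2 p1
      _ = _ := by ring
  refine (sum_le_sum fun x _ => h1 x).trans (le_of_eq ?_)
  rw [← mul_sum, sum_add_distrib, sum_comp_add_right (fun x => sqGrad e S g x ^ r) u]
  ring

end Translation

lemma sum_coloring_ite_eq {ι : Type*} [Fintype ι] [DecidableEq ι] {L : ℕ} [NeZero L] (j : ι)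
    (ψ : (ι → ZMod L) → ℝ) (hψ : ∀ c t, ψ (c + Pi.single j t) = ψ c) :
    (L : ℝ) * ∑ c, (if c j = 0 then ψ c else 0) = ∑ c, ψ c := by
  have h1 : ∀ t : ZMod L, ∑ c : ι → ZMod L, (if c j = -t then ψ c else 0) =
      ∑ c, (if c j = 0 then ψ c else 0) := by
    intro t
    rw [← sum_comp_sub_right (fun c : ι → ZMod L => if c j = -t then ψ c else 0) (Pi.single j t)]
    refine sum_congr rfl fun c _ => ?_
    have : ψ (c - Pi.single j t) = ψ c :=
      (hψ (c - Pi.single j t) t).symm.trans (congrArg ψ (sub_add_cancel c (Pi.single j t)))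
    simp [this, sub_eq_neg_self]
  calc (L : ℝ) * ∑ c, (if c j = 0 then ψ c else 0)
      = ∑ t : ZMod L, ∑ c : ι → ZMod L, (if c j = -t then ψ c else 0) := by
        simp [h1, ZMod.card]
    _ = ∑ c, ψ c := by
        rw [sum_comm]
        refine sum_congr rfl fun c _ => ?_
        have : ∀ t : ZMod L, (c j = -t) = (t = -c j) := fun t => by
          rw [eq_iff_iff]; constructor <;> (intro h; simp [h])
        simp [this]

/-- Rosenthal's inequality for a sum over a random colour class of a uniform colouring with `L`
colours. -/
lemma sum_coloring_rpow_le {ι : Type*} [Fintype ι] [DecidableEq ι] {L : ℕ} [NeZero L] {r : ℝ}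
    (hr : 1 ≤ r) (a : ι → ℝ) (ha : ∀ j, 0 ≤ a j) :
    ∑ c : ι → ZMod L, (∑ j with c j = 0, a j) ^ r ≤
      (Fintype.card (ι → ZMod L) : ℝ) * (2 ^ r * (∑ j, a j ^ r) / L +
        (2 ^ r * (∑ j, a j) / L) ^ r) := by
  have hL : (0 : ℝ) < L := by exact_mod_cast Nat.pos_of_ne_zero (NeZero.ne L)
  set X : (ι → ZMod L) → ℝ := fun c => ∑ j with c j = 0, a j with hX
  set Y : ι → (ι → ZMod L) → ℝ := fun j c => ∑ i with c i = 0 ∧ i ≠ j, a i with hY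
  have hX0 : ∀ c, 0 ≤ X c := fun c => sum_nonneg fun j _ => ha j
  have hY0 : ∀ j c, 0 ≤ Y j c := fun j c => sum_nonneg fun j _ => ha j
  have hYX : ∀ j c, Y j c ≤ X c := fun j c =>
    sum_le_sum_of_subset_of_nonneg (fun i => by simp +contextual) fun i _ _ => ha i
  have hXY : ∀ j c, c j = 0 → X c = a j + Y j c := by
    intro j c hj
    simp only [hX, hY]
    rw [← sum_erase_add _ _ (by simpa using hj : j ∈ univ.filter fun i => c i = 0), add_comm]
    congr 2
    ext i; simp [and_comm]
  have key : ∀ Z : ℝ, 0 ≤ Z → Z ^ r = Z * Z ^ (r - 1) := by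
    intro Z hZ
    rw [← Real.rpow_one_add' hZ (by linarith)]
    congr 1; ring
  have h2 : (2 : ℝ) ^ r = 2 * 2 ^ (r - 1) := key 2 (by norm_num)
  have hstep : ∀ c, X c ^ r ≤ ∑ j, 2 ^ (r - 1) *
      ((if c j = 0 then a j ^ r else 0) + if c j = 0 then a j * Y j c ^ (r - 1) else 0) := by
    intro c
    rw [key _ (hX0 c)]
    nth_rewrite 1 [hX]
    rw [sum_mul, sum_filter]
    refine sum_le_sum fun j _ => ?_
    split_ifs with hj
    · rw [hXY j c hj, key _ (ha j), ← mul_add, mul_left_comm]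
      exact mul_le_mul_of_nonneg_left
        (add_rpow_le_two_rpow_mul (by linarith) (ha j) (hY0 j c)) (ha j)
    · simp
  have hsum : ∑ c, X c ^ r ≤ ∑ j, 2 ^ (r - 1) *
      ((Fintype.card (ι → ZMod L) : ℝ) * a j ^ r / L + a j / L * ∑ c, X c ^ (r - 1)) := by
    refine (sum_le_sum fun c _ => hstep c).trans ?_
    rw [sum_comm]
    refine sum_le_sum fun j _ => ?_
    rw [← mul_sum, sum_add_distrib]
    have e1 := sum_coloring_ite_eq (L := L) j (fun _ => a j ^ r) (fun _ _ => rfl)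
    have e2 := sum_coloring_ite_eq (L := L) j (fun c => a j * Y j c ^ (r - 1)) (fun c t => by
      have : Y j (c + Pi.single j t) = Y j c := by
        simp only [hY]
        refine sum_congr (filter_congr fun i _ => ?_) fun _ _ => rfl
        refine and_congr_left fun hij => ?_
        simp [Pi.single_eq_of_ne hij]
      rw [this])
    replace e1 := eq_div_of_mul_eq hL.ne' ((mul_comm _ _).trans e1)
    replace e2 := eq_div_of_mul_eq hL.ne' ((mul_comm _ _).trans e2)
    simp only [sum_const, card_univ, nsmul_eq_mul] at e1
    rw [e1, e2, ← mul_sum]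
    gcongr
    rw [div_mul_eq_mul_div]
    have := ha j
    gcongr with c
    · exact hY0 j c
    · exact hYX j c
  rw [← mul_sum, sum_add_distrib, ← sum_mul, ← sum_div, ← sum_div, ← mul_sum] at hsum
  have hA : 0 ≤ ∑ j, a j := sum_nonneg fun j _ => ha j
  have hyoung : ∑ c, 2 ^ (r - 1) * ((∑ j, a j) / L) * X c ^ (r - 1) ≤
      ∑ c, (X c ^ r / 2 + (2 * (2 ^ (r - 1) * ((∑ j, a j) / L))) ^ r / 2) :=
    sum_le_sum fun c _ => mul_rpow_sub_one_le hr (by positivity) (hX0 c)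
  rw [sum_add_distrib, ← sum_div, ← mul_sum, ← mul_assoc, ← h2, sum_const, card_univ,
    nsmul_eq_mul] at hyoung
  have h3 : 2 ^ r * ((∑ j, a j) / L) = 2 ^ r * (∑ j, a j) / (L : ℝ) := by ring
  rw [h3] at hyoung
  have h4 : (Fintype.card (ι → ZMod L) : ℝ) * (2 ^ r * (∑ j, a j ^ r) / L +
        (2 ^ r * (∑ j, a j) / L) ^ r) =
      2 * (2 ^ (r - 1) * ((Fintype.card (ι → ZMod L) : ℝ) * (∑ j, a j ^ r) / L)) +
        (Fintype.card (ι → ZMod L) : ℝ) * (2 ^ r * (∑ j, a j) / L) ^ r := by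
    rw [h2]; ring
  rw [h4]
  change ∑ c, X c ^ r ≤ _
  linarith

section Smoothing

variable {ι : Type*} [Fintype ι] [DecidableEq ι] {N : ℕ} [NeZero N]

lemma sum_prod_pi (F : ι → ZMod N → ℝ) : ∑ d : ι → ZMod N, ∏ i, F i (d i) = ∏ i, ∑ t, F i t := by
  rw [prod_univ_sum, Fintype.piFinset_univ]

lemma sum_prod_mul_mul (κ : ZMod N → ℝ) (hκ : ∑ t, κ t = 1) (u v : ZMod N → ℝ) {i j : ι}
    (hij : i ≠ j) :
    ∑ d : ι → ZMod N, (∏ k, κ (d k)) * (u (d i) * v (d j)) =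
      (∑ t, κ t * u t) * ∑ t, κ t * v t := by
  have h := sum_prod_pi (N := N)
    (fun k t => κ t * ((if k = i then u t else 1) * (if k = j then v t else 1)))
  simp only [prod_mul_distrib, prod_ite_eq', mem_univ, if_true] at h
  rw [h, ← mul_prod_erase univ _ (mem_univ i),
    ← mul_prod_erase (univ.erase i) _ (mem_erase.2 ⟨hij.symm, mem_univ j⟩), prod_eq_one]
  · simp [hij, hij.symm]
  · intro k hk
    simp only [mem_erase, mem_univ, and_true] at hk
    simp [hk.1, hk.2, hκ]

lemma sum_prod_mul (κ : ZMod N → ℝ) (hκ : ∑ t, κ t = 1) (u : ZMod N → ℝ) (i : ι) :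
    ∑ d : ι → ZMod N, (∏ k, κ (d k)) * u (d i) = ∑ t, κ t * u t := by
  have h := sum_prod_pi (N := N) (fun k t => κ t * (if k = i then u t else 1))
  simp only [prod_mul_distrib, prod_ite_eq', mem_univ, if_true] at h
  rw [h, ← mul_prod_erase univ _ (mem_univ i), prod_eq_one]
  · simp
  · intro k hk
    simp only [mem_erase, mem_univ, and_true] at hk
    simp [hk, hκ]

lemma sum_prod_kernel (κ : ZMod N → ℝ) (hκ : ∑ t, κ t = 1) :
    ∑ d : ι → ZMod N, ∏ k, κ (d k) = 1 := by
  rw [sum_prod_pi (fun _ => κ)]; simp [hκ]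

/-- Bessel's inequality for the orthogonal system `d ↦ w (d j)` under a product measure. -/
lemma sum_sq_sum_prod_mul_le (κ : ZMod N → ℝ) (hpos : ∀ t, 0 < κ t) (hκ : ∑ t, κ t = 1)
    (w : ZMod N → ℝ) (hw : ∑ t, κ t * w t = 0) (hw1 : ∀ t, w t ^ 2 ≤ 1)
    (φ : (ι → ZMod N) → ℝ) :
    ∑ j, (∑ d, (∏ k, κ (d k)) * w (d j) * φ d) ^ 2 ≤ ∑ d, (∏ k, κ (d k)) * φ d ^ 2 := by
  set P : (ι → ZMod N) → ℝ := fun d => ∏ k, κ (d k) with hP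
  set b : ι → ℝ := fun j => ∑ d, P d * w (d j) * φ d with hb
  have hP0 : ∀ d, 0 ≤ P d := fun d => prod_nonneg fun k _ => (hpos _).le
  have hworth : ∀ i j, ∑ d, P d * (w (d i) * w (d j)) ≤ if i = j then 1 else 0 := by
    intro i j
    split_ifs with hij
    · subst hij
      calc ∑ d, P d * (w (d i) * w (d i)) ≤ ∑ d, P d := by
            refine sum_le_sum fun d _ => mul_le_of_le_one_right (hP0 d) ?_
            rw [← sq]; exact hw1 _
        _ = 1 := sum_prod_kernel κ hκ
    · exact (sum_prod_mul_mul κ hκ w w hij).le.trans (by simp [hw])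
  have hworth' : ∀ i j, i ≠ j → ∑ d, P d * (w (d i) * w (d j)) = 0 := fun i j hij =>
    (sum_prod_mul_mul κ hκ w w hij).trans (by simp [hw])
  have h0 : 0 ≤ ∑ d, P d * (φ d - ∑ j, b j * w (d j)) ^ 2 :=
    sum_nonneg fun d _ => mul_nonneg (hP0 d) (sq_nonneg _)
  have h1 : ∑ d, P d * (φ d - ∑ j, b j * w (d j)) ^ 2 =
      ∑ d, P d * φ d ^ 2 - 2 * ∑ j, b j ^ 2 +
        ∑ i, ∑ j, b i * b j * ∑ d, P d * (w (d i) * w (d j)) := by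
    have e1 : ∑ j, b j ^ 2 = ∑ d, P d * φ d * ∑ j, b j * w (d j) := by
      simp only [mul_sum]
      rw [sum_comm]
      refine sum_congr rfl fun j _ => ?_
      rw [sq]
      nth_rewrite 2 [hb]
      rw [mul_sum]
      exact sum_congr rfl fun d _ => by ring
    have e2 : ∑ i, ∑ j, b i * b j * ∑ d, P d * (w (d i) * w (d j)) =
        ∑ d, P d * (∑ j, b j * w (d j)) ^ 2 := by
      simp only [mul_sum]
      rw [sum_congr rfl fun i _ => sum_comm, sum_comm]
      refine sum_congr rfl fun d _ => ?_
      rw [sq, sum_mul_sum, mul_sum]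
      refine sum_congr rfl fun i _ => ?_
      rw [mul_sum]
      exact sum_congr rfl fun j _ => by ring
    rw [e1, e2, mul_sum, ← sum_sub_distrib, ← sum_add_distrib]
    exact sum_congr rfl fun d _ => by ring
  have h2 : ∑ i, ∑ j, b i * b j * ∑ d, P d * (w (d i) * w (d j)) ≤ ∑ j, b j ^ 2 := by
    refine sum_le_sum fun i _ => ?_
    rw [sum_eq_single i (fun j _ hj => by rw [hworth' i j hj.symm, mul_zero]) (by simp), ← sq]
    have := hworth i i
    rw [if_pos rfl] at this
    exact mul_le_of_le_one_right (sq_nonneg _) this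
  change ∑ j, b j ^ 2 ≤ ∑ d, P d * φ d ^ 2
  linarith

/-- The average of `f` over translations distributed according to the product of copies of `κ`. -/
def smooth (κ : ZMod N → ℝ) (f : (ι → ZMod N) → ℝ) (x : ι → ZMod N) : ℝ :=
  ∑ d : ι → ZMod N, (∏ k, κ (d k)) * f (x + d)

lemma smooth_add_single_sub (κ : ZMod N → ℝ) (hpos : ∀ t, 0 < κ t) (hκ : ∑ t, κ t = 1)
    (f : (ι → ZMod N) → ℝ) (x : ι → ZMod N) (j : ι) (s : ZMod N) :
    smooth κ f (x + Pi.single j s) - smooth κ f x =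
      ∑ d : ι → ZMod N, (∏ k, κ (d k)) * (κ (d j - s) / κ (d j) - 1) * (f (x + d) - f x) := by
  have hw : ∑ t, κ t * (κ (t - s) / κ t - 1) = 0 := by
    have : ∀ t, κ t * (κ (t - s) / κ t - 1) = κ (t - s) - κ t := fun t => by
      have := (hpos t).ne'
      field_simp
    simp only [this, sum_sub_distrib, sum_comp_sub_right κ s, sub_self]
  have h0 : ∑ d : ι → ZMod N, (∏ k, κ (d k)) * (κ (d j - s) / κ (d j) - 1) * f x = 0 := by
    rw [← sum_mul, sum_prod_mul κ hκ (fun t => κ (t - s) / κ t - 1) j, hw, zero_mul]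
  have h1 : smooth κ f (x + Pi.single j s) =
      ∑ d : ι → ZMod N, (∏ k, κ (d k)) * (κ (d j - s) / κ (d j)) * f (x + d) := by
    refine (sum_comp_sub_right (fun d : ι → ZMod N =>
      (∏ k, κ (d k)) * f (x + Pi.single j s + d)) (Pi.single j s)).symm.trans ?_
    refine sum_congr rfl fun d _ => ?_
    have e1 : x + Pi.single j s + (d - Pi.single j s) = x + d := by abel
    have e2 : ∏ k, κ ((d - Pi.single j s : ι → ZMod N) k) = (∏ k, κ (d k)) * (κ (d j - s) / κ (d j)) := by
      have : ∀ k, κ ((d - Pi.single j s : ι → ZMod N) k) =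
          κ (d k) * (if k = j then κ (d k - s) / κ (d k) else 1) := by
        intro k
        by_cases hk : k = j
        · subst hk
          have := (hpos (d k)).ne'
          simp; field_simp
        · simp [hk]
      simp only [this, prod_mul_distrib, prod_ite_eq', mem_univ, if_true]
    rw [e1, e2]
  simp only [mul_sub (_ * _) (f _)]
  rw [sum_sub_distrib, h0, sub_zero, h1, smooth, ← sum_sub_distrib]
  exact sum_congr rfl fun d _ => by ring

lemma sum_sq_smooth_sub_le (κ : ZMod N → ℝ) (hpos : ∀ t, 0 < κ t) (hκ : ∑ t, κ t = 1)
    (s : ZMod N) (hs : ∀ t, κ (t - s) ≤ 2 * κ t) (f : (ι → ZMod N) → ℝ) (x : ι → ZMod N) :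
    ∑ j, (smooth κ f (x + Pi.single j s) - smooth κ f x) ^ 2 ≤
      ∑ d : ι → ZMod N, (∏ k, κ (d k)) * (f (x + d) - f x) ^ 2 := by
  simp only [smooth_add_single_sub κ hpos hκ]
  refine sum_sq_sum_prod_mul_le κ hpos hκ (fun t => κ (t - s) / κ t - 1) ?_ ?_
    (fun d => f (x + d) - f x)
  · have : ∀ t, κ t * (κ (t - s) / κ t - 1) = κ (t - s) - κ t := fun t => by
      have := (hpos t).ne'
      field_simp
    simp only [this, sum_sub_distrib, sum_comp_sub_right κ s, sub_self]
  · intro t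
    have h1 : κ (t - s) / κ t ≤ 2 := (div_le_iff₀ (hpos t)).2 (hs t)
    have h2 : 0 < κ (t - s) / κ t := div_pos (hpos _) (hpos _)
    nlinarith

lemma sq_sum_mul_rpow_le {α : Type*} [Fintype α] {r : ℝ} (hr : 1 ≤ r) (w a : α → ℝ)
    (hw : ∀ i, 0 ≤ w i) (hw1 : ∑ i, w i = 1) :
    ((∑ i, w i * a i) ^ 2) ^ r ≤ ∑ i, w i * (a i ^ 2) ^ r := by
  have h1 : (∑ i, w i * a i) ^ 2 ≤ ∑ i, w i * a i ^ 2 :=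
    Real.pow_arith_mean_le_arith_mean_pow_of_even univ w a (fun i _ => hw i) hw1 even_two
  calc ((∑ i, w i * a i) ^ 2) ^ r ≤ (∑ i, w i * a i ^ 2) ^ r := by gcongr
    _ ≤ _ := Real.rpow_arith_mean_le_arith_mean_rpow univ w (fun i => a i ^ 2)
        (fun i _ => hw i) hw1 (fun i _ => sq_nonneg _) hr

lemma sum_smooth_sub_rpow_le {r : ℝ} (hr : 1 ≤ r) (κ : ZMod N → ℝ) (hpos : ∀ t, 0 < κ t)
    (hκ : ∑ t, κ t = 1) (f : (ι → ZMod N) → ℝ) (e : ι → ZMod N) :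
    ∑ x, ((smooth κ f (x + e) - smooth κ f x) ^ 2) ^ r ≤ ∑ x, ((f (x + e) - f x) ^ 2) ^ r := by
  calc ∑ x, ((smooth κ f (x + e) - smooth κ f x) ^ 2) ^ r
      ≤ ∑ x, ∑ d : ι → ZMod N, (∏ k, κ (d k)) * ((f (x + d + e) - f (x + d)) ^ 2) ^ r := by
        refine sum_le_sum fun x _ => ?_
        have : smooth κ f (x + e) - smooth κ f x =
            ∑ d : ι → ZMod N, (∏ k, κ (d k)) * (f (x + d + e) - f (x + d)) := by
          simp only [smooth, ← sum_sub_distrib, mul_sub, add_right_comm x e]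
        rw [this]
        exact sq_sum_mul_rpow_le hr _ _ (fun d => prod_nonneg fun k _ => (hpos _).le)
          (sum_prod_kernel κ hκ)
    _ = _ := by
        rw [sum_comm]
        have : ∀ d : ι → ZMod N, ∑ x, (∏ k, κ (d k)) * ((f (x + d + e) - f (x + d)) ^ 2) ^ r =
            (∏ k, κ (d k)) * ∑ x, ((f (x + e) - f x) ^ 2) ^ r := fun d => by
          rw [← mul_sum, sum_comp_add_right (fun x => ((f (x + e) - f x) ^ 2) ^ r) d]
        simp only [this]
        rw [← sum_mul, sum_prod_kernel κ hκ, one_mul]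

lemma smooth_sub_self_rpow_le {r : ℝ} (hr : 1 ≤ r) (κ : ZMod N → ℝ) (hpos : ∀ t, 0 < κ t)
    (hκ : ∑ t, κ t = 1) (f : (ι → ZMod N) → ℝ) (x : ι → ZMod N) :
    ((smooth κ f x - f x) ^ 2) ^ r ≤
      ∑ d : ι → ZMod N, (∏ k, κ (d k)) * ((f (x + d) - f x) ^ 2) ^ r := by
  have : smooth κ f x - f x = ∑ d : ι → ZMod N, (∏ k, κ (d k)) * (f (x + d) - f x) := by
    simp only [smooth, mul_sub, sum_sub_distrib]
    rw [← sum_mul, sum_prod_kernel κ hκ, one_mul]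
  rw [this]
  exact sq_sum_mul_rpow_le hr _ _ (fun d => prod_nonneg fun k _ => (hpos _).le)
    (sum_prod_kernel κ hκ)

end Smoothing

section Scalar

variable {ι : Type*} [Fintype ι] [DecidableEq ι] {N L : ℕ} [NeZero N] [NeZero L]

lemma sum_coloring_sqGrad_smooth_le {r : ℝ} (hr : 1 ≤ r) (κ : ZMod N → ℝ) (hpos : ∀ t, 0 < κ t)
    (hκ : ∑ t, κ t = 1) (hsub : ∀ t, κ (t - 1) ≤ 2 * κ t) (hadd : ∀ t, κ (t + 1) ≤ 2 * κ t)
    (f : (ι → ZMod N) → ℝ) :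
    ∑ c : ι → ZMod L, ∑ x, sqGrad (fun j => Pi.single j (1 : ZMod N))
        (univ.filter fun j => c j = 0) (smooth κ f) x ^ r ≤
      (Fintype.card (ι → ZMod L) : ℝ) *
        (2 ^ r * (2 ^ r * (2 * ∑ j, ∑ x, ((f (x + Pi.single j 1) - f x) ^ 2) ^ r)) / L +
          (2 * 2 ^ r / L) ^ r *
            ∑ x, ∑ d : ι → ZMod N, (∏ k, κ (d k)) * ((f (x + d) - f x) ^ 2) ^ r) := by
  set g := smooth κ f with hg
  set e : ι → ι → ZMod N := fun j => Pi.single j (1 : ZMod N) with he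
  set a : (ι → ZMod N) → ι → ℝ := fun x j =>
    (g (x + e j) - g x) ^ 2 + (g (x - e j) - g x) ^ 2 with ha
  have ha0 : ∀ x j, 0 ≤ a x j := fun x j => by positivity
  have hP0 : ∀ d : ι → ZMod N, 0 ≤ ∏ k, κ (d k) := fun d => prod_nonneg fun k _ => (hpos _).le
  have hneg : ∀ x j, x - e j = x + Pi.single j (-1) := fun x j => by
    rw [sub_eq_add_neg, he, Pi.single_neg]
  have hgrad : ∀ x, ∑ j, a x j ≤
      2 * ∑ d : ι → ZMod N, (∏ k, κ (d k)) * (f (x + d) - f x) ^ 2 := by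
    intro x
    have h1 := sum_sq_smooth_sub_le κ hpos hκ 1 hsub f x
    have h2 := sum_sq_smooth_sub_le κ hpos hκ (-1) (fun t => by simpa using hadd t) f x
    rw [ha]
    simp only [sum_add_distrib, hneg]
    linarith
  have h2nd : ∀ x, (2 ^ r * (∑ j, a x j) / (L : ℝ)) ^ r ≤ (2 * 2 ^ r / (L : ℝ)) ^ r *
      ∑ d : ι → ZMod N, (∏ k, κ (d k)) * ((f (x + d) - f x) ^ 2) ^ r := by
    intro x
    have hM : 0 ≤ ∑ d : ι → ZMod N, (∏ k, κ (d k)) * (f (x + d) - f x) ^ 2 :=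
      sum_nonneg fun d _ => mul_nonneg (hP0 d) (sq_nonneg _)
    have hA : 0 ≤ ∑ j, a x j := sum_nonneg fun j _ => ha0 x j
    calc (2 ^ r * (∑ j, a x j) / (L : ℝ)) ^ r
        ≤ (2 * 2 ^ r / (L : ℝ) *
            ∑ d : ι → ZMod N, (∏ k, κ (d k)) * (f (x + d) - f x) ^ 2) ^ r := by
          apply Real.rpow_le_rpow (by positivity) _ (by linarith)
          calc 2 ^ r * (∑ j, a x j) / (L : ℝ) ≤ 2 ^ r * (2 * ∑ d : ι → ZMod N,
                (∏ k, κ (d k)) * (f (x + d) - f x) ^ 2) / (L : ℝ) := by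
                gcongr; exact hgrad x
            _ = _ := by ring
      _ = (2 * 2 ^ r / (L : ℝ)) ^ r *
            (∑ d : ι → ZMod N, (∏ k, κ (d k)) * (f (x + d) - f x) ^ 2) ^ r :=
          Real.mul_rpow (by positivity) hM
      _ ≤ _ := by
          gcongr
          exact Real.rpow_arith_mean_le_arith_mean_rpow univ _ _
            (fun d _ => hP0 d) (sum_prod_kernel κ hκ) (fun d _ => sq_nonneg _) hr
  have h1st : ∑ x, ∑ j, a x j ^ r ≤
      2 ^ r * (2 * ∑ j, ∑ x, ((f (x + Pi.single j 1) - f x) ^ 2) ^ r) := by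
    rw [sum_comm, mul_sum, mul_sum]
    refine sum_le_sum fun j _ => ?_
    have hfwd := sum_smooth_sub_rpow_le hr κ hpos hκ f (e j)
    have hbwd : ∑ x, ((g (x - e j) - g x) ^ 2) ^ r = ∑ x, ((g (x + e j) - g x) ^ 2) ^ r := by
      rw [← sum_comp_add_right (fun x => ((g (x - e j) - g x) ^ 2) ^ r) (e j)]
      refine sum_congr rfl fun x _ => ?_
      simp only [add_sub_cancel_right]
      rw [← neg_sub, neg_sq]
    calc ∑ x, a x j ^ r ≤ ∑ x, 2 ^ r * (((g (x + e j) - g x) ^ 2) ^ r +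
          ((g (x - e j) - g x) ^ 2) ^ r) := sum_le_sum fun x _ =>
            add_rpow_le_two_rpow_mul (by linarith) (sq_nonneg _) (sq_nonneg _)
      _ = 2 ^ r * (2 * ∑ x, ((g (x + e j) - g x) ^ 2) ^ r) := by
          rw [← mul_sum, sum_add_distrib, hbwd, two_mul]
      _ ≤ _ := by gcongr
  calc ∑ c : ι → ZMod L, ∑ x, sqGrad e (univ.filter fun j => c j = 0) g x ^ r
      = ∑ x, ∑ c : ι → ZMod L, (∑ j with c j = 0, a x j) ^ r := sum_comm
    _ ≤ ∑ x, (Fintype.card (ι → ZMod L) : ℝ) * (2 ^ r * (∑ j, a x j ^ r) / L +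
        (2 ^ r * (∑ j, a x j) / L) ^ r) :=
      sum_le_sum fun x _ => sum_coloring_rpow_le hr (a x) (ha0 x)
    _ = (Fintype.card (ι → ZMod L) : ℝ) * (2 ^ r * (∑ x, ∑ j, a x j ^ r) / L +
        ∑ x, (2 ^ r * (∑ j, a x j) / L) ^ r) := by
      rw [← mul_sum, sum_add_distrib, ← sum_div, ← mul_sum]
    _ ≤ _ := by
      rw [mul_sum univ _ ((2 * 2 ^ r / (L : ℝ)) ^ r)]
      gcongr with x
      exact h2nd x

/-- The metric `X_p` inequality for real functions on a discrete torus (with `p = 2 * r`), where the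
last term is an average over translations distributed according to a product measure. -/
lemma sum_coloring_sq_sub_rpow_le {r : ℝ} (hr : 1 ≤ r) (κ : ZMod N → ℝ) (hpos : ∀ t, 0 < κ t)
    (hκ : ∑ t, κ t = 1) (hsub : ∀ t, κ (t - 1) ≤ 2 * κ t) (hadd : ∀ t, κ (t + 1) ≤ 2 * κ t)
    (T : ℕ) (hT : ((T + T : ℕ) : ZMod N) = 0) (f : (ι → ZMod N) → ℝ) :
    ∑ c : ι → ZMod L, ∑ x,
        ((f (x + ∑ j with c j = 0, T • Pi.single j (1 : ZMod N)) - f x) ^ 2) ^ r ≤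
      (Fintype.card (ι → ZMod L) : ℝ) * (12 ^ r * (2 * 2 ^ r * ((T : ℝ) ^ 2 * r ^ 2) ^ r *
        (2 ^ r * (2 ^ r * (2 * ∑ j, ∑ x, ((f (x + Pi.single j 1) - f x) ^ 2) ^ r)) / L +
          (2 * 2 ^ r / L) ^ r *
            ∑ x, ∑ d : ι → ZMod N, (∏ k, κ (d k)) * ((f (x + d) - f x) ^ 2) ^ r) +
          2 * ∑ x, ∑ d : ι → ZMod N, (∏ k, κ (d k)) * ((f (x + d) - f x) ^ 2) ^ r)) := by
  have hgrad := sum_coloring_sqGrad_smooth_le (L := L) hr κ hpos hκ hsub hadd f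
  set B := ∑ x, ∑ d : ι → ZMod N, (∏ k, κ (d k)) * ((f (x + d) - f x) ^ 2) ^ r with hB
  set A := ∑ j, ∑ x, ((f (x + Pi.single j 1) - f x) ^ 2) ^ r with hA
  set g := smooth κ f with hg
  have hgf : ∑ x, ((g x - f x) ^ 2) ^ r ≤ B :=
    sum_le_sum fun x _ => smooth_sub_self_rpow_le hr κ hpos hκ f x
  have he : ∀ j : ι, T • Pi.single j (1 : ZMod N) + T • Pi.single j (1 : ZMod N) =
      (0 : ι → ZMod N) := by
    intro j
    rw [← add_smul, ← Pi.single_smul, nsmul_one, hT, Pi.single_zero]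
  have hc : ∀ c : ι → ZMod L, ∑ x,
      ((f (x + ∑ j with c j = 0, T • Pi.single j (1 : ZMod N)) - f x) ^ 2) ^ r ≤
      12 ^ r * (2 * 2 ^ r * ((T : ℝ) ^ 2 * r ^ 2) ^ r *
        ∑ x, sqGrad (fun j => Pi.single j (1 : ZMod N))
          (univ.filter fun j => c j = 0) g x ^ r + 2 * B) := by
    intro c
    have hpoinc := sum_sq_sub_rpow_le hr (fun j => Pi.single j (1 : ZMod N)) T he
      (univ.filter fun j => c j = 0) g
    set u : ι → ZMod N := ∑ j with c j = 0, T • Pi.single j (1 : ZMod N)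
    have hfg : ∑ x, ((f (x + u) - g (x + u)) ^ 2) ^ r ≤ B := by
      rw [sum_comp_add_right (fun x => ((f x - g x) ^ 2) ^ r) u]
      refine le_trans (le_of_eq (sum_congr rfl fun x _ => ?_)) hgf
      rw [← neg_sub, neg_sq]
    calc ∑ x, ((f (x + u) - f x) ^ 2) ^ r
        ≤ ∑ x, 12 ^ r * (((g (x + u) - g x) ^ 2) ^ r + ((f (x + u) - g (x + u)) ^ 2) ^ r +
            ((g x - f x) ^ 2) ^ r) := by
          refine sum_le_sum fun x _ => ?_
          have := sq_add_three_rpow_le (by linarith : 0 ≤ r) (g (x + u) - g x)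
            (f (x + u) - g (x + u)) (g x - f x)
          rwa [show g (x + u) - g x + (f (x + u) - g (x + u)) + (g x - f x) = f (x + u) - f x by
            ring] at this
      _ = 12 ^ r * (∑ x, ((g (x + u) - g x) ^ 2) ^ r + ∑ x, ((f (x + u) - g (x + u)) ^ 2) ^ r +
            ∑ x, ((g x - f x) ^ 2) ^ r) := by
          rw [← mul_sum, sum_add_distrib, sum_add_distrib]
      _ ≤ _ := by
          refine mul_le_mul_of_nonneg_left ?_ (by positivity)
          linarith
  refine (sum_le_sum fun c _ => hc c).trans ?_
  rw [← mul_sum, sum_add_distrib, ← mul_sum, sum_const, card_univ, nsmul_eq_mul]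
  calc _ ≤ 12 ^ r * (2 * 2 ^ r * ((T : ℝ) ^ 2 * r ^ 2) ^ r * ((Fintype.card (ι → ZMod L) : ℝ) *
        (2 ^ r * (2 ^ r * (2 * A)) / L + (2 * 2 ^ r / L) ^ r * B)) +
        (Fintype.card (ι → ZMod L) : ℝ) * (2 * B)) := by gcongr
    _ = _ := by ring

end Scalar

section Kernel

lemma natAbs_valMinAbs_add_le_add {N : ℕ} (a b : ZMod N) :
    (a + b).valMinAbs.natAbs ≤ a.valMinAbs.natAbs + b.valMinAbs.natAbs :=
  (ZMod.natAbs_valMinAbs_add_le a b).trans (Int.natAbs_add_le _ _)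

variable {N : ℕ} [NeZero N]

/-- The two-sided geometric probability distribution on the cyclic group `ZMod N`. -/
noncomputable def geomKernel (N : ℕ) [NeZero N] (t : ZMod N) : ℝ :=
  (1 / 2) ^ t.valMinAbs.natAbs / ∑ s : ZMod N, (1 / 2 : ℝ) ^ s.valMinAbs.natAbs

lemma one_le_sum_geom : 1 ≤ ∑ s : ZMod N, (1 / 2 : ℝ) ^ s.valMinAbs.natAbs := by
  have := single_le_sum (f := fun s : ZMod N => (1 / 2 : ℝ) ^ s.valMinAbs.natAbs)
    (fun s _ => by positivity) (mem_univ 0)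
  simpa using this

lemma geomKernel_pos (t : ZMod N) : 0 < geomKernel N t :=
  div_pos (by positivity) (zero_lt_one.trans_le one_le_sum_geom)

lemma sum_geomKernel : ∑ t, geomKernel N t = 1 := by
  simp only [geomKernel]
  rw [← sum_div]
  exact div_self (zero_lt_one.trans_le one_le_sum_geom).ne'

lemma natAbs_valMinAbs_one_le : (1 : ZMod N).valMinAbs.natAbs ≤ 1 := by
  rw [ZMod.valMinAbs_natAbs_eq_min]
  exact (min_le_left _ _).trans (by rw [ZMod.val_one_eq_one_mod]; exact Nat.mod_le _ _)

lemma geomKernel_le_two_mul {a b : ZMod N} (h : b.valMinAbs.natAbs ≤ a.valMinAbs.natAbs + 1) :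
    geomKernel N a ≤ 2 * geomKernel N b := by
  have hZ := zero_lt_one.trans_le (one_le_sum_geom (N := N))
  rw [geomKernel, geomKernel, ← mul_div_assoc]
  gcongr
  calc (1 / 2 : ℝ) ^ a.valMinAbs.natAbs = 2 * (1 / 2) ^ (a.valMinAbs.natAbs + 1) := by
        rw [pow_succ]; ring
    _ ≤ _ := mul_le_mul_of_nonneg_left
        (pow_le_pow_of_le_one (by norm_num : (0 : ℝ) ≤ 1 / 2) (by norm_num) h) (by norm_num)

lemma geomKernel_sub_one_le (t : ZMod N) : geomKernel N (t - 1) ≤ 2 * geomKernel N t := by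
  apply geomKernel_le_two_mul
  have h := natAbs_valMinAbs_add_le_add (t - 1) 1
  rw [sub_add_cancel] at h
  have := natAbs_valMinAbs_one_le (N := N)
  omega

lemma geomKernel_add_one_le (t : ZMod N) : geomKernel N (t + 1) ≤ 2 * geomKernel N t := by
  apply geomKernel_le_two_mul
  have h := natAbs_valMinAbs_add_le_add (t + 1) (-1)
  rw [add_neg_cancel_right, ZMod.natAbs_valMinAbs_neg] at h
  have := natAbs_valMinAbs_one_le (N := N)
  omega

lemma summable_int_pow_mul_geom (k : ℕ) :
    Summable fun z : ℤ => (1 / 2 : ℝ) ^ z.natAbs * (z.natAbs : ℝ) ^ k := by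
  have h : Summable fun m : ℕ => (1 / 2 : ℝ) ^ m * (m : ℝ) ^ k := by
    simpa only [mul_comm] using
      summable_pow_mul_geometric_of_norm_lt_one (R := ℝ) k (r := 1 / 2) (by norm_num)
  apply Summable.of_nat_of_neg <;> simpa using h

lemma exists_sum_geomKernel_mul_rpow_le {p : ℝ} (hp : 0 < p) :
    ∃ M : ℝ, 0 ≤ M ∧ ∀ (N : ℕ) [NeZero N],
      ∑ t, geomKernel N t * (t.valMinAbs.natAbs : ℝ) ^ p ≤ M := by
  set F : ℤ → ℝ := fun z => (1 / 2 : ℝ) ^ z.natAbs * (z.natAbs : ℝ) ^ ⌈p⌉₊ with hF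
  have hF0 : ∀ z, 0 ≤ F z := fun z => by positivity
  refine ⟨∑' z, F z, tsum_nonneg hF0, fun N _ => ?_⟩
  calc ∑ t, geomKernel N t * (t.valMinAbs.natAbs : ℝ) ^ p ≤ ∑ t : ZMod N, F t.valMinAbs := by
        refine sum_le_sum fun t _ => ?_
        have h1 : geomKernel N t ≤ (1 / 2) ^ t.valMinAbs.natAbs :=
          div_le_self (by positivity) one_le_sum_geom
        have h2 : (t.valMinAbs.natAbs : ℝ) ^ p ≤ (t.valMinAbs.natAbs : ℝ) ^ ⌈p⌉₊ := by
          rcases Nat.eq_zero_or_pos t.valMinAbs.natAbs with h | h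
          · rw [h]
            simp [Real.zero_rpow hp.ne']
          · rw [← Real.rpow_natCast]
            exact Real.rpow_le_rpow_of_exponent_le (by exact_mod_cast h) (Nat.le_ceil p)
        exact mul_le_mul h1 h2 (by positivity) (by positivity)
    _ = ∑ z ∈ univ.image (ZMod.valMinAbs : ZMod N → ℤ), F z :=
        (sum_image fun a _ b _ h => ZMod.injective_valMinAbs h).symm
    _ ≤ ∑' z, F z := (summable_int_pow_mul_geom ⌈p⌉₊).sum_le_tsum _ fun z _ => hF0 z

end Kernel

section Transfer

open MeasureTheory

lemma LpSpace.integrable_and_integral_eq {p : ℝ} (hp : 0 < p) (F : LpSpace p) :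
    Integrable (fun s => ((F s) ^ 2) ^ (p / 2)) ∧ ∫ s, ((F s) ^ 2) ^ (p / 2) = ‖F‖ ^ p := by
  have e : ∀ s, ((F s) ^ 2) ^ (p / 2) = ‖F s‖ ^ p := fun s => by
    rw [Real.norm_eq_abs, ← sq_abs, ← Real.rpow_natCast, ← Real.rpow_mul (abs_nonneg _)]
    congr 1; push_cast; ring
  have h0 : ENNReal.ofReal p ≠ 0 := by simpa using hp
  have hm := Lp.memLp F
  simp only [e]
  constructor
  · have := hm.integrable_norm_rpow h0 ENNReal.ofReal_ne_top
    rwa [ENNReal.toReal_ofReal hp.le] at this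
  · have hI : 0 ≤ ∫ s, ‖F s‖ ^ p := integral_nonneg fun s => by positivity
    rw [Lp.norm_def, hm.eLpNorm_eq_integral_rpow_norm h0 ENNReal.ofReal_ne_top,
      ENNReal.toReal_ofReal hp.le, ENNReal.toReal_ofReal (by positivity),
      ← Real.rpow_mul hI, inv_mul_cancel₀ hp.ne', Real.rpow_one]

lemma LpSpace.integrable_and_integral_sub_eq {p : ℝ} (hp : 0 < p) (F G : LpSpace p) :
    Integrable (fun s => ((F s - G s) ^ 2) ^ (p / 2)) ∧
      ∫ s, ((F s - G s) ^ 2) ^ (p / 2) = ‖F - G‖ ^ p := by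
  have h := LpSpace.integrable_and_integral_eq hp (F - G)
  have e : (fun s => (((F - G : LpSpace p) s) ^ 2) ^ (p / 2)) =ᵐ[volume]
      fun s => ((F s - G s) ^ 2) ^ (p / 2) := by
    filter_upwards [Lp.coeFn_sub F G] with s hs
    rw [hs, Pi.sub_apply]
  exact ⟨h.1.congr e, by rw [← h.2]; exact (integral_congr_ae e).symm⟩

/-- The metric `X_p` inequality for `L_p`-valued functions on a discrete torus. -/
lemma exists_sum_coloring_norm_sub_rpow_le {p : ℝ} (hp : 2 ≤ p) :
    ∃ C : ℝ, 0 < C ∧ ∀ (n N L : ℕ) [NeZero N] [NeZero L] (T : ℕ),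
      ((T + T : ℕ) : ZMod N) = 0 → ∀ f : (Fin n → ZMod N) → LpSpace p,
      ∑ c : Fin n → ZMod L, ∑ x,
        ‖f (x + ∑ j with c j = 0, T • Pi.single j (1 : ZMod N)) - f x‖ ^ p ≤
      (Fintype.card (Fin n → ZMod L) : ℝ) * (C *
        ((T : ℝ) ^ p / L * ∑ j, ∑ x, ‖f (x + Pi.single j 1) - f x‖ ^ p +
          ((T : ℝ) ^ p / (L : ℝ) ^ (p / 2) + 1) *
            ∑ x, ∑ d : Fin n → ZMod N, (∏ k, geomKernel N (d k)) * ‖f (x + d) - f x‖ ^ p)) := by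
  have hr : 1 ≤ p / 2 := by linarith
  have hp0 : 0 < p := by linarith
  set r := p / 2 with hrdef
  set C₁ : ℝ := 12 ^ r * (2 * 2 ^ r * (r ^ 2) ^ r * (2 ^ r * (2 ^ r * 2))) with hC₁
  set C₂ : ℝ := 12 ^ r * (2 * 2 ^ r * (r ^ 2) ^ r * (2 * 2 ^ r) ^ r) with hC₂
  refine ⟨C₁ + C₂ + 12 ^ r * 2, by positivity, fun n N L _ _ T hT f => ?_⟩
  set C := C₁ + C₂ + 12 ^ r * 2 with hC
  have hC1 : C₁ ≤ C := by
    have : 0 ≤ C₂ + 12 ^ r * 2 := by positivity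
    linarith
  have hC2 : C₂ ≤ C := by
    have : 0 ≤ C₁ + 12 ^ r * 2 := by positivity
    linarith
  have hC3 : 12 ^ r * 2 ≤ C := by
    have : 0 ≤ C₁ + C₂ := by positivity
    linarith
  have hL : (0 : ℝ) < L := by exact_mod_cast Nat.pos_of_ne_zero (NeZero.ne L)
  set K : ℝ := (Fintype.card (Fin n → ZMod L) : ℝ) with hK
  have hP0 : ∀ d : Fin n → ZMod N, 0 ≤ ∏ k, geomKernel N (d k) :=
    fun d => prod_nonneg fun k _ => (geomKernel_pos _).le
  have hT2 : ((T : ℝ) ^ 2) ^ r = (T : ℝ) ^ p := by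
    rw [← Real.rpow_natCast, ← Real.rpow_mul (Nat.cast_nonneg T)]
    congr 1; push_cast; rw [hrdef]; ring
  have hscalar : ∀ s : ℝ, ∑ c : Fin n → ZMod L, ∑ x,
        ((f (x + ∑ j with c j = 0, T • Pi.single j (1 : ZMod N)) s - f x s) ^ 2) ^ r ≤
      K * (C * ((T : ℝ) ^ p / L * ∑ j, ∑ x, ((f (x + Pi.single j 1) s - f x s) ^ 2) ^ r +
          ((T : ℝ) ^ p / (L : ℝ) ^ r + 1) *
            ∑ x, ∑ d : Fin n → ZMod N,
              (∏ k, geomKernel N (d k)) * ((f (x + d) s - f x s) ^ 2) ^ r)) := by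
    intro s
    refine (sum_coloring_sq_sub_rpow_le (L := L) hr (geomKernel N) geomKernel_pos sum_geomKernel
      geomKernel_sub_one_le geomKernel_add_one_le T hT (fun x => f x s)).trans ?_
    set A := ∑ j, ∑ x, ((f (x + Pi.single j 1) s - f x s) ^ 2) ^ r
    set B := ∑ x, ∑ d : Fin n → ZMod N,
              (∏ k, geomKernel N (d k)) * ((f (x + d) s - f x s) ^ 2) ^ r
    have hA : 0 ≤ A := sum_nonneg fun j _ => sum_nonneg fun x _ => by positivity
    have hB : 0 ≤ B := sum_nonneg fun x _ => sum_nonneg fun d _ =>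
      mul_nonneg (hP0 d) (by positivity)
    refine mul_le_mul_of_nonneg_left ?_ (by positivity)
    rw [Real.mul_rpow (by positivity) (by positivity), hT2,
      Real.div_rpow (by positivity) (by positivity)]
    calc _ = C₁ * ((T : ℝ) ^ p / L * A) + C₂ * ((T : ℝ) ^ p / (L : ℝ) ^ r * B) +
          12 ^ r * 2 * B := by
          rw [hC₁, hC₂]; ring
      _ ≤ C * ((T : ℝ) ^ p / L * A) + C * ((T : ℝ) ^ p / (L : ℝ) ^ r * B) + C * B := by gcongr
      _ = _ := by ring
  have hint : ∀ F G : LpSpace p, Integrable (fun s => ((F s - G s) ^ 2) ^ r) :=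
    fun F G => (LpSpace.integrable_and_integral_sub_eq hp0 F G).1
  have hval : ∀ F G : LpSpace p, ‖F - G‖ ^ p = ∫ s, ((F s - G s) ^ 2) ^ r :=
    fun F G => (LpSpace.integrable_and_integral_sub_eq hp0 F G).2.symm
  have iA : ∀ j, ∀ x : Fin n → ZMod N,
      Integrable fun s => ((f (x + Pi.single j 1) s - f x s) ^ 2) ^ r := fun j x => hint _ _
  have iB : ∀ x d : Fin n → ZMod N, Integrable fun s =>
      (∏ k, geomKernel N (d k)) * ((f (x + d) s - f x s) ^ 2) ^ r :=
    fun x d => (hint _ _).const_mul _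
  simp only [hval, ← integral_const_mul]
  have eL : ∑ c : Fin n → ZMod L, ∑ x : Fin n → ZMod N, ∫ s,
      ((f (x + ∑ j with c j = 0, T • Pi.single j (1 : ZMod N)) s - f x s) ^ 2) ^ r =
      ∫ s, ∑ c : Fin n → ZMod L, ∑ x : Fin n → ZMod N,
      ((f (x + ∑ j with c j = 0, T • Pi.single j (1 : ZMod N)) s - f x s) ^ 2) ^ r := by
    rw [integral_finsetSum _ fun c _ => integrable_finsetSum _ fun x _ => hint _ _]
    exact sum_congr rfl fun c _ => (integral_finsetSum _ fun x _ => hint _ _).symm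
  have eA : ∑ j, ∑ x : Fin n → ZMod N, ∫ s, ((f (x + Pi.single j 1) s - f x s) ^ 2) ^ r =
      ∫ s, ∑ j, ∑ x : Fin n → ZMod N, ((f (x + Pi.single j 1) s - f x s) ^ 2) ^ r := by
    rw [integral_finsetSum _ fun j _ => integrable_finsetSum _ fun x _ => iA j x]
    exact sum_congr rfl fun c _ => (integral_finsetSum _ fun x _ => iA _ x).symm
  have eB : ∑ x, ∑ d : Fin n → ZMod N, ∫ s,
      (∏ k, geomKernel N (d k)) * ((f (x + d) s - f x s) ^ 2) ^ r =
      ∫ s, ∑ x, ∑ d : Fin n → ZMod N,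
        (∏ k, geomKernel N (d k)) * ((f (x + d) s - f x s) ^ 2) ^ r := by
    rw [integral_finsetSum _ fun x _ => integrable_finsetSum _ fun d _ => iB x d]
    exact sum_congr rfl fun c _ => (integral_finsetSum _ fun x _ => iB _ x).symm
  have jA : Integrable fun s => ∑ j, ∑ x : Fin n → ZMod N,
      ((f (x + Pi.single j 1) s - f x s) ^ 2) ^ r :=
    integrable_finsetSum _ fun j _ => integrable_finsetSum _ fun x _ => iA j x
  have jB : Integrable fun s => ∑ x, ∑ d : Fin n → ZMod N,
      (∏ k, geomKernel N (d k)) * ((f (x + d) s - f x s) ^ 2) ^ r :=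
    integrable_finsetSum _ fun x _ => integrable_finsetSum _ fun d _ => iB x d
  rw [eL, eA, eB, ← integral_const_mul, ← integral_const_mul,
    ← integral_add (jA.const_mul _) (jB.const_mul _), ← integral_const_mul, ← integral_const_mul]
  exact integral_mono
    (integrable_finsetSum _ fun c _ => integrable_finsetSum _ fun x _ => hint _ _)
    ((((jA.const_mul _).add (jB.const_mul _)).const_mul C).const_mul K) hscalar

end Transfer

section Fold

variable {N : ℕ} [NeZero N]

/-- The folding map of the cyclic group `ZMod N` onto a path, sending `t` to its distance to `0`. -/
def pathFold (t : ZMod N) : Fin N :=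
  ⟨t.valMinAbs.natAbs, (ZMod.natAbs_valMinAbs_le t).trans_lt
    (Nat.div_lt_self (Nat.pos_of_ne_zero (NeZero.ne N)) one_lt_two)⟩

lemma abs_pathFold_add_sub_pathFold_le (s t : ZMod N) :
    |((pathFold (s + t) : ℕ) : ℝ) - ((pathFold s : ℕ) : ℝ)| ≤ (t.valMinAbs.natAbs : ℝ) := by
  have h1 := natAbs_valMinAbs_add_le_add s t
  have h2 := natAbs_valMinAbs_add_le_add (s + t) (-t)
  rw [add_neg_cancel_right, ZMod.natAbs_valMinAbs_neg] at h2
  have h1' : ((pathFold (s + t) : ℕ) : ℝ) ≤ (pathFold s : ℕ) + (t.valMinAbs.natAbs : ℝ) := by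
    exact_mod_cast h1
  have h2' : ((pathFold s : ℕ) : ℝ) ≤ (pathFold (s + t) : ℕ) + (t.valMinAbs.natAbs : ℝ) := by
    exact_mod_cast h2
  rw [abs_le]
  constructor <;> linarith

lemma pathFold_eq_min (s : ZMod N) : (pathFold s : ℕ) = min s.val (N - s.val) :=
  ZMod.valMinAbs_natAbs_eq_min s

lemma val_add_natCast_of_lt (s : ZMod N) {T : ℕ} (hT : T < N) :
    (s + (T : ZMod N)).val = if s.val + T < N then s.val + T else s.val + T - N := by
  have hs := ZMod.val_lt s
  have hTv : ((T : ZMod N)).val = T := ZMod.val_cast_of_lt hT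
  split_ifs with h
  · rw [ZMod.val_add_of_lt (by rwa [hTv]), hTv]
  · rw [ZMod.val_add_of_le (by rw [hTv]; omega), hTv]

lemma pathFold_add_half_add_pathFold {T : ℕ} (hT : T + T = N) (s : ZMod N) :
    (pathFold (s + (T : ZMod N)) : ℕ) + (pathFold s : ℕ) = T := by
  have hN := Nat.pos_of_ne_zero (NeZero.ne N)
  have hs := ZMod.val_lt s
  rw [pathFold_eq_min, pathFold_eq_min, val_add_natCast_of_lt s (by omega)]
  split_ifs <;> omega

lemma half_le_abs_sub_pathFold_add {R : ℕ} (hR : 4 * R = N) (s : ZMod N) :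
    (2 * R : ℝ) ≤ |2 * R - 2 * ((pathFold s : ℕ) : ℝ)| +
      |2 * R - 2 * ((pathFold (s + (R : ZMod N)) : ℕ) : ℝ)| := by
  have hN := Nat.pos_of_ne_zero (NeZero.ne N)
  have hs := ZMod.val_lt s
  have key : (2 * R : ℤ) ≤ |2 * R - 2 * ((pathFold s : ℕ) : ℤ)| +
      |2 * R - 2 * ((pathFold (s + (R : ZMod N)) : ℕ) : ℤ)| := by
    have e1 := pathFold_eq_min s
    have e2 := pathFold_eq_min (s + (R : ZMod N))
    rw [val_add_natCast_of_lt s (by omega)] at e2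
    rcases abs_cases (2 * R - 2 * ((pathFold s : ℕ) : ℤ)) with h1 | h1 <;>
      rcases abs_cases (2 * R - 2 * ((pathFold (s + (R : ZMod N)) : ℕ) : ℤ)) with h2 | h2 <;>
      split_ifs at e2 <;> omega
  exact_mod_cast key

lemma le_sum_abs_sub_pathFold_rpow {q : ℝ} (hq : 0 < q) {R : ℕ} (hR : 4 * R = N) :
    (N : ℝ) * ((R : ℝ) ^ q / 2) ≤ ∑ s : ZMod N, |2 * R - 2 * ((pathFold s : ℕ) : ℝ)| ^ q := by
  set A : ZMod N → ℝ := fun s => |2 * R - 2 * ((pathFold s : ℕ) : ℝ)| with hA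
  have hA0 : ∀ s, 0 ≤ A s := fun s => abs_nonneg _
  have hpair : ∀ s, (R : ℝ) ^ q ≤ A s ^ q + A (s + (R : ZMod N)) ^ q := fun s => by
    have h := half_le_abs_sub_pathFold_add hR s
    rcases le_total (R : ℝ) (A s) with h' | h'
    · have := Real.rpow_le_rpow (Nat.cast_nonneg R) h' hq.le
      have := Real.rpow_nonneg (hA0 (s + (R : ZMod N))) q
      linarith
    · have h'' : (R : ℝ) ≤ A (s + (R : ZMod N)) := by
        simp only [hA] at h' ⊢
        linarith
      have := Real.rpow_le_rpow (Nat.cast_nonneg R) h'' hq.le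
      have := Real.rpow_nonneg (hA0 s) q
      linarith
  have hsum := sum_le_sum fun s (_ : s ∈ univ) => hpair s
  rw [sum_add_distrib, sum_comp_add_right (fun s => A s ^ q) (R : ZMod N), sum_const, card_univ,
    ZMod.card, nsmul_eq_mul] at hsum
  linarith

lemma gridDist_pathFold_add_rpow_le {n : ℕ} {p q : ℝ} (hp : 0 ≤ p) (hq : 0 < q)
    (x d : Fin n → ZMod N) :
    gridDist q (fun i => pathFold (x i + d i)) (fun i => pathFold (x i)) ^ p ≤
      (∑ i, ((d i).valMinAbs.natAbs : ℝ) ^ q) ^ (p / q) := by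
  rw [gridDist, lqDist, ← Real.rpow_mul (sum_nonneg fun i _ => by positivity), one_div_mul_eq_div]
  refine Real.rpow_le_rpow (sum_nonneg fun i _ => by positivity) (sum_le_sum fun i _ => ?_)
    (by positivity)
  exact Real.rpow_le_rpow (abs_nonneg _) (abs_pathFold_add_sub_pathFold_le _ _) hq.le

lemma sum_prod_geomKernel_mul_rpow_le {n : ℕ} {p q M : ℝ} (hq : 0 < q) (hqp : q ≤ p)
    (hM : ∑ t : ZMod N, geomKernel N t * (t.valMinAbs.natAbs : ℝ) ^ p ≤ M) :
    ∑ d : Fin n → ZMod N, (∏ k, geomKernel N (d k)) *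
      (∑ i, ((d i).valMinAbs.natAbs : ℝ) ^ q) ^ (p / q) ≤ (n : ℝ) ^ (p / q) * M := by
  have hpq : 1 ≤ p / q := by rwa [one_le_div hq]
  have hP0 : ∀ d : Fin n → ZMod N, 0 ≤ ∏ k, geomKernel N (d k) :=
    fun d => prod_nonneg fun k _ => (geomKernel_pos _).le
  have hbound : ∀ d : Fin n → ZMod N, (∑ i, ((d i).valMinAbs.natAbs : ℝ) ^ q) ^ (p / q) ≤
      (n : ℝ) ^ (p / q - 1) * ∑ i, ((d i).valMinAbs.natAbs : ℝ) ^ p := fun d => by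
    refine (Real.rpow_sum_le_const_mul_sum_rpow_of_nonneg univ hpq
      (fun i _ => by positivity)).trans_eq ?_
    rw [card_univ, Fintype.card_fin]
    congr 1
    refine sum_congr rfl fun i _ => ?_
    rw [← Real.rpow_mul (Nat.cast_nonneg _), mul_div_cancel₀ _ hq.ne']
  calc _ ≤ ∑ d : Fin n → ZMod N, (∏ k, geomKernel N (d k)) *
        ((n : ℝ) ^ (p / q - 1) * ∑ i, ((d i).valMinAbs.natAbs : ℝ) ^ p) :=
        sum_le_sum fun d _ => mul_le_mul_of_nonneg_left (hbound d) (hP0 d)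
    _ = (n : ℝ) ^ (p / q - 1) * ∑ i, ∑ d : Fin n → ZMod N, (∏ k, geomKernel N (d k)) *
        ((d i).valMinAbs.natAbs : ℝ) ^ p := by
        rw [sum_comm, mul_sum]
        refine sum_congr rfl fun d _ => ?_
        rw [← mul_sum]
        ring
    _ = (n : ℝ) ^ (p / q - 1) *
        ∑ _i : Fin n, ∑ t : ZMod N, geomKernel N t * (t.valMinAbs.natAbs : ℝ) ^ p := by
        congr 1
        exact sum_congr rfl fun i _ => sum_prod_mul (geomKernel N) sum_geomKernel
          (fun t => (t.valMinAbs.natAbs : ℝ) ^ p) i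
    _ ≤ (n : ℝ) ^ (p / q - 1) * (n * M) := by
        rw [sum_const, card_univ, Fintype.card_fin, nsmul_eq_mul]
        gcongr
    _ = (n : ℝ) ^ (p / q) * M := by
        rcases Nat.eq_zero_or_pos n with rfl | hn
        · simp [Real.zero_rpow (by linarith : p / q ≠ 0)]
        · rw [Real.rpow_sub_one (by positivity)]
          field_simp

lemma card_mul_rpow_le_sum_rpow {α : Type*} [Fintype α] {r a : ℝ} (hr : 1 ≤ r) (ha : 0 ≤ a)
    (z : α → ℝ) (hz : ∀ i, 0 ≤ z i) (h : (Fintype.card α : ℝ) * a ≤ ∑ i, z i) :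
    (Fintype.card α : ℝ) * a ^ r ≤ ∑ i, z i ^ r := by
  rcases isEmpty_or_nonempty α with hα | hα
  · simp
  have hc : (0 : ℝ) < Fintype.card α := by exact_mod_cast Fintype.card_pos
  have hJ := Real.rpow_arith_mean_le_arith_mean_rpow univ (fun _ : α => (Fintype.card α : ℝ)⁻¹) z
    (fun _ _ => by positivity) (by simp [hc.ne']) (fun i _ => hz i) hr
  rw [← mul_sum, ← mul_sum, inv_mul_eq_div, inv_mul_eq_div, le_div_iff₀' hc] at hJ
  refine le_trans (mul_le_mul_of_nonneg_left (Real.rpow_le_rpow ha ?_ (by linarith)) hc.le) hJ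
  rwa [le_div_iff₀' hc]

lemma sum_coloring_gridDist_pathFold_rpow_ge {n L R : ℕ} [NeZero L] {p q : ℝ} (hq : 0 < q)
    (hqp : q ≤ p) (hR : 4 * R = N) :
    (Fintype.card (Fin n → ZMod L) : ℝ) * Fintype.card (Fin n → ZMod N) *
        ((n : ℝ) / L * ((R : ℝ) ^ q / 2)) ^ (p / q) ≤
      ∑ c : Fin n → ZMod L, ∑ x : Fin n → ZMod N,
        gridDist q (fun i => pathFold ((x + ∑ j with c j = 0, (2 * R) • Pi.single j (1 : ZMod N)) i))
          (fun i => pathFold (x i)) ^ p := by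
  have hpq : 1 ≤ p / q := by rwa [one_le_div hq]
  have hL : (0 : ℝ) < L := by exact_mod_cast Nat.pos_of_ne_zero (NeZero.ne L)
  set A : ZMod N → ℝ := fun s => |2 * R - 2 * ((pathFold s : ℕ) : ℝ)| ^ q with hA
  have hA0 : ∀ s, 0 ≤ A s := fun s => by positivity
  set z : (Fin n → ZMod L) × (Fin n → ZMod N) → ℝ :=
    fun w => ∑ j, if w.1 j = 0 then A (w.2 j) else 0 with hz
  have hz0 : ∀ w, 0 ≤ z w := fun w => sum_nonneg fun j _ => by split_ifs <;> simp [hA0]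
  have hcoord : ∀ (c : Fin n → ZMod L) (i : Fin n),
      (∑ j with c j = 0, (2 * R) • Pi.single j (1 : ZMod N) : Fin n → ZMod N) i =
        if c i = 0 then ((2 * R : ℕ) : ZMod N) else 0 := fun c i => by
    simp [Finset.sum_apply, Pi.single_apply]
  have hterm : ∀ c x, z (c, x) ^ (p / q) ≤
      gridDist q (fun i => pathFold ((x + ∑ j with c j = 0, (2 * R) • Pi.single j (1 : ZMod N)) i))
          (fun i => pathFold (x i)) ^ p := fun c x => by
    rw [gridDist, lqDist, ← Real.rpow_mul (sum_nonneg fun i _ => by positivity),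
      one_div_mul_eq_div]
    refine Real.rpow_le_rpow (hz0 _) (sum_le_sum fun i _ => ?_) (by linarith)
    rw [Pi.add_apply, hcoord]
    dsimp only
    split_ifs with h
    · have h2 := pathFold_add_half_add_pathFold (T := 2 * R) (by omega) (x i)
      have h3 : ((pathFold (x i + ((2 * R : ℕ) : ZMod N)) : ℕ) : ℝ) =
          2 * R - ((pathFold (x i) : ℕ) : ℝ) := by
        rw [eq_sub_iff_add_eq]
        exact_mod_cast h2
      rw [h3]
      exact le_of_eq (by simp only [hA]; congr 2; ring)
    · positivity
  have hfiber : ∀ j, (Fintype.card (Fin n → ZMod N) : ℝ) * ((R : ℝ) ^ q / 2) ≤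
      ∑ x : Fin n → ZMod N, A (x j) := fun j => by
    have h1 := le_sum_abs_sub_pathFold_rpow hq hR
    have hN : (0 : ℝ) < N := by exact_mod_cast Nat.pos_of_ne_zero (NeZero.ne N)
    have h2 := sum_prod_mul (ι := Fin n) (fun _ : ZMod N => (N : ℝ)⁻¹)
      (by simp [ZMod.card, hN.ne']) A j
    simp only [prod_const, card_univ, Fintype.card_fin] at h2
    rw [← mul_sum, ← mul_sum, inv_pow, inv_mul_eq_div, inv_mul_eq_div,
      div_eq_div_iff (by positivity) hN.ne'] at h2
    have h3 : (Fintype.card (Fin n → ZMod N) : ℝ) = (N : ℝ) ^ n := by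
      simp [ZMod.card]
    rw [h3]
    refine le_of_mul_le_mul_right ?_ hN
    refine le_trans ?_ h2.symm.le
    calc _ = (N : ℝ) * ((R : ℝ) ^ q / 2) * (N : ℝ) ^ n := by ring
      _ ≤ _ := mul_le_mul_of_nonneg_right h1 (by positivity)
  have hsum : (Fintype.card ((Fin n → ZMod L) × (Fin n → ZMod N)) : ℝ) *
      ((n : ℝ) / L * ((R : ℝ) ^ q / 2)) ≤ ∑ w, z w := by
    have e : (L : ℝ) * ∑ w, z w =
        ∑ j, ∑ x : Fin n → ZMod N, (Fintype.card (Fin n → ZMod L) : ℝ) * A (x j) := by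
      calc (L : ℝ) * ∑ w, z w
          = L * ∑ j, ∑ x : Fin n → ZMod N, ∑ c : Fin n → ZMod L,
              (if c j = 0 then A (x j) else 0) := by
            rw [sum_comm]
            congr 1
            exact sum_congr rfl fun j _ => Fintype.sum_prod_type_right _
        _ = ∑ j, ∑ x : Fin n → ZMod N, (L : ℝ) * ∑ c : Fin n → ZMod L,
              (if c j = 0 then A (x j) else 0) := by
            simp only [mul_sum]
        _ = _ := by
            refine sum_congr rfl fun j _ => sum_congr rfl fun x _ => ?_
            refine (sum_coloring_ite_eq (L := L) j (fun _ => A (x j)) fun _ _ => rfl).trans ?_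
            rw [sum_const, card_univ, nsmul_eq_mul]
    refine le_of_mul_le_mul_left ?_ hL
    rw [e, Fintype.card_prod, Nat.cast_mul]
    calc _ = ∑ _j : Fin n, (Fintype.card (Fin n → ZMod L) : ℝ) *
          ((Fintype.card (Fin n → ZMod N) : ℝ) * ((R : ℝ) ^ q / 2)) := by
          rw [sum_const, card_univ, Fintype.card_fin, nsmul_eq_mul]
          field_simp
      _ ≤ _ := by
          refine sum_le_sum fun j _ => ?_
          rw [← mul_sum]
          exact mul_le_mul_of_nonneg_left (hfiber j) (by positivity)
  have hmain := card_mul_rpow_le_sum_rpow hpq (by positivity) z hz0 hsum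
  rw [Fintype.card_prod, Nat.cast_mul, Fintype.sum_prod_type] at hmain
  exact hmain.trans (sum_le_sum fun c _ => sum_le_sum fun x _ => hterm c x)

end Fold

lemma div_natDiv_le_two_mul {n k : ℕ} (hk : 1 ≤ k) (hkn : k ≤ n) :
    (n : ℝ) / ((n / k : ℕ) : ℝ) ≤ 2 * k := by
  have hL : 1 ≤ n / k := (Nat.one_le_div_iff hk).2 hkn
  have h : n < k * (n / k) + k := by
    rw [← Nat.mul_succ]
    exact Nat.lt_mul_div_succ n hk
  have h2 : n ≤ 2 * k * (n / k) := by nlinarith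
  rw [div_le_iff₀ (by exact_mod_cast hL)]
  exact_mod_cast h2

lemma le_div_natDiv {n k : ℕ} (hk : 1 ≤ k) (hkn : k ≤ n) :
    (k : ℝ) ≤ (n : ℝ) / ((n / k : ℕ) : ℝ) := by
  have hL : 1 ≤ n / k := (Nat.one_le_div_iff hk).2 hkn
  rw [le_div_iff₀ (by exact_mod_cast hL)]
  exact_mod_cast Nat.mul_div_le n k

lemma one_le_rpow_mul_div_rpow {p m n k : ℝ} (hp : 0 ≤ p) (hm : 0 < m) (hn : 0 < n) (hk : 0 < k)
    (h : n / (16 * m ^ 2) ≤ k) : 1 ≤ (16 * m) ^ p * (k / n) ^ (p / 2) := by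
  have e : (16 * m) ^ p = ((16 * m) ^ 2) ^ (p / 2) := by
    rw [← Real.rpow_natCast, ← Real.rpow_mul (by positivity)]
    congr 1; push_cast; ring
  rw [e, ← Real.mul_rpow (by positivity) (by positivity)]
  refine Real.one_le_rpow ?_ (by positivity)
  rw [div_le_iff₀ (by positivity)] at h
  rw [← mul_div_assoc, one_le_div hn]
  nlinarith [mul_pos hk (pow_pos hm 2)]

lemma mul_rpow_div_le_of_rpow_le {p q A D W k : ℝ} (hp : 0 < p) (hA : 0 < A) (hD : 0 ≤ D)
    (hW : 0 < W) (hk : 0 ≤ k) (h : k ^ (p / q) ≤ A * D ^ p * W) :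
    A⁻¹ ^ (1 / p) * k ^ (1 / q) / W ^ (1 / p) ≤ D := by
  rw [div_le_iff₀ (by positivity)]
  have h1 := Real.rpow_le_rpow (by positivity) h (by positivity : 0 ≤ 1 / p)
  rw [← Real.rpow_mul hk, Real.mul_rpow (by positivity) hW.le, Real.mul_rpow hA.le (by positivity),
    ← Real.rpow_mul hD, mul_one_div_cancel hp.ne', Real.rpow_one] at h1
  have e : p / q * (1 / p) = 1 / q := by field_simp
  rw [e] at h1
  rw [Real.inv_rpow hA.le, inv_mul_le_iff₀ (by positivity)]
  linarith

/-- **Inequality (1.7): the distortion lower bound for embeddings of grids.**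
Let `2 ≤ q < p < ∞`. There is `c = c(p) > 0` depending only on `p` such that for all
`m, n ∈ ℕ`, `D ∈ [1,∞)` and every `φ : [32m]_q^n → L_p` with
`‖x-y‖_{ℓ_q^n} ≤ ‖φ(x) - φ(y)‖_{L_p} ≤ D ‖x-y‖_{ℓ_q^n}`, and every `k ∈ [n]` with
`k ≥ n/(16m²)`, one has `D ≥ c k^{1/q}/(k + k^{p/2} n^{p/q - p/2})^{1/p}`. -/
theorem grid_embedding_lower_bound (p : ℝ) (hp : 2 ≤ p) :
    ∃ c : ℝ, 0 < c ∧ ∀ q : ℝ, 2 ≤ q → q < p → ∀ m n : ℕ, 0 < m → 0 < n →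
      ∀ D : ℝ, 1 ≤ D → ∀ φ : (Fin n → Fin (32 * m)) → LpSpace p,
      (∀ x y : Fin n → Fin (32 * m),
        gridDist q x y ≤ ‖φ x - φ y‖ ∧ ‖φ x - φ y‖ ≤ D * gridDist q x y) →
      ∀ k : ℕ, 1 ≤ k → k ≤ n → (n : ℝ) / (16 * (m : ℝ) ^ 2) ≤ (k : ℝ) →
      c * (k : ℝ) ^ (1 / q) /
          ((k : ℝ) + (k : ℝ) ^ (p / 2) * (n : ℝ) ^ (p / q - p / 2)) ^ (1 / p) ≤ D := by
  obtain ⟨C, hC, hXp⟩ := exists_sum_coloring_norm_sub_rpow_le hp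
  have hp0 : 0 < p := by linarith
  obtain ⟨M, hM0, hM⟩ := exists_sum_geomKernel_mul_rpow_le hp0
  set B : ℝ := 2 + (2 ^ (p / 2) + 1) * M with hB
  have hB0 : 0 < B := by positivity
  refine ⟨(4 ^ p * C * B)⁻¹ ^ (1 / p), by positivity, ?_⟩
  intro q hq2 hqp m n hm hn D hD φ hφ k hk hkn hnk
  have hq : 0 < q := by linarith
  have hm' : (0 : ℝ) < m := by exact_mod_cast hm
  have hn' : (0 : ℝ) < n := by exact_mod_cast hn
  have hk' : (0 : ℝ) < k := by exact_mod_cast hk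
  have hD0 : 0 ≤ D := by linarith
  refine mul_rpow_div_le_of_rpow_le hp0 (by positivity) hD0 (by positivity) hk'.le ?_
  have : NeZero (32 * m) := ⟨by omega⟩
  have : NeZero (n / k) := ⟨(Nat.div_pos hkn hk).ne'⟩
  set L := n / k with hLdef
  have hL : (0 : ℝ) < L := by exact_mod_cast Nat.div_pos hkn hk
  set r := p / q with hr
  have hr0 : 0 < r := by positivity
  set K : ℝ := (Fintype.card (Fin n → ZMod L) : ℝ) with hK
  set V : ℝ := (Fintype.card (Fin n → ZMod (32 * m)) : ℝ) with hV
  have hK0 : 0 < K := by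
    rw [hK]
    exact_mod_cast Fintype.card_pos
  have hV0 : 0 < V := by
    rw [hV]
    exact_mod_cast Fintype.card_pos
  set f : (Fin n → ZMod (32 * m)) → LpSpace p := fun x => φ fun i => pathFold (x i) with hf
  have hupper : ∀ x d, ‖f (x + d) - f x‖ ^ p ≤
      D ^ p * (∑ i, ((d i).valMinAbs.natAbs : ℝ) ^ q) ^ r := fun x d => by
    have h0 : 0 ≤ gridDist q (fun i => pathFold ((x + d) i)) fun i => pathFold (x i) :=
      Real.rpow_nonneg (sum_nonneg fun i _ => by positivity) _
    have h1 : ‖f (x + d) - f x‖ ^ p ≤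
        (D * gridDist q (fun i => pathFold ((x + d) i)) fun i => pathFold (x i)) ^ p :=
      Real.rpow_le_rpow (h0.trans (hφ _ _).1) (hφ _ _).2 hp0.le
    rw [Real.mul_rpow hD0 h0] at h1
    exact h1.trans (mul_le_mul_of_nonneg_left (gridDist_pathFold_add_rpow_le hp0.le hq x d)
      (by positivity))
  have hedge : ∑ j, ∑ x, ‖f (x + Pi.single j 1) - f x‖ ^ p ≤ n * (V * D ^ p) := by
    have hone : ∀ j : Fin n, (∑ i, (((Pi.single j 1 : Fin n → ZMod (32 * m)) i).valMinAbs.natAbs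
        : ℝ) ^ q) ^ r ≤ 1 := fun j => by
      refine Real.rpow_le_one (sum_nonneg fun i _ => by positivity) ?_ hr0.le
      rw [sum_eq_single j (fun i _ hij => by simp [Pi.single_eq_of_ne hij, Real.zero_rpow hq.ne'])
        (by simp), Pi.single_eq_same]
      exact Real.rpow_le_one (by positivity) (by exact_mod_cast natAbs_valMinAbs_one_le) hq.le
    calc _ ≤ ∑ _j : Fin n, ∑ _x : Fin n → ZMod (32 * m), D ^ p :=
          sum_le_sum fun j _ => sum_le_sum fun x _ => (hupper x _).trans
            (mul_le_of_le_one_right (by positivity) (hone j))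
      _ = _ := by simp [hV]
  have hsmooth : ∑ x, ∑ d : Fin n → ZMod (32 * m),
      (∏ i, geomKernel (32 * m) (d i)) * ‖f (x + d) - f x‖ ^ p ≤ V * (D ^ p * (n ^ r * M)) := by
    have hd := sum_prod_geomKernel_mul_rpow_le (n := n) hq hqp.le (hM (32 * m))
    calc _ ≤ ∑ _x : Fin n → ZMod (32 * m), D ^ p * (n ^ r * M) := by
          refine sum_le_sum fun x _ => ?_
          refine le_trans ?_ (mul_le_mul_of_nonneg_left hd (by positivity : 0 ≤ D ^ p))
          rw [mul_sum]
          refine sum_le_sum fun d _ => ?_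
          rw [mul_left_comm]
          exact mul_le_mul_of_nonneg_left (hupper x d)
            (prod_nonneg fun i _ => (geomKernel_pos _).le)
      _ = _ := by simp [hV]
  have hlower : K * V * ((n : ℝ) / L * (((8 * m : ℕ) : ℝ) ^ q / 2)) ^ r ≤
      ∑ c : Fin n → ZMod L, ∑ x, ‖f (x + ∑ j with c j = 0,
        (2 * (8 * m)) • Pi.single j (1 : ZMod (32 * m))) - f x‖ ^ p := by
    refine (sum_coloring_gridDist_pathFold_rpow_ge hq hqp.le (by ring)).trans
      (sum_le_sum fun c _ => sum_le_sum fun x _ => ?_)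
    exact Real.rpow_le_rpow (Real.rpow_nonneg (sum_nonneg fun i _ => by positivity) _)
      (hφ _ _).1 hp0.le
  have hT : ((2 * (8 * m) + 2 * (8 * m) : ℕ) : ZMod (32 * m)) = 0 := by
    rw [show 2 * (8 * m) + 2 * (8 * m) = 32 * m by ring, ZMod.natCast_self]
  have hmain := hlower.trans (hXp n (32 * m) L (2 * (8 * m)) hT f)
  set T : ℝ := ((2 * (8 * m) : ℕ) : ℝ) with hTdef
  have hTm : T = 16 * m := by rw [hTdef]; push_cast; ring
  have hT0 : 0 < T := by rw [hTm]; positivity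
  have hLk : (1 : ℝ) / L ≤ 2 * (k / n) := by
    have h := div_natDiv_le_two_mul hk hkn
    rw [div_le_iff₀ hL] at h
    rw [div_le_iff₀ hL, ← mul_div_assoc, div_mul_eq_mul_div, le_div_iff₀ hn']
    linarith
  have hL1 : T ^ p / L * (n * (V * D ^ p)) ≤ V * D ^ p * T ^ p * (2 * k) := by
    calc _ = V * D ^ p * T ^ p * (n / L) := by ring
      _ ≤ _ := mul_le_mul_of_nonneg_left (div_natDiv_le_two_mul hk hkn) (by positivity)
  have hL2 : T ^ p / (L : ℝ) ^ (p / 2) + 1 ≤ T ^ p * ((2 ^ (p / 2) + 1) * (k / n) ^ (p / 2)) := by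
    have h1 := Real.rpow_le_rpow (by positivity) hLk (by positivity : 0 ≤ p / 2)
    rw [Real.div_rpow zero_le_one hL.le, Real.one_rpow,
      Real.mul_rpow two_pos.le (by positivity)] at h1
    have h2 := one_le_rpow_mul_div_rpow hp0.le hm' hn' hk' hnk
    rw [← hTm] at h2
    have h3 := mul_le_mul_of_nonneg_left h1 (by positivity : 0 ≤ T ^ p)
    calc _ = T ^ p * (1 / (L : ℝ) ^ (p / 2)) + 1 := by ring
      _ ≤ T ^ p * (2 ^ (p / 2) * (k / n) ^ (p / 2)) + T ^ p * (k / n) ^ (p / 2) := add_le_add h3 h2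
      _ = _ := by ring
  have hlow : (k : ℝ) ^ r * T ^ p / 4 ^ p ≤ ((n : ℝ) / L * (((8 * m : ℕ) : ℝ) ^ q / 2)) ^ r := by
    have e8 : ((8 * m : ℕ) : ℝ) = T / 2 := by rw [hTdef]; push_cast; ring
    have hqr : q * r = p := by rw [hr]; field_simp
    have h2r : (2 : ℝ) ^ r ≤ 2 ^ p :=
      Real.rpow_le_rpow_of_exponent_le one_le_two (div_le_self hp0.le (by linarith))
    have h4 : (4 : ℝ) ^ p = 2 ^ p * 2 ^ p := by
      rw [← Real.mul_rpow two_pos.le two_pos.le]; norm_num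
    rw [Real.mul_rpow (by positivity) (by positivity), Real.div_rpow (by positivity) two_pos.le,
      ← Real.rpow_mul (by positivity), hqr, e8, Real.div_rpow hT0.le two_pos.le]
    calc _ = (k : ℝ) ^ r * (T ^ p / 2 ^ p / 2 ^ p) := by rw [h4]; field_simp
      _ ≤ _ := by
        gcongr
        exact le_div_natDiv hk hkn
  have hkn_rpow : (k / n : ℝ) ^ (p / 2) * n ^ r = k ^ (p / 2) * n ^ (r - p / 2) := by
    rw [Real.div_rpow hk'.le hn'.le, Real.rpow_sub hn']
    ring
  set X : ℝ := (k : ℝ) ^ (p / 2) * n ^ (r - p / 2) with hX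
  have hX0 : 0 ≤ X := by positivity
  have hfinal : K * V * ((k : ℝ) ^ r * T ^ p / 4 ^ p) ≤
      K * V * (C * (D ^ p * (T ^ p * (B * (k + X))))) := by
    refine (mul_le_mul_of_nonneg_left hlow (by positivity)).trans (hmain.trans ?_)
    rw [mul_assoc K V]
    refine mul_le_mul_of_nonneg_left ?_ hK0.le
    rw [mul_left_comm V C]
    refine mul_le_mul_of_nonneg_left ?_ hC.le
    calc _ ≤ T ^ p / L * (n * (V * D ^ p)) +
          (T ^ p / (L : ℝ) ^ (p / 2) + 1) * (V * (D ^ p * (n ^ r * M))) := by gcongr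
      _ ≤ V * D ^ p * T ^ p * (2 * k) + T ^ p * ((2 ^ (p / 2) + 1) * (k / n) ^ (p / 2)) *
          (V * (D ^ p * (n ^ r * M))) := by gcongr
      _ = V * D ^ p * T ^ p * (2 * k + (2 ^ (p / 2) + 1) * M * X) := by
          rw [← hkn_rpow]
          ring
      _ ≤ V * D ^ p * T ^ p * (B * (k + X)) := by
          refine mul_le_mul_of_nonneg_left ?_ (by positivity)
          have h1 : 0 ≤ (2 ^ (p / 2) + 1) * M * k := by positivity
          rw [hB]
          linarith
      _ = _ := by ring
  have hfinal' := le_of_mul_le_mul_left hfinal (by positivity)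
  rw [div_le_iff₀ (by positivity)] at hfinal'
  refine le_of_mul_le_mul_right (hfinal'.trans_eq ?_) (by positivity : 0 < T ^ p)
  ring
end
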